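/- Let i ≥ 2 be such that #f_{i−1} = 2 and #f_i = #f_{i+1} = 1, write f_i = {d}, and let J be an invariant-factor count function for d. Then for every x ∈ ℝ, lim_{n→∞} (1/n)·#{1 ≤ m ≤ n : J(m) ≤ μ_i·log log n + x·σ_i·(log log n)^{1/2}} = Φ(x; −ν_i/(σ_i² + σ_{i;2,1}²)^{1/2}). -/

import Mathlib

open MeasureTheory ProbabilityTheory Filter

noncomputable section

/-- A key encoding the lexicographic order on pairs `(φ(q), q)`; this is a valid
encoding on prime powers since every prime power satisfies `q ≤ 2 * φ(q)`. -/
def ppKey (q : ℕ) : ℕ := 2 * Nat.totient q ^ 2 + q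

/-- The `n`-th smallest key of a prime power (0-indexed). -/
def ppNthKey (n : ℕ) : ℕ := Nat.nth (fun k => ∃ q : ℕ, IsPrimePow q ∧ ppKey q = k) n

/-- The total φ-sequence `q̃_i` (1-indexed): the enumeration of all prime powers
ordered by nondecreasing totient, with ties broken by increasing size. -/
def qt (i : ℕ) : ℕ := sInf {q : ℕ | IsPrimePow q ∧ ppKey q = ppNthKey (i - 1)}

/-- `lcm(q̃_1, …, q̃_i)`. -/
def Lseq (i : ℕ) : ℕ := (Finset.Icc 1 i).lcm qt

/-- The universal factor order set `f_i`. -/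
def UFO (i : ℕ) : Set ℕ :=
  if Nat.totient (qt i) < Nat.totient (qt (i + 1)) then {Lseq i}
  else {Lseq i, Nat.lcm (Lseq (i - 1)) (qt (i + 1))}

/-- `φ(q̃_i)` as a real number. -/
def phiQ (i : ℕ) : ℝ := (Nat.totient (qt i) : ℝ)

/-- `μ_i = 1/φ(q̃_i) − 1/φ(q̃_{i+1})`. -/
def muSeq (i : ℕ) : ℝ := 1 / phiQ i - 1 / phiQ (i + 1)

/-- `σ_i = (1/φ(q̃_i) + 1/φ(q̃_{i+1}) − 2/(φ(q̃_i)·φ(q̃_{i+1})))^{1/2}`. -/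
def sigSeq (i : ℕ) : ℝ :=
  Real.sqrt (1 / phiQ i + 1 / phiQ (i + 1) - 2 / (phiQ i * phiQ (i + 1)))

/-- `σ_{i;a,b} = (φ(q̃_i)^{−a} + φ(q̃_{i+1})^{−b} − 2/(φ(q̃_i)·φ(q̃_{i+1})))^{1/2}`. -/
def sigAB (i a b : ℕ) : ℝ :=
  Real.sqrt (1 / phiQ i ^ a + 1 / phiQ (i + 1) ^ b - 2 / (phiQ i * phiQ (i + 1)))

/-- `ν_j = (φ(q̃_j)^{−1}·(1 − φ(q̃_j)^{−1}))^{1/2}`. -/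
def nuSeq (j : ℕ) : ℝ := Real.sqrt (1 / phiQ j * (1 - 1 / phiQ j))

/-- `J` is an invariant-factor count function for `d`: whenever `(ℤ/mℤ)ˣ` is isomorphic to
a direct product of cyclic groups `ℤ/λ_1 × ⋯ × ℤ/λ_K` with `1 < λ_1 ∣ λ_2 ∣ ⋯ ∣ λ_K`,
`J m` is the number of indices `j` with `λ_j = d`. -/
def IsInvCount (d : ℕ) (J : ℕ → ℕ) : Prop :=
  ∀ m : ℕ, 1 ≤ m → ∀ K : ℕ, ∀ lam : Fin K → ℕ,
    (∀ j, 1 < lam j) →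
    (∀ j k : Fin K, j ≤ k → lam j ∣ lam k) →
    Nonempty ((ZMod m)ˣ ≃* Multiplicative (∀ j : Fin K, ZMod (lam j))) →
    J m = (Finset.univ.filter fun j : Fin K => lam j = d).card

/-- The number of `m ∈ {1, …, n}` satisfying `P`. -/
def cnt (P : ℕ → Prop) (n : ℕ) : ℕ := {m : ℕ | 1 ≤ m ∧ m ≤ n ∧ P m}.ncard

/-- The average `(1/n)·∑_{m=1}^n J(m)`. -/
def avg (J : ℕ → ℕ) (n : ℕ) : ℝ := (∑ m ∈ Finset.Icc 1 n, (J m : ℝ)) / n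

/-- `log log n`. -/
def LL (n : ℕ) : ℝ := Real.log (Real.log n)

/-- The standard normal cumulative distribution function. -/
def Phi (x : ℝ) : ℝ := (Real.sqrt (2 * Real.pi))⁻¹ * ∫ t in Set.Iic x, Real.exp (-t ^ 2 / 2)

/-- Owen's T-function. -/
def OwenT (h a : ℝ) : ℝ :=
  (2 * Real.pi)⁻¹ * ∫ t in (0:ℝ)..a, Real.exp (-(1 + t ^ 2) * h ^ 2 / 2) / (1 + t ^ 2)

/-- The skew-normal cumulative distribution function with parameter `α`. -/
def PhiSkew (x α : ℝ) : ℝ := Phi x - 2 * OwenT x α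

/-- The standard Gaussian probability measure `γ^k` on `ℝ^k`. -/
def stdGaussian (k : ℕ) : Measure (Fin k → ℝ) :=
  Measure.pi fun _ => gaussianReal 0 1

/-- `ω(m;q,1)`: the number of distinct primes `p ∣ m` with `p ≡ 1 (mod q)`. -/
def omegaQ (m q : ℕ) : ℕ := (m.primeFactors.filter fun p => p % q = 1 % q).card

/-- The correction term `Ē(m;p^α)`. -/
def Ebar (m p α : ℕ) : ℕ :=
  if p ^ α = 2 ∧ 8 ∣ m then 2
  else if p ^ α = 2 ∧ 4 ∣ m ∧ ¬(8 ∣ m) then 1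
  else if p = 2 ∧ 2 ≤ α ∧ 2 ^ (α + 2) ∣ m then 1
  else if p ≠ 2 ∧ p ^ (α + 1) ∣ m then 1
  else 0

/-- `prm(m;q)` for a prime power `q = p^α`: the unique `k` such that `p^k` is the cardinality
of the subgroup `{x ∈ (ℤ/mℤ)ˣ : x^p = 1 and x = y^{p^{α−1}} for some y}` (obtained here as the
`p`-adic valuation of that cardinality; note `p = q.minFac` and `p^{α−1} = q / p`). -/
def prm (m q : ℕ) : ℕ :=
  (Nat.card {x : (ZMod m)ˣ // x ^ q.minFac = 1 ∧ ∃ y : (ZMod m)ˣ, y ^ (q / q.minFac) = x}).factorization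
    q.minFac

/-- `m` is `y`-typical: for all prime powers `q₁, q₂` with `φ(q₁) ≤ y` and `φ(q₁) < φ(q₂)`
one has `prm(m;q₁) > prm(m;q₂)`. -/
def yTypical (y : ℝ) (m : ℕ) : Prop :=
  ∀ q₁ q₂ : ℕ, IsPrimePow q₁ → IsPrimePow q₂ →
    (Nat.totient q₁ : ℝ) ≤ y → Nat.totient q₁ < Nat.totient q₂ →
    prm m q₂ < prm m q₁

/-- The sum of `p^{-σ}` over the primes `p ≡ 1 (mod q)`. -/
def primeZeta (q : ℕ) (σ : ℝ) : ℝ :=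
  ∑' p : Nat.Primes, if (p : ℕ) % q = 1 % q then ((p : ℕ) : ℝ) ^ (-σ) else 0

lemma summable_primeZeta (q : ℕ) {σ : ℝ} (hσ : 1 < σ) :
    Summable fun p : Nat.Primes =>
      if (p : ℕ) % q = 1 % q then ((p : ℕ) : ℝ) ^ (-σ) else 0 := by
  have h : Summable fun p : Nat.Primes => ((p : ℕ) : ℝ) ^ (-σ) :=
    Nat.Primes.summable_rpow.mpr (by linarith)
  refine Summable.of_nonneg_of_le (fun p => ?_) (fun p => ?_) h
  · split_ifs <;> positivity
  · split_ifs
    · exact le_rfl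
    · positivity

lemma norm_natCast_cpow_neg_ofReal {p : ℕ} (hp : 0 < p) (σ : ℝ) :
    ‖(p : ℂ) ^ (-(σ : ℂ))‖ = (p : ℝ) ^ (-σ) := by
  rw [Complex.norm_natCast_cpow_of_pos hp]; simp

lemma abs_neg_log_one_sub_sub_re_le {z : ℂ} (hz : ‖z‖ ≤ 1 / 2) :
    |(-Complex.log (1 - z)).re - z.re| ≤ ‖z‖ ^ 2 := by
  have h := Complex.norm_log_one_add_sub_self_le (z := -z) (by rw [norm_neg]; linarith)
  rw [norm_neg] at h
  have h2 : ‖z‖ ^ 2 * (1 - ‖z‖)⁻¹ / 2 ≤ ‖z‖ ^ 2 := by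
    have : (1 - ‖z‖)⁻¹ ≤ 2 := by
      rw [inv_le_comm₀ (by linarith) (by norm_num)]; linarith
    nlinarith [sq_nonneg ‖z‖]
  have h3 : |(Complex.log (1 + -z) - -z).re| ≤ ‖z‖ ^ 2 :=
    (Complex.abs_re_le_norm _).trans (h.trans h2)
  rw [← abs_neg] at h3
  convert h3 using 2
  simp [sub_eq_add_neg]
  ring

lemma log_norm_LSeries_eq (q : ℕ) (χ : DirichletCharacter ℂ q) {σ : ℝ} (hσ : 1 < σ) :
    Real.log ‖LSeries (fun n => χ n) σ‖
      = ∑' p : Nat.Primes, (-Complex.log (1 - χ p * (p : ℂ) ^ (-(σ : ℂ)))).re := by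
  have hs : 1 < (σ : ℂ).re := by simpa using hσ
  rw [← DirichletCharacter.LSeries_eulerProduct_exp_log χ hs, Complex.norm_exp, Real.log_exp,
    Complex.re_tsum (χ.summable_neg_log_one_sub_mul_prime_cpow hs)]

lemma abs_sum_log_norm_LSeries_sub_le (q : ℕ) [NeZero q] {σ : ℝ} (hσ : 1 < σ) :
    |∑ χ : DirichletCharacter ℂ q, Real.log ‖LSeries (fun n => χ n) σ‖
      - q.totient * primeZeta q σ| ≤ q.totient * ∑' p : Nat.Primes, ((p : ℕ) : ℝ) ^ (-2 : ℝ) := by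
  have hs : 1 < (σ : ℂ).re := by simpa using hσ
  have hsum : ∀ χ : DirichletCharacter ℂ q, Summable fun p : Nat.Primes =>
      (-Complex.log (1 - χ p * (p : ℂ) ^ (-(σ : ℂ)))).re := fun χ =>
    (Complex.hasSum_re (χ.summable_neg_log_one_sub_mul_prime_cpow hs).hasSum).summable
  have hcard : (Fintype.card (DirichletCharacter ℂ q) : ℝ) = q.totient := by
    rw [← Nat.card_eq_fintype_card, DirichletCharacter.card_eq_totient_of_hasEnoughRootsOfUnity]
  simp_rw [log_norm_LSeries_eq q _ hσ]
  rw [← Summable.tsum_finsetSum (fun χ _ => hsum χ), primeZeta, ← tsum_mul_left,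
    ← Summable.tsum_sub (summable_sum fun χ _ => hsum χ)
      ((summable_primeZeta q hσ).mul_left _), ← tsum_mul_left]
  have hbd : ∀ p : Nat.Primes,
      ‖∑ χ : DirichletCharacter ℂ q, (-Complex.log (1 - χ p * (p : ℂ) ^ (-(σ : ℂ)))).re
        - q.totient * (if (p : ℕ) % q = 1 % q then ((p : ℕ) : ℝ) ^ (-σ) else 0)‖
        ≤ q.totient * ((p : ℕ) : ℝ) ^ (-2 : ℝ) := by
    intro p
    have hp := p.prop
    have hp2 : (2 : ℝ) ≤ (p : ℕ) := by exact_mod_cast hp.two_le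
    have horth : ∑ χ : DirichletCharacter ℂ q, (χ p * (p : ℂ) ^ (-(σ : ℂ))).re
        = q.totient * (if (p : ℕ) % q = 1 % q then ((p : ℕ) : ℝ) ^ (-σ) else 0) := by
      rw [← Complex.re_sum, ← Finset.sum_mul, DirichletCharacter.sum_characters_eq]
      have h1 : (((p : ℕ) : ZMod q) = 1) ↔ (p : ℕ) % q = 1 % q := by
        rw [← ZMod.natCast_eq_natCast_iff', Nat.cast_one]
      have h2 : ((p : ℕ) : ℂ) ^ (-(σ : ℂ)) = (((p : ℕ) : ℝ) ^ (-σ) : ℝ) := by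
        rw [Complex.ofReal_cpow (by positivity)]; simp
      by_cases h : (p : ℕ) % q = 1 % q
      · rw [if_pos (h1.2 h), if_pos h, h2]
        rw [← Complex.ofReal_natCast, ← Complex.ofReal_mul, Complex.ofReal_re]
      · rw [if_neg (fun h' => h (h1.1 h')), if_neg h]; simp
    have hz : ∀ χ : DirichletCharacter ℂ q, ‖χ p * (p : ℂ) ^ (-(σ : ℂ))‖ ≤ ((p : ℕ) : ℝ)⁻¹ := by
      intro χ
      rw [norm_mul, norm_natCast_cpow_neg_ofReal hp.pos, ← Real.rpow_neg_one]
      calc _ ≤ 1 * ((p : ℕ) : ℝ) ^ (-σ) := by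
            gcongr; exact χ.norm_le_one _
        _ ≤ _ := by
            rw [one_mul]
            exact Real.rpow_le_rpow_of_exponent_le (by linarith) (by linarith)
    rw [← horth, ← Finset.sum_sub_distrib, ← hcard, ← nsmul_eq_mul, ← Finset.card_univ]
    refine (norm_sum_le _ _).trans (Finset.sum_le_card_nsmul _ _ _ fun χ _ => ?_)
    have h12 : ((p : ℕ) : ℝ)⁻¹ ≤ 1 / 2 := by
      rw [inv_le_comm₀ (by linarith) (by norm_num)]; norm_num; exact hp.two_le
    refine (abs_neg_log_one_sub_sub_re_le ((hz χ).trans h12)).trans ?_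
    rw [show (-2 : ℝ) = (-1) * (2 : ℕ) by norm_num, Real.rpow_mul (by positivity),
      Real.rpow_natCast, Real.rpow_neg_one]
    exact pow_le_pow_left₀ (norm_nonneg _) (hz χ) 2
  have hS : Summable fun p : Nat.Primes => (q.totient : ℝ) * ((p : ℕ) : ℝ) ^ (-2 : ℝ) :=
    (Nat.Primes.summable_rpow.mpr (by norm_num)).mul_left _
  exact tsum_of_norm_bounded hS.hasSum hbd

lemma succ_rpow_neg_le_sub {σ : ℝ} (hσ : 1 < σ) {k : ℕ} (hk : 1 ≤ k) :
    ((k + 1 : ℕ) : ℝ) ^ (-σ) ≤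
      ((k : ℝ) ^ (1 - σ) - ((k + 1 : ℕ) : ℝ) ^ (1 - σ)) / (σ - 1) := by
  have hk0 : (0 : ℝ) < k := by exact_mod_cast hk
  have hk1 : (0 : ℝ) < ((k + 1 : ℕ) : ℝ) := by positivity
  rw [le_div_iff₀ (by linarith)]
  have h1 : (k : ℝ) ^ (1 - σ) = ((k + 1 : ℕ) : ℝ) ^ (1 - σ) *
      Real.exp ((σ - 1) * (-Real.log (k / ((k + 1 : ℕ) : ℝ)))) := by
    rw [Real.rpow_def_of_pos hk0, Real.rpow_def_of_pos hk1, ← Real.exp_add,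
      Real.log_div hk0.ne' hk1.ne']
    congr 1; ring
  have h2 : Real.log (k / ((k + 1 : ℕ) : ℝ)) ≤ -(1 / ((k + 1 : ℕ) : ℝ)) := by
    refine (Real.log_le_sub_one_of_pos (by positivity)).trans (le_of_eq ?_)
    field_simp; push_cast; ring
  have h3 : 1 + (σ - 1) * (1 / ((k + 1 : ℕ) : ℝ)) ≤
      Real.exp ((σ - 1) * (-Real.log (k / ((k + 1 : ℕ) : ℝ)))) := by
    refine le_trans ?_ (Real.add_one_le_exp _)
    nlinarith
  have h4 : ((k + 1 : ℕ) : ℝ) ^ (-σ) = ((k + 1 : ℕ) : ℝ) ^ (1 - σ) * (1 / ((k + 1 : ℕ) : ℝ)) := by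
    rw [show -σ = (1 - σ) - 1 by ring, Real.rpow_sub_one hk1.ne']; ring
  rw [h1, h4]
  have h5 : 0 < ((k + 1 : ℕ) : ℝ) ^ (1 - σ) := by positivity
  nlinarith

lemma sum_Ioc_rpow_neg_le {σ : ℝ} (hσ : 1 < σ) {n : ℕ} (hn : 1 ≤ n) (m : ℕ) :
    ∑ k ∈ Finset.Ioc n m, (k : ℝ) ^ (-σ) ≤ (n : ℝ) ^ (1 - σ) / (σ - 1) := by
  have h0 : (0 : ℝ) < σ - 1 := by linarith
  rcases le_total m n with h | h
  · rw [Finset.Ioc_eq_empty_of_le h]; simp; positivity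
  have key : ∑ k ∈ Finset.Ioc n m, (k : ℝ) ^ (-σ) ≤
      ((n : ℝ) ^ (1 - σ) - (m : ℝ) ^ (1 - σ)) / (σ - 1) := by
    induction m, h using Nat.le_induction with
    | base => simp
    | succ m hm ih =>
      rw [Finset.sum_Ioc_succ_top hm]
      have := succ_rpow_neg_le_sub hσ (hn.trans hm)
      have e : ((n : ℝ) ^ (1 - σ) - ((m + 1 : ℕ) : ℝ) ^ (1 - σ)) / (σ - 1) =
        ((n : ℝ) ^ (1 - σ) - (m : ℝ) ^ (1 - σ)) / (σ - 1) +
        ((m : ℝ) ^ (1 - σ) - ((m + 1 : ℕ) : ℝ) ^ (1 - σ)) / (σ - 1) := by ring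
      rw [e]
      linarith
  refine key.trans ?_
  gcongr
  have : 0 ≤ (m : ℝ) ^ (1 - σ) := by positivity
  linarith

lemma LSeries_natCast_sum_range_tendsto {q : ℕ} (χ : DirichletCharacter ℂ q) {σ : ℝ}
    (hσ : 1 < σ) :
    Tendsto (fun N => ∑ n ∈ Finset.range N, LSeries.term (fun n => χ n) σ n) atTop
      (nhds (LSeries (fun n => χ n) σ)) :=
  (DirichletCharacter.LSeriesSummable_of_one_lt_re χ
    (by simpa using hσ)).hasSum.tendsto_sum_nat

lemma norm_LSeries_term_le {q : ℕ} (χ : DirichletCharacter ℂ q) (σ : ℝ) (n : ℕ) (hn : n ≠ 0) :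
    ‖LSeries.term (fun n => χ n) σ n‖ ≤ (n : ℝ) ^ (-σ) := by
  rw [LSeries.term_of_ne_zero hn, norm_div, div_eq_mul_inv, Complex.norm_natCast_cpow_of_pos
    (Nat.pos_of_ne_zero hn), Real.rpow_neg (by positivity)]
  refine mul_le_of_le_one_left (by positivity) (χ.norm_le_one _)

lemma norm_LSeries_le {q : ℕ} (χ : DirichletCharacter ℂ q) {σ : ℝ} (hσ : 1 < σ) :
    ‖LSeries (fun n => χ n) σ‖ ≤ 1 + 1 / (σ - 1) := by
  refine le_of_tendsto' ((LSeries_natCast_sum_range_tendsto χ hσ).norm) fun N => ?_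
  have h1 := sum_Ioc_rpow_neg_le hσ le_rfl (N + 1)
  rw [Nat.cast_one, Real.one_rpow] at h1
  calc ‖∑ n ∈ Finset.range N, LSeries.term (fun n => χ n) σ n‖
      ≤ ∑ n ∈ Finset.range N, ‖LSeries.term (fun n => χ n) σ n‖ := norm_sum_le _ _
    _ ≤ ∑ n ∈ Finset.range (N + 2), ‖LSeries.term (fun n => χ n) σ n‖ :=
        Finset.sum_le_sum_of_subset_of_nonneg (Finset.range_subset_range.2 (by omega))
          fun _ _ _ => norm_nonneg _
    _ = ∑ n ∈ Finset.Icc 1 (N + 1), ‖LSeries.term (fun n => χ n) σ n‖ := by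
        rw [Finset.range_eq_Ico, Finset.sum_eq_sum_Ico_succ_bot (by omega)]
        simp; rfl
    _ ≤ ∑ n ∈ Finset.Icc 1 (N + 1), (n : ℝ) ^ (-σ) :=
        Finset.sum_le_sum fun n hn => norm_LSeries_term_le χ σ n (by simp at hn; omega)
    _ ≤ 1 + 1 / (σ - 1) := by
        rw [← Finset.insert_Icc_add_one_left_eq_Icc (by omega), Finset.sum_insert (by simp)]
        have : Finset.Icc (1 + 1) (N + 1) = Finset.Ioc 1 (N + 1) := rfl
        rw [this]; simpa using h1

lemma sum_range_character_eq_zero {q : ℕ} [NeZero q] {χ : DirichletCharacter ℂ q} (hχ : χ ≠ 1) :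
    ∑ j ∈ Finset.range q, χ (j : ZMod q) = 0 := by
  rw [← MulChar.sum_eq_zero_of_ne_one hχ]
  refine Finset.sum_bij' (fun j _ => (j : ZMod q)) (fun a _ => a.val) ?_ ?_ ?_ ?_ ?_
  · simp
  · intro a _; simpa using ZMod.val_lt a
  · intro j hj; exact ZMod.val_cast_of_lt (by simpa using hj)
  · simp
  · simp

lemma norm_sum_block_le {q : ℕ} [NeZero q] {χ : DirichletCharacter ℂ q} (hχ : χ ≠ 1) {σ : ℝ}
    (hσ : 1 < σ) {M : ℕ} (hM : 1 ≤ M) :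
    ‖∑ j ∈ Finset.range q, LSeries.term (fun n => χ n) σ (M * q + j)‖ ≤
      q * (((M * q : ℕ) : ℝ) ^ (-σ) - (((M + 1) * q : ℕ) : ℝ) ^ (-σ)) := by
  have hq : 0 < q := Nat.pos_of_neZero q
  have hMq : 0 < M * q := by positivity
  have hterm : ∀ j, LSeries.term (fun n => χ n) σ (M * q + j)
      = χ (j : ZMod q) * ((((M * q + j : ℕ) : ℝ) ^ (-σ) : ℝ) : ℂ) := by
    intro j
    rw [LSeries.term_of_ne_zero (by omega), Complex.ofReal_cpow (by positivity)]
    simp [Complex.cpow_neg, div_eq_mul_inv]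
  have h0 : ∑ j ∈ Finset.range q, LSeries.term (fun n => χ n) σ (M * q + j)
      = ∑ j ∈ Finset.range q, χ (j : ZMod q) *
        (((((M * q + j : ℕ) : ℝ) ^ (-σ) - ((M * q : ℕ) : ℝ) ^ (-σ) : ℝ)) : ℂ) := by
    simp_rw [hterm, Complex.ofReal_sub, mul_sub]
    rw [Finset.sum_sub_distrib, ← Finset.sum_mul, sum_range_character_eq_zero hχ]; simp
  rw [h0]
  have hb : ∀ j ∈ Finset.range q, ‖χ (j : ZMod q) *
        (((((M * q + j : ℕ) : ℝ) ^ (-σ) - ((M * q : ℕ) : ℝ) ^ (-σ) : ℝ)) : ℂ)‖ ≤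
        ((M * q : ℕ) : ℝ) ^ (-σ) - (((M + 1) * q : ℕ) : ℝ) ^ (-σ) := by
    intro j hj
    rw [Finset.mem_range] at hj
    rw [norm_mul, Complex.norm_real, Real.norm_eq_abs]
    refine (mul_le_of_le_one_left (abs_nonneg _) (χ.norm_le_one _)).trans ?_
    have h1 : ((M * q + j : ℕ) : ℝ) ^ (-σ) ≤ ((M * q : ℕ) : ℝ) ^ (-σ) :=
      Real.rpow_le_rpow_of_nonpos (by exact_mod_cast hMq) (by exact_mod_cast Nat.le_add_right _ _)
        (by linarith)
    have h2 : (((M + 1) * q : ℕ) : ℝ) ^ (-σ) ≤ ((M * q + j : ℕ) : ℝ) ^ (-σ) :=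
      Real.rpow_le_rpow_of_nonpos (by positivity)
        (by exact_mod_cast (by rw [add_mul]; omega : M * q + j ≤ (M + 1) * q)) (by linarith)
    rw [abs_of_nonpos (by linarith)]
    linarith
  calc _ ≤ _ := norm_sum_le _ _
    _ ≤ _ := Finset.sum_le_card_nsmul _ _ _ hb
    _ = _ := by simp

lemma norm_LSeries_le_of_ne_one {q : ℕ} [NeZero q] {χ : DirichletCharacter ℂ q} (hχ : χ ≠ 1)
    {σ : ℝ} (hσ : 1 < σ) :
    ‖LSeries (fun n => χ n) σ‖ ≤ 2 + Real.log q := by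
  have hq : 0 < q := Nat.pos_of_neZero q
  have hq1 : (1 : ℝ) ≤ q := by exact_mod_cast hq
  have hsub : Tendsto (fun M : ℕ => (M + 1) * q) atTop atTop :=
    tendsto_atTop_mono (fun M => M.le_succ.trans (Nat.le_mul_of_pos_right _ hq)) tendsto_id
  refine le_of_tendsto' (((LSeries_natCast_sum_range_tendsto χ hσ).comp hsub).norm) fun M => ?_
  have base : ‖∑ n ∈ Finset.range q, LSeries.term (fun n => χ n) σ n‖ ≤ 1 + Real.log q := by
    calc _ ≤ ∑ n ∈ Finset.range q, ‖LSeries.term (fun n => χ n) σ n‖ := norm_sum_le _ _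
      _ ≤ ∑ n ∈ Finset.range (q + 1), ‖LSeries.term (fun n => χ n) σ n‖ :=
        Finset.sum_le_sum_of_subset_of_nonneg (Finset.range_subset_range.2 (by omega))
          fun _ _ _ => norm_nonneg _
      _ = ∑ n ∈ Finset.range q, ‖LSeries.term (fun n => χ n) σ (n + 1)‖ := by
        rw [Finset.sum_range_succ']; simp
      _ ≤ ∑ n ∈ Finset.range q, ((n + 1 : ℕ) : ℝ)⁻¹ := by
        refine Finset.sum_le_sum fun n _ => (norm_LSeries_term_le χ σ _ (by omega)).trans ?_
        rw [← Real.rpow_neg_one]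
        exact Real.rpow_le_rpow_of_exponent_le (by push_cast; linarith [n.cast_nonneg (α := ℝ)])
          (by linarith)
      _ = ((harmonic q : ℚ) : ℝ) := by simp [harmonic]
      _ ≤ _ := harmonic_le_one_add_log q
  have key : ‖∑ n ∈ Finset.range ((M + 1) * q), LSeries.term (fun n => χ n) σ n‖ ≤
      1 + Real.log q + q * ((q : ℝ) ^ (-σ) - (((M + 1) * q : ℕ) : ℝ) ^ (-σ)) := by
    induction M with
    | zero => simpa using base
    | succ M ih =>
      rw [add_mul (M + 1), one_mul, Finset.sum_range_add]
      have := norm_sum_block_le hχ hσ (M := M + 1) (by omega)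
      rw [show (M + 1 + 1) * q = (M + 1) * q + q by ring] at this
      refine (norm_add_le _ _).trans ((add_le_add ih this).trans (le_of_eq ?_))
      ring
  refine key.trans ?_
  have h1 : 0 ≤ (((M + 1) * q : ℕ) : ℝ) ^ (-σ) := by positivity
  have h2 : (q : ℝ) * (q : ℝ) ^ (-σ) ≤ 1 := by
    rw [← Real.rpow_one_add' (by positivity) (by linarith)]
    exact Real.rpow_le_one_of_one_le_of_nonpos hq1 (by linarith)
  nlinarith

lemma exists_abs_log_norm_LSeries_le {q : ℕ} [NeZero q] {χ : DirichletCharacter ℂ q}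
    (hχ : χ ≠ 1) :
    ∃ C : ℝ, ∀ σ : ℝ, 1 < σ → σ ≤ 2 → |Real.log ‖LSeries (fun n => χ n) σ‖| ≤ C := by
  have hc : ContinuousOn (fun σ : ℝ => Real.log ‖DirichletCharacter.LFunction χ σ‖)
      (Set.Icc 1 2) := by
    refine ContinuousOn.log ?_ ?_
    · exact ((DirichletCharacter.differentiable_LFunction hχ).continuous.comp
        Complex.continuous_ofReal).norm.continuousOn
    · intro σ hσ
      exact norm_ne_zero_iff.2 (DirichletCharacter.LFunction_ne_zero_of_one_le_re χ (Or.inl hχ)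
        (by simpa using hσ.1))
  obtain ⟨C, hC⟩ := isCompact_Icc.exists_bound_of_continuousOn hc
  refine ⟨C, fun σ h1 h2 => ?_⟩
  rw [← DirichletCharacter.LFunction_eq_LSeries χ (by simpa using h1)]
  exact hC σ ⟨h1.le, h2⟩

lemma exists_abs_log_norm_LSeries_one_sub_le (q : ℕ) [NeZero q] :
    ∃ C : ℝ, ∀ σ : ℝ, 1 < σ → σ ≤ 2 →
      |Real.log ‖LSeries (fun n => (1 : DirichletCharacter ℂ q) n) σ‖
        - Real.log (1 / (σ - 1))| ≤ C := by
  have hval : ∀ σ : ℝ, 1 < σ → DirichletCharacter.LFunctionTrivChar₁ q σ =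
      ((σ : ℂ) - 1) * DirichletCharacter.LFunction (1 : DirichletCharacter ℂ q) σ := by
    intro σ hσ
    have : (σ : ℂ) ≠ 1 := by
      norm_cast; linarith
    simp [DirichletCharacter.LFunctionTrivChar₁, this, DirichletCharacter.LFunctionTrivChar]
  have hL : ∀ σ : ℝ, 1 < σ →
      DirichletCharacter.LFunction (1 : DirichletCharacter ℂ q) σ ≠ 0 := by
    intro σ hσ
    refine DirichletCharacter.LFunction_ne_zero_of_one_le_re 1 (Or.inr ?_) (by simpa using hσ.le)
    norm_cast; linarith
  have hσ1 : ∀ σ : ℝ, 1 < σ → ((σ : ℂ) - 1) ≠ 0 := by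
    intro σ hσ
    rw [sub_ne_zero]; norm_cast; linarith
  have hc : ContinuousOn (fun σ : ℝ => Real.log ‖DirichletCharacter.LFunctionTrivChar₁ q σ‖)
      (Set.Icc 1 2) := by
    refine ContinuousOn.log ?_ ?_
    · exact ((DirichletCharacter.differentiable_LFunctionTrivChar₁ q).continuous.comp
        Complex.continuous_ofReal).norm.continuousOn
    · intro σ hσ
      rw [norm_ne_zero_iff]
      rcases hσ.1.eq_or_lt with h | h
      · rw [← h]; exact DirichletCharacter.LFunctionTrivChar₁_apply_one_ne_zero q
      · rw [hval σ h]
        exact mul_ne_zero (hσ1 σ h) (hL σ h)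
  obtain ⟨C, hC⟩ := isCompact_Icc.exists_bound_of_continuousOn hc
  refine ⟨C, fun σ h1 h2 => ?_⟩
  rw [← DirichletCharacter.LFunction_eq_LSeries 1 (by simpa using h1)]
  have h := hC σ ⟨h1.le, h2⟩
  rw [hval σ h1, norm_mul, Real.log_mul (norm_ne_zero_iff.2 (hσ1 σ h1))
    (norm_ne_zero_iff.2 (hL σ h1))] at h
  have e : ‖(σ : ℂ) - 1‖ = σ - 1 := by
    rw [← Complex.ofReal_one, ← Complex.ofReal_sub, Complex.norm_real, Real.norm_eq_abs,
      abs_of_pos (by linarith)]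
  rw [e] at h
  rw [one_div, Real.log_inv]
  rw [Real.norm_eq_abs] at h
  convert h using 2
  ring

/-- Dirichlet's theorem in logarithmic form. -/
lemma exists_abs_primeZeta_sub_le {q : ℕ} (hq : 0 < q) :
    ∃ C : ℝ, ∀ σ : ℝ, 1 < σ → σ ≤ 2 →
      |primeZeta q σ - Real.log (1 / (σ - 1)) / q.totient| ≤ C := by
  have : NeZero q := ⟨hq.ne'⟩
  have hφ : (0 : ℝ) < q.totient := by exact_mod_cast Nat.totient_pos.2 hq
  have h : ∀ χ : DirichletCharacter ℂ q, ∃ C : ℝ, ∀ σ : ℝ, 1 < σ → σ ≤ 2 →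
      |Real.log ‖LSeries (fun n => χ n) σ‖ -
        if χ = 1 then Real.log (1 / (σ - 1)) else 0| ≤ C := by
    intro χ
    by_cases hχ : χ = 1
    · subst hχ; simpa using exists_abs_log_norm_LSeries_one_sub_le q
    · simpa [hχ] using exists_abs_log_norm_LSeries_le hχ
  choose C hC using h
  refine ⟨(∑ χ, C χ + q.totient * ∑' p : Nat.Primes, ((p : ℕ) : ℝ) ^ (-2 : ℝ)) / q.totient,
    fun σ h1 h2 => ?_⟩
  have hA := abs_sum_log_norm_LSeries_sub_le q h1
  have hB : |∑ χ : DirichletCharacter ℂ q, Real.log ‖LSeries (fun n => χ n) σ‖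
      - Real.log (1 / (σ - 1))| ≤ ∑ χ, C χ := by
    have : Real.log (1 / (σ - 1)) = ∑ χ : DirichletCharacter ℂ q,
        if χ = 1 then Real.log (1 / (σ - 1)) else 0 := by simp
    rw [this, ← Finset.sum_sub_distrib]
    exact (Finset.abs_sum_le_sum_abs _ _).trans (Finset.sum_le_sum fun χ _ => hC χ σ h1 h2)
  rw [le_div_iff₀ hφ, ← abs_of_pos hφ, ← abs_mul, abs_of_pos hφ, sub_mul,
    div_mul_cancel₀ _ hφ.ne']
  rw [abs_le] at hA hB ⊢
  constructor <;> linarith [hA.1, hA.2, hB.1, hB.2]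

/-- An upper bound for `∑ p^{-σ}` over primes `p ≡ 1 (mod q)` that is uniform in `q`. -/
lemma exists_primeZeta_le :
    ∃ C : ℝ, ∀ q : ℕ, 0 < q → ∀ σ : ℝ, 1 < σ → σ ≤ 2 →
      primeZeta q σ ≤ Real.log (1 / (σ - 1)) / q.totient + Real.log (2 + Real.log q) + C := by
  refine ⟨Real.log 2 + ∑' p : Nat.Primes, ((p : ℕ) : ℝ) ^ (-2 : ℝ), fun q hq σ h1 h2 => ?_⟩
  have : NeZero q := ⟨hq.ne'⟩
  have hφ : (1 : ℝ) ≤ q.totient := by exact_mod_cast Nat.totient_pos.2 hq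
  have hlq : 0 ≤ Real.log q := Real.log_natCast_nonneg q
  have hA := (abs_le.1 (abs_sum_log_norm_LSeries_sub_le q h1)).1
  have hcard : (Fintype.card (DirichletCharacter ℂ q) : ℝ) = q.totient := by
    rw [← Nat.card_eq_fintype_card, DirichletCharacter.card_eq_totient_of_hasEnoughRootsOfUnity]
  have hne : ∀ χ : DirichletCharacter ℂ q, 0 < ‖LSeries (fun n => χ n) σ‖ := by
    intro χ
    rw [← DirichletCharacter.LSeries_eulerProduct_exp_log χ (by simpa using h1)]
    exact norm_pos_iff.2 (Complex.exp_ne_zero _)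
  have hlog : 0 ≤ Real.log (1 / (σ - 1)) := by
    apply Real.log_nonneg
    rw [le_div_iff₀ (by linarith)]; linarith
  have hB : ∑ χ : DirichletCharacter ℂ q, Real.log ‖LSeries (fun n => χ n) σ‖ ≤
      Real.log (1 / (σ - 1)) + Real.log 2 + q.totient * Real.log (2 + Real.log q) := by
    have hx : ∀ χ : DirichletCharacter ℂ q, Real.log ‖LSeries (fun n => χ n) σ‖ ≤
        (if χ = 1 then Real.log (1 / (σ - 1)) + Real.log 2 else 0) +
          Real.log (2 + Real.log q) := by
      intro χ
      by_cases hχ : χ = 1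
      · rw [if_pos hχ]
        have : Real.log ‖LSeries (fun n => χ n) σ‖ ≤ Real.log (1 / (σ - 1) * 2) := by
          refine Real.log_le_log (hne χ) ((norm_LSeries_le χ h1).trans ?_)
          have : 1 ≤ 1 / (σ - 1) := by rw [le_div_iff₀ (by linarith)]; linarith
          linarith
        rw [Real.log_mul (by have : 0 < σ - 1 := by linarith
                             positivity) (by norm_num)] at this
        have : 0 ≤ Real.log (2 + Real.log q) := Real.log_nonneg (by linarith)
        linarith
      · rw [if_neg hχ, zero_add]
        exact Real.log_le_log (hne χ) (norm_LSeries_le_of_ne_one hχ h1)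
    refine (Finset.sum_le_sum fun χ _ => hx χ).trans (le_of_eq ?_)
    rw [Finset.sum_add_distrib]
    simp [← hcard]
  have hl2 : 0 ≤ Real.log 2 := Real.log_nonneg (by norm_num)
  have hfin : q.totient * primeZeta q σ ≤ q.totient *
      (Real.log (1 / (σ - 1)) / q.totient + Real.log (2 + Real.log q) +
        (Real.log 2 + ∑' p : Nat.Primes, ((p : ℕ) : ℝ) ^ (-2 : ℝ))) := by
    have e : q.totient * (Real.log (1 / (σ - 1)) / q.totient) = Real.log (1 / (σ - 1)) := by
      field_simp
    rw [mul_add, mul_add, mul_add, e]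
    nlinarith
  exact le_of_mul_le_mul_left hfin (by linarith)

/-- The sum of `1/p` over the primes `p ≤ n` with `p ≡ 1 (mod q)`. -/
def recipSum (q n : ℕ) : ℝ :=
  ∑ p ∈ (Finset.Icc 1 n).filter (fun p => p.Prime ∧ p % q = 1 % q), (1 : ℝ) / p

lemma sum_filter_eq_sum_primes (q n : ℕ) (σ : ℝ) :
    ∑ p ∈ (Finset.Icc 1 n).filter (fun p => p.Prime ∧ p % q = 1 % q), (p : ℝ) ^ (-σ) =
      ∑ p ∈ ((Finset.Icc 1 n).subtype Nat.Prime : Finset Nat.Primes),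
        if (p : ℕ) % q = 1 % q then ((p : ℕ) : ℝ) ^ (-σ) else 0 := by
  rw [← Finset.filter_filter, Finset.sum_filter]
  exact (Finset.sum_subtype_eq_sum_filter
    (f := fun p : ℕ => if p % q = 1 % q then (p : ℝ) ^ (-σ) else 0)).symm

lemma recipSum_le_mul_primeZeta (q n : ℕ) {σ : ℝ} (hσ : 1 < σ) :
    recipSum q n ≤ (n : ℝ) ^ (σ - 1) * primeZeta q σ := by
  have h1 : ∑ p ∈ (Finset.Icc 1 n).filter (fun p => p.Prime ∧ p % q = 1 % q), (p : ℝ) ^ (-σ)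
      ≤ primeZeta q σ := by
    rw [sum_filter_eq_sum_primes]
    exact sum_le_hasSum (L := SummationFilter.unconditional Nat.Primes) _
      (fun p _ => by split_ifs <;> positivity) (summable_primeZeta q hσ).hasSum
  refine le_trans ?_ (mul_le_mul_of_nonneg_left h1 (by positivity))
  rw [recipSum, Finset.mul_sum]
  refine Finset.sum_le_sum fun p hp => ?_
  simp only [Finset.mem_filter, Finset.mem_Icc] at hp
  have hp0 : (0 : ℝ) < p := by exact_mod_cast hp.1.1
  have e : (1 : ℝ) / p = (p : ℝ) ^ (σ - 1) * (p : ℝ) ^ (-σ) := by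
    rw [← Real.rpow_add hp0, show σ - 1 + -σ = -1 by ring, Real.rpow_neg_one, one_div]
  rw [e]
  gcongr
  · linarith

lemma primeZeta_le_recipSum_add (q : ℕ) {n : ℕ} (hn : 1 ≤ n) {σ : ℝ} (hσ : 1 < σ) :
    primeZeta q σ ≤ recipSum q n + (n : ℝ) ^ (1 - σ) / (σ - 1) := by
  refine Real.tsum_le_of_sum_le (fun p => by split_ifs <;> positivity) fun s => ?_
  obtain ⟨m, hm⟩ : ∃ m, ∀ p ∈ s, (p : ℕ) ≤ m := ⟨s.sup (fun p => (p : ℕ)), fun p hp =>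
    Finset.le_sup (f := fun p : Nat.Primes => (p : ℕ)) hp⟩
  calc _ ≤ ∑ p ∈ ((Finset.Icc 1 (n + m)).subtype Nat.Prime : Finset Nat.Primes),
        (if (p : ℕ) % q = 1 % q then ((p : ℕ) : ℝ) ^ (-σ) else 0) := by
        refine Finset.sum_le_sum_of_subset_of_nonneg (fun p hp => ?_)
          fun _ _ _ => by split_ifs <;> positivity
        exact Finset.mem_subtype.2
          (Finset.mem_Icc.2 ⟨p.prop.one_le, (hm p hp).trans (Nat.le_add_left _ _)⟩)
    _ = ∑ p ∈ (Finset.Icc 1 (n + m)).filter (fun p => p.Prime ∧ p % q = 1 % q),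
        (p : ℝ) ^ (-σ) := (sum_filter_eq_sum_primes _ _ _).symm
    _ = ∑ p ∈ (Finset.Icc 1 n).filter (fun p => p.Prime ∧ p % q = 1 % q), (p : ℝ) ^ (-σ) +
        ∑ p ∈ (Finset.Ioc n (n + m)).filter (fun p => p.Prime ∧ p % q = 1 % q),
          (p : ℝ) ^ (-σ) := by
        rw [← Finset.sum_union, ← Finset.filter_union]
        · congr 2
          ext x; simp; omega
        · refine Finset.disjoint_filter_filter ?_
          rw [Finset.disjoint_left]; intro a; simp; omega
    _ ≤ recipSum q n + ∑ p ∈ Finset.Ioc n (n + m), (p : ℝ) ^ (-σ) := by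
        refine add_le_add (Finset.sum_le_sum fun p hp => ?_)
          (Finset.sum_le_sum_of_subset_of_nonneg (Finset.filter_subset _ _)
            fun _ _ _ => by positivity)
        simp only [Finset.mem_filter, Finset.mem_Icc] at hp
        rw [one_div, ← Real.rpow_neg_one]
        exact Real.rpow_le_rpow_of_exponent_le (by exact_mod_cast hp.1.1) (by linarith)
    _ ≤ _ := by gcongr; exact sum_Ioc_rpow_neg_le hσ hn _

lemma exists_recipSum_le :
    ∃ C : ℝ, ∀ q : ℕ, 0 < q → ∀ n : ℕ, 3 ≤ n →
      recipSum q n ≤ 3 * (LL n / q.totient + Real.log (2 + Real.log q) + C) := by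
  obtain ⟨C, hC⟩ := exists_primeZeta_le
  refine ⟨C, fun q hq n hn => ?_⟩
  have hn3 : (3 : ℝ) ≤ n := by exact_mod_cast hn
  have hlog : 1 < Real.log n := by
    rw [Real.lt_log_iff_exp_lt (by linarith)]
    exact Real.exp_one_lt_d9.trans (by linarith)
  have h0 : 0 < Real.log n := by linarith
  have hσ1 : 1 < 1 + 1 / Real.log n := by
    have : 0 < 1 / Real.log n := by positivity
    linarith
  have hσ2 : 1 + 1 / Real.log n ≤ 2 := by
    have : 1 / Real.log n ≤ 1 := by rw [div_le_one h0]; exact hlog.le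
    linarith
  have h := hC q hq _ hσ1 hσ2
  have h2 := recipSum_le_mul_primeZeta q n hσ1
  have e1 : (n : ℝ) ^ (1 + 1 / Real.log n - 1) = Real.exp 1 := by
    rw [Real.rpow_def_of_pos (by linarith)]; rw [add_sub_cancel_left]; congr 1; field_simp
  have e2 : Real.log (1 / (1 + 1 / Real.log n - 1)) = LL n := by
    rw [LL, add_sub_cancel_left, one_div_one_div]
  rw [e1] at h2
  rw [e2] at h
  have hT : 0 ≤ primeZeta q (1 + 1 / Real.log n) := tsum_nonneg fun p => by
    split_ifs <;> positivity
  have he := Real.exp_one_lt_d9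
  nlinarith

lemma exists_abs_recipSum_sub_le {q : ℕ} (hq : 0 < q) :
    ∃ C : ℝ, 0 ≤ C ∧ ∀ n : ℕ, 1 ≤ n → 1 ≤ Real.log n → 1 ≤ LL n →
      |recipSum q n - LL n / q.totient| ≤ C + 3 * Real.log (LL n) := by
  obtain ⟨C, hC⟩ := exists_abs_primeZeta_sub_le hq
  have hφ : (1 : ℝ) ≤ q.totient := by exact_mod_cast Nat.totient_pos.2 hq
  refine ⟨3 * |C| + 3, by positivity, fun n hn hl hL => ?_⟩
  have hn0 : (0 : ℝ) < n := by exact_mod_cast hn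
  set y := Real.log n with hy
  set L := LL n with hLdef
  have hLy : L = Real.log y := rfl
  have hy0 : 0 < y := by linarith
  have hL0 : 0 < L := by linarith
  have hlL : 0 ≤ Real.log L := Real.log_nonneg hL
  have hCa := le_abs_self C
  have hdivφ : ∀ t : ℝ, 0 ≤ t → t / q.totient ≤ t := fun t ht => div_le_self ht hφ
  rw [abs_le]
  constructor
  · have hLle : L ≤ y := by rw [hLy]; exact (Real.log_le_sub_one_of_pos hy0).trans (by linarith)
    have hσ1 : 1 < 1 + L / y := by
      have : 0 < L / y := by positivity
      linarith
    have hσ2 : 1 + L / y ≤ 2 := by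
      have : L / y ≤ 1 := by rw [div_le_one hy0]; exact hLle
      linarith
    have h1 := primeZeta_le_recipSum_add q hn hσ1
    have h2 := (abs_le.1 (hC _ hσ1 hσ2)).1
    have e1 : (n : ℝ) ^ (1 - (1 + L / y)) / (1 + L / y - 1) = 1 / L := by
      rw [Real.rpow_def_of_pos hn0, ← hy, show y * (1 - (1 + L / y)) = -L by field_simp; ring,
        Real.exp_neg, hLy, Real.exp_log hy0]
      rw [← hLy, add_sub_cancel_left]; field_simp
    have e2 : Real.log (1 / (1 + L / y - 1)) = L - Real.log L := by
      rw [add_sub_cancel_left, one_div_div, Real.log_div hy0.ne' hL0.ne', hLy]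
    rw [e1] at h1
    rw [e2, sub_div] at h2
    have h3 : 1 / L ≤ 1 := by rw [div_le_one hL0]; exact hL
    have h4 := hdivφ _ hlL
    have h5 := abs_nonneg C
    linarith
  · have hLy0 : 0 < L * y := by positivity
    have hσ1 : 1 < 1 + 1 / (L * y) := by
      have : 0 < 1 / (L * y) := by positivity
      linarith
    have hσ2 : 1 + 1 / (L * y) ≤ 2 := by
      have : 1 / (L * y) ≤ 1 := by rw [div_le_one hLy0]; nlinarith
      linarith
    have h1 := recipSum_le_mul_primeZeta q n hσ1
    have h2 := (abs_le.1 (hC _ hσ1 hσ2)).2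
    have e1 : (n : ℝ) ^ (1 + 1 / (L * y) - 1) = Real.exp (1 / L) := by
      rw [Real.rpow_def_of_pos hn0, ← hy]; rw [add_sub_cancel_left]; congr 1; field_simp
    have e2 : Real.log (1 / (1 + 1 / (L * y) - 1)) = L + Real.log L := by
      rw [add_sub_cancel_left, one_div_one_div,
        Real.log_mul hL0.ne' hy0.ne', hLy]; ring
    rw [e1] at h1
    rw [e2, add_div] at h2
    have h3 : 1 / L ≤ 1 := by rw [div_le_one hL0]; exact hL
    have h4 := hdivφ _ hlL
    have h5 : Real.exp (1 / L) ≤ 1 + 2 / L := by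
      have hx0 : 0 ≤ 1 / L := by positivity
      have := Real.abs_exp_sub_one_sub_id_le (x := 1 / L) (by rw [abs_of_nonneg hx0]; exact h3)
      have := (abs_le.1 this).2
      have : 2 / L = 2 * (1 / L) := by ring
      nlinarith
    have hZ : primeZeta q (1 + 1 / (L * y)) ≤ L / q.totient + Real.log L + |C| := by linarith
    have hT : 0 ≤ primeZeta q (1 + 1 / (L * y)) := tsum_nonneg fun p => by
      split_ifs <;> positivity
    have h6 : recipSum q n ≤ (1 + 2 / L) * (L / q.totient + Real.log L + |C|) :=
      h1.trans (mul_le_mul h5 hZ hT (by positivity))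
    have h7 : 2 / L * (L / q.totient) ≤ 2 := by
      rw [div_mul_div_comm, div_le_iff₀ (by positivity)]; nlinarith
    have h8 : 2 / L ≤ 2 := by rw [div_le_iff₀ hL0]; linarith
    have h9 : 2 / L * (Real.log L + |C|) ≤ 2 * (Real.log L + |C|) := by
      gcongr
    nlinarith

lemma tendsto_LL : Tendsto LL atTop atTop :=
  Real.tendsto_log_atTop.comp (Real.tendsto_log_atTop.comp tendsto_natCast_atTop_atTop)

lemma tendsto_log_div_sqrt : Tendsto (fun y : ℝ => Real.log y / Real.sqrt y) atTop (nhds 0) := by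
  have h := (isLittleO_log_rpow_atTop (r := 1 / 2) (by norm_num)).tendsto_div_nhds_zero
  refine h.congr fun y => by rw [Real.sqrt_eq_rpow]

/-- Mertens' theorem for primes `p ≡ 1 (mod q)` with a weak error term. -/
lemma tendsto_recipSum {q : ℕ} (hq : 0 < q) :
    Tendsto (fun n => (recipSum q n - LL n / q.totient) / Real.sqrt (LL n)) atTop (nhds 0) := by
  obtain ⟨C, hC0, hC⟩ := exists_abs_recipSum_sub_le hq
  have h1 : Tendsto (fun n => C / Real.sqrt (LL n) +
      3 * (Real.log (LL n) / Real.sqrt (LL n))) atTop (nhds 0) := by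
    have a := (tendsto_log_div_sqrt.comp tendsto_LL).const_mul 3
    have b := ((Real.tendsto_sqrt_atTop.comp tendsto_LL).const_div_atTop C)
    simpa using b.add a
  refine squeeze_zero_norm' ?_ h1
  filter_upwards [eventually_ge_atTop 1, tendsto_LL.eventually_ge_atTop 1,
    (Real.tendsto_log_atTop.comp tendsto_natCast_atTop_atTop).eventually_ge_atTop 1] with n h1 h2 h3
  rw [Real.norm_eq_abs, abs_div, abs_of_nonneg (Real.sqrt_nonneg _), mul_div_assoc', ← add_div]
  gcongr
  exact hC n h1 h3 h2

lemma card_multiples_Icc (n d : ℕ) :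
    (((Finset.Icc 1 n).filter (d ∣ ·)).card : ℝ) ≤ n / d := by
  have h : ((Finset.Icc 1 n).filter (d ∣ ·)).card = n / d := by
    rw [← Nat.Ioc_filter_dvd_card_eq_div]; rfl
  rw [h]; exact Nat.cast_div_le

lemma le_card_multiples_Icc (n d : ℕ) (hd : 0 < d) :
    (n : ℝ) / d - 1 ≤ (((Finset.Icc 1 n).filter (d ∣ ·)).card : ℝ) := by
  have h : ((Finset.Icc 1 n).filter (d ∣ ·)).card = n / d := by
    rw [← Nat.Ioc_filter_dvd_card_eq_div]; rfl
  have hd' : (0 : ℝ) < d := by exact_mod_cast hd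
  rw [h, sub_le_iff_le_add, div_le_iff₀ hd']
  have := Nat.lt_mul_div_succ n hd
  have h2 : (n : ℝ) < d * ((n / d : ℕ) + 1) := by exact_mod_cast this
  linarith

lemma sum_prod_filter_dvd {R : Type*} [CommRing R] {P : Finset ℕ} (hP : ∀ p ∈ P, p.Prime)
    (w : ℕ → R) (n : ℕ) :
    ∑ m ∈ Finset.Icc 1 n, ∏ p ∈ P.filter (· ∣ m), (1 + w p) =
      ∑ D ∈ P.powerset, (∏ p ∈ D, w p) *
        (((Finset.Icc 1 n).filter ((∏ p ∈ D, p) ∣ ·)).card : R) := by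
  have h1 : ∀ m : ℕ, ∏ p ∈ P.filter (· ∣ m), (1 + w p) =
      ∑ D ∈ P.powerset, if (∏ p ∈ D, p) ∣ m then ∏ p ∈ D, w p else 0 := fun m => by
    rw [Finset.prod_one_add, ← Finset.sum_filter]
    refine Finset.sum_congr ?_ fun _ _ => rfl
    ext D
    simp only [Finset.mem_powerset, Finset.mem_filter]
    constructor
    · intro h
      have hDP : D ⊆ P := h.trans (Finset.filter_subset _ _)
      exact ⟨hDP, Finset.prod_primes_dvd _ (fun p hp => (hP p (hDP hp)).prime)
        fun p hp => (Finset.mem_filter.1 (h hp)).2⟩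
    · rintro ⟨h, h'⟩ p hp
      exact Finset.mem_filter.2 ⟨h hp, (Finset.dvd_prod_of_mem _ hp).trans h'⟩
  simp_rw [h1]
  rw [Finset.sum_comm]
  refine Finset.sum_congr rfl fun D _ => ?_
  rw [← Finset.sum_filter, Finset.sum_const, nsmul_eq_mul, mul_comm]

lemma norm_avg_prod_sub_le {P : Finset ℕ} (hP : ∀ p ∈ P, p.Prime) (w : ℕ → ℂ) {n z k : ℕ}
    (hn : 1 ≤ n) (hz : ∀ p ∈ P, p ≤ z) (hz1 : 1 ≤ z) (hk : z ^ (2 * k) ≤ n) :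
    ‖(∑ m ∈ Finset.Icc 1 n, ∏ p ∈ P.filter (· ∣ m), (1 + w p)) / n -
      ∏ p ∈ P, (1 + w p / p)‖ ≤
      ((Real.sqrt n)⁻¹ + (1 / 2) ^ k) * Real.exp (2 * ∑ p ∈ P, ‖w p‖ / p) := by
  have hn0 : (0 : ℝ) < n := by exact_mod_cast hn
  have hprod : ∏ p ∈ P, (1 + w p / p) =
      ∑ D ∈ P.powerset, (∏ p ∈ D, w p) * ((∏ p ∈ D, p : ℕ) : ℂ)⁻¹ := by
    rw [Finset.prod_one_add]
    refine Finset.sum_congr rfl fun D _ => ?_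
    rw [Finset.prod_div_distrib, div_eq_mul_inv, Nat.cast_prod]
  rw [sum_prod_filter_dvd hP, hprod, Finset.sum_div, ← Finset.sum_sub_distrib]
  have hterm : ∀ D ∈ P.powerset,
      ‖(∏ p ∈ D, w p) * (((Finset.Icc 1 n).filter ((∏ p ∈ D, p) ∣ ·)).card : ℂ) / n -
        (∏ p ∈ D, w p) * ((∏ p ∈ D, p : ℕ) : ℂ)⁻¹‖ ≤
      ((Real.sqrt n)⁻¹ + (1 / 2) ^ k) * ∏ p ∈ D, (2 * (‖w p‖ / p)) := fun D hD => by
    rw [Finset.mem_powerset] at hD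
    set N := ∏ p ∈ D, p with hN
    have hNpos : 0 < N := Finset.prod_pos fun p hp => (hP p (hD hp)).pos
    have hN0 : (0 : ℝ) < N := by exact_mod_cast hNpos
    set c := ((Finset.Icc 1 n).filter (N ∣ ·)).card with hc
    have e1 : (∏ p ∈ D, w p) * (c : ℂ) / n - (∏ p ∈ D, w p) * ((N : ℕ) : ℂ)⁻¹ =
        (∏ p ∈ D, w p) * (((c : ℝ) / n - (N : ℝ)⁻¹ : ℝ) : ℂ) := by
      push_cast; ring
    have u1 := card_multiples_Icc n N
    have u2 := le_card_multiples_Icc n N hNpos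
    rw [← hc] at u1 u2
    have v1 : |(c : ℝ) / n - (N : ℝ)⁻¹| ≤ (n : ℝ)⁻¹ := by
      rw [abs_le]
      have a1 : (c : ℝ) / n ≤ (N : ℝ)⁻¹ := by
        rw [div_le_iff₀ hn0, inv_mul_eq_div]; exact u1
      have a2 : (N : ℝ)⁻¹ - (n : ℝ)⁻¹ ≤ (c : ℝ) / n := by
        rw [le_div_iff₀ hn0, sub_mul, inv_mul_cancel₀ hn0.ne', inv_mul_eq_div]; exact u2
      have a3 : 0 < (n : ℝ)⁻¹ := by positivity
      constructor <;> linarith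
    have v2 : |(c : ℝ) / n - (N : ℝ)⁻¹| ≤ (N : ℝ)⁻¹ := by
      rw [abs_le]
      have a1 : (c : ℝ) / n ≤ (N : ℝ)⁻¹ := by
        rw [div_le_iff₀ hn0, inv_mul_eq_div]; exact u1
      have a2 : 0 ≤ (c : ℝ) / n := by positivity
      have a3 : 0 < (N : ℝ)⁻¹ := by positivity
      constructor <;> linarith
    have v3 : |(c : ℝ) / n - (N : ℝ)⁻¹| ≤
        ((Real.sqrt n)⁻¹ + (1 / 2) ^ k) * 2 ^ D.card * (N : ℝ)⁻¹ := by
      rcases le_or_gt D.card k with hDk | hDk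
      · refine v1.trans ?_
        have hNz : N ≤ z ^ k := by
          calc N ≤ ∏ p ∈ D, z := Finset.prod_le_prod' fun p hp => hz p (hD hp)
            _ = z ^ D.card := by rw [Finset.prod_const]
            _ ≤ z ^ k := Nat.pow_le_pow_right hz1 hDk
        have hNn : (N : ℝ) ≤ Real.sqrt n := by
          apply Real.le_sqrt_of_sq_le
          have : N ^ 2 ≤ n := by
            calc N ^ 2 ≤ (z ^ k) ^ 2 := Nat.pow_le_pow_left hNz 2
              _ = z ^ (2 * k) := by rw [← pow_mul, mul_comm]
              _ ≤ n := hk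
          exact_mod_cast this
        have hs : 0 < Real.sqrt n := Real.sqrt_pos.2 hn0
        calc (n : ℝ)⁻¹ = (Real.sqrt n)⁻¹ * (Real.sqrt n)⁻¹ := by
              rw [← mul_inv, Real.mul_self_sqrt hn0.le]
          _ ≤ (Real.sqrt n)⁻¹ * (N : ℝ)⁻¹ := by gcongr
          _ ≤ _ := by
              gcongr
              have h1 : (1 : ℝ) ≤ 2 ^ D.card := one_le_pow₀ (by norm_num)
              have h2 : (0 : ℝ) ≤ (1 / 2) ^ k := by positivity
              have h3 : 0 < (Real.sqrt n)⁻¹ := by positivity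
              nlinarith
      · refine v2.trans ?_
        have h1 : (1 : ℝ) ≤ (1 / 2) ^ k * 2 ^ D.card := by
          calc (1 : ℝ) = (1 / 2) ^ k * 2 ^ k := by rw [← mul_pow]; norm_num
            _ ≤ _ := by gcongr; norm_num
        have h2 : (0 : ℝ) ≤ (Real.sqrt n)⁻¹ * 2 ^ D.card := by positivity
        have h3 : 0 < (N : ℝ)⁻¹ := by positivity
        nlinarith
    rw [e1, norm_mul, Complex.norm_real, Real.norm_eq_abs, norm_prod]
    calc _ ≤ (∏ p ∈ D, ‖w p‖) * (((Real.sqrt n)⁻¹ + (1 / 2) ^ k) * 2 ^ D.card * (N : ℝ)⁻¹) := by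
          gcongr
      _ = _ := by
          rw [Finset.prod_mul_distrib, Finset.prod_div_distrib, Finset.prod_const, hN]
          push_cast; ring
  refine (norm_sum_le_of_le _ hterm).trans ?_
  rw [← Finset.mul_sum, ← Finset.prod_one_add, Finset.mul_sum, Real.exp_sum]
  gcongr with p hp
  rw [add_comm]; exact Real.add_one_le_exp _

/-- The primes up to `n`. -/
def primesLE (n : ℕ) : Finset ℕ := (Finset.Icc 1 n).filter Nat.Prime

lemma mem_primesLE {n p : ℕ} : p ∈ primesLE n ↔ p ≤ n ∧ p.Prime := by
  simp only [primesLE, Finset.mem_filter, Finset.mem_Icc]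
  exact ⟨fun h => ⟨h.1.2, h.2⟩, fun h => ⟨⟨h.2.one_le, h.1⟩, h.2⟩⟩

lemma primesLE_mono {m n : ℕ} (h : m ≤ n) : primesLE m ⊆ primesLE n := fun p hp => by
  rw [mem_primesLE] at *; exact ⟨hp.1.trans h, hp.2⟩

lemma sum_primesLE_inv (n : ℕ) : ∑ p ∈ primesLE n, (1 : ℝ) / p = recipSum 1 n := by
  rw [recipSum, primesLE]
  simp [Nat.mod_one]

lemma tendsto_recipSum_one_div :
    Tendsto (fun n => recipSum 1 n / LL n) atTop (nhds 1) := by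
  have h := tendsto_recipSum one_pos
  have h2 : Tendsto (fun n => (Real.sqrt (LL n))⁻¹) atTop (nhds 0) :=
    tendsto_inv_atTop_zero.comp (Real.tendsto_sqrt_atTop.comp tendsto_LL)
  have h3 := (h.mul h2).add_const 1
  rw [zero_mul, zero_add] at h3
  refine h3.congr' ?_
  filter_upwards [tendsto_LL.eventually_gt_atTop 0] with n hn
  have hs : 0 < Real.sqrt (LL n) := Real.sqrt_pos.2 hn
  have e : LL n = Real.sqrt (LL n) * Real.sqrt (LL n) := (Real.mul_self_sqrt hn.le).symm
  rw [Nat.totient_one, Nat.cast_one, div_one, div_mul_eq_mul_div, ← div_eq_mul_inv, div_div, ← e]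
  field_simp; ring

/-- A truncation level `z n` with `z n ^ (2 * k n) ≤ n` and `k n ≥ log log n` that discards
only a negligible part of `∑ 1/p`. -/
lemma exists_truncation : ∃ z k : ℕ → ℕ, (∀ᶠ n in atTop, 1 ≤ z n ∧ z n ≤ n ∧
    z n ^ (2 * k n) ≤ n ∧ LL n ≤ k n) ∧
    Tendsto (fun n => (recipSum 1 n - recipSum 1 (z n)) / Real.sqrt (LL n)) atTop (nhds 0) := by
  obtain ⟨C, hC0, hC⟩ := exists_abs_recipSum_sub_le one_pos
  set k : ℕ → ℕ := fun n => ⌈LL n⌉₊ with hk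
  set z : ℕ → ℕ := fun n => ⌊(n : ℝ) ^ ((1 : ℝ) / (2 * k n))⌋₊ with hz
  have hlogn : Tendsto (fun n : ℕ => Real.log n) atTop atTop :=
    Real.tendsto_log_atTop.comp tendsto_natCast_atTop_atTop
  have hlin : Tendsto (fun n : ℕ => Real.log n - 16 * (LL n)) atTop atTop := by
    have h1 : Tendsto (fun y : ℝ => y - 16 * Real.log y) atTop atTop := by
      have h2 := Real.isLittleO_log_id_atTop.bound (show (0 : ℝ) < 1 / 32 by norm_num)
      refine tendsto_atTop_mono' _ ?_ (tendsto_id.atTop_div_const (show (0 : ℝ) < 2 by norm_num))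
      filter_upwards [h2, eventually_ge_atTop 1] with y h hy
      have h3 := le_abs_self (Real.log y)
      rw [Real.norm_eq_abs, Real.norm_eq_abs, id, abs_of_nonneg (by linarith : (0 : ℝ) ≤ y)] at h
      simp only [id]
      linarith
    exact h1.comp hlogn
  have key : ∀ᶠ n : ℕ in atTop, 1 ≤ z n ∧ z n ≤ n ∧ z n ^ (2 * k n) ≤ n ∧ LL n ≤ k n ∧
      LL n - Real.log (LL n) - Real.log 8 ≤ LL (z n) ∧ 1 ≤ Real.log (z n) ∧ 1 ≤ LL (z n) := by
    have hlin2 : Tendsto (fun n : ℕ => LL n - Real.log (LL n) - Real.log 8) atTop atTop := by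
      have h1 : Tendsto (fun y : ℝ => y - Real.log y) atTop atTop := by
        have h2 := Real.isLittleO_log_id_atTop.bound (show (0 : ℝ) < 1 / 2 by norm_num)
        refine tendsto_atTop_mono' _ ?_ (tendsto_id.atTop_div_const (show (0 : ℝ) < 2 by norm_num))
        filter_upwards [h2, eventually_ge_atTop 1] with y h hy
        have h3 := le_abs_self (Real.log y)
        rw [Real.norm_eq_abs, Real.norm_eq_abs, id, abs_of_nonneg (by linarith : (0 : ℝ) ≤ y)] at h
        simp only [id]
        linarith
      exact tendsto_atTop_add_const_right _ (-Real.log 8) (h1.comp tendsto_LL)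
    filter_upwards [eventually_ge_atTop 1, tendsto_LL.eventually_ge_atTop 1,
      hlogn.eventually_ge_atTop 1, hlin.eventually_ge_atTop 0, hlin2.eventually_ge_atTop 1]
      with n hn hL hl h0 h8
    have hn1 : (1 : ℝ) ≤ n := by exact_mod_cast hn
    have hn0 : (0 : ℝ) < n := by linarith
    have hkL : LL n ≤ k n := Nat.le_ceil _
    have hkL2 : (k n : ℝ) ≤ 2 * LL n := by
      have := (Nat.ceil_lt_add_one (by linarith : 0 ≤ LL n)).le
      linarith
    have hk1 : (1 : ℝ) ≤ k n := hL.trans hkL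
    have hk0 : (0 : ℝ) < 2 * k n := by linarith
    set r : ℝ := (n : ℝ) ^ ((1 : ℝ) / (2 * k n)) with hr
    have hr1 : 1 ≤ r := Real.one_le_rpow hn1 (by positivity)
    have hzr : (z n : ℝ) ≤ r := Nat.floor_le (by linarith)
    have hz1 : 1 ≤ z n := Nat.one_le_floor_iff _ |>.2 hr1
    have hpow : z n ^ (2 * k n) ≤ n := by
      have : (z n : ℝ) ^ (2 * k n) ≤ n := by
        calc (z n : ℝ) ^ (2 * k n) ≤ r ^ (2 * k n) := by gcongr
          _ = n := by
            rw [hr, ← Real.rpow_natCast, ← Real.rpow_mul hn0.le]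
            push_cast
            rw [one_div, inv_mul_cancel₀ hk0.ne', Real.rpow_one]
      exact_mod_cast this
    have hkn : k n ≠ 0 := by
      intro h; rw [h] at hk1; norm_num at hk1
    have hzn : z n ≤ n := (Nat.le_self_pow (by omega) _).trans hpow
    have hzr2 : r / 2 ≤ z n := by
      have : r < z n + 1 := Nat.lt_floor_add_one _
      have : (1 : ℝ) ≤ z n := by exact_mod_cast hz1
      linarith
    have hlogr : Real.log r = Real.log n / (2 * k n) := by
      rw [hr, Real.log_rpow hn0]; ring
    have hl2 : Real.log 2 ≤ 1 := by linarith [Real.log_two_lt_d9]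
    have hlz : Real.log n / (8 * LL n) ≤ Real.log (z n) := by
      have h1 : Real.log r - Real.log 2 ≤ Real.log (z n) := by
        rw [← Real.log_div (by linarith) (by norm_num)]
        exact Real.log_le_log (by linarith) hzr2
      have h2 : Real.log n / (4 * LL n) ≤ Real.log r := by
        rw [hlogr]; exact div_le_div_of_nonneg_left (by linarith) hk0 (by linarith)
      have h3 : Real.log n / (4 * LL n) = Real.log n / (8 * LL n) + Real.log n / (8 * LL n) := by
        field_simp; ring
      have h4 : 1 ≤ Real.log n / (8 * LL n) := by
        rw [le_div_iff₀ (by linarith)]; linarith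
      linarith
    have hlz1 : LL n - Real.log (LL n) - Real.log 8 ≤ LL (z n) := by
      have h1 : Real.log (Real.log n / (8 * LL n)) ≤ LL (z n) :=
        Real.log_le_log (by apply div_pos <;> linarith) hlz
      rw [Real.log_div (by linarith) (by linarith), Real.log_mul (by norm_num) (by linarith)] at h1
      change LL n - _ ≤ _ at h1
      linarith
    have h4 : 1 ≤ Real.log n / (8 * LL n) := by
      rw [le_div_iff₀ (by linarith)]; linarith
    exact ⟨hz1, hzn, hpow, hkL, hlz1, h4.trans hlz, h8.trans hlz1⟩
  refine ⟨z, k, key.mono fun n h => ⟨h.1, h.2.1, h.2.2.1, h.2.2.2.1⟩, ?_⟩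
  have hlim : Tendsto (fun n => (2 * C + Real.log 8) / Real.sqrt (LL n) +
      7 * (Real.log (LL n) / Real.sqrt (LL n))) atTop (nhds 0) := by
    have a := (tendsto_log_div_sqrt.comp tendsto_LL).const_mul 7
    have b := ((Real.tendsto_sqrt_atTop.comp tendsto_LL).const_div_atTop (2 * C + Real.log 8))
    simpa using b.add a
  refine squeeze_zero_norm' ?_ hlim
  filter_upwards [key, tendsto_LL.eventually_ge_atTop 1, hlogn.eventually_ge_atTop 1] with
    n ⟨hz1, hzn, _, _, h5, h6, h7⟩ hL hl
  rw [Real.norm_eq_abs, abs_div, abs_of_nonneg (Real.sqrt_nonneg _), mul_div_assoc', ← add_div]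
  gcongr
  have c1 := abs_le.1 (hC n (hz1.trans hzn) hl hL)
  have c2 := abs_le.1 (hC (z n) hz1 h6 h7)
  simp only [Nat.totient_one, Nat.cast_one, div_one] at c1 c2
  have hLz : LL (z n) ≤ LL n := by
    refine Real.log_le_log (by linarith) (Real.log_le_log ?_ ?_)
    · exact_mod_cast hz1
    · exact_mod_cast hzn
  have hLz2 : Real.log (LL (z n)) ≤ Real.log (LL n) := Real.log_le_log (by linarith) hLz
  have hmono : recipSum 1 (z n) ≤ recipSum 1 n := by
    rw [← sum_primesLE_inv, ← sum_primesLE_inv]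
    exact Finset.sum_le_sum_of_subset_of_nonneg (primesLE_mono hzn) fun _ _ _ => by positivity
  rw [abs_of_nonneg (by linarith)]
  linarith [c1.2, c2.1]

/-- The strongly additive function `m ↦ ∑_{p ∣ m} h p`. -/
def addSum (h : ℕ → ℝ) (m : ℕ) : ℝ := ∑ p ∈ m.primeFactors, h p

lemma filter_primesLE_dvd (z : ℕ) {m : ℕ} (hm : m ≠ 0) :
    (primesLE z).filter (· ∣ m) = m.primeFactors.filter (· ≤ z) := by
  ext p
  simp only [Finset.mem_filter, mem_primesLE, Nat.mem_primeFactors]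
  tauto

lemma sum_card_primeFactors_filter_le {z n : ℕ} (hzn : z ≤ n) :
    ∑ m ∈ Finset.Icc 1 n, ((m.primeFactors.filter (z < ·)).card : ℝ) ≤
      n * (recipSum 1 n - recipSum 1 z) := by
  have h1 : ∀ m ∈ Finset.Icc 1 n, ((m.primeFactors.filter (z < ·)).card : ℝ) =
      ∑ p ∈ primesLE n \ primesLE z, if p ∣ m then (1 : ℝ) else 0 := fun m hm => by
    rw [Finset.mem_Icc] at hm
    rw [← Finset.sum_filter, Finset.sum_const, nsmul_eq_mul, mul_one]
    congr 2
    ext p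
    simp only [Finset.mem_filter, Finset.mem_sdiff, mem_primesLE, Nat.mem_primeFactors]
    constructor
    · rintro ⟨⟨hp, hd, h0⟩, hz⟩
      exact ⟨⟨⟨(Nat.le_of_dvd (by omega) hd).trans hm.2, hp⟩, fun h => by omega⟩, hd⟩
    · rintro ⟨⟨⟨h, hp⟩, hz⟩, hd⟩
      exact ⟨⟨hp, hd, by omega⟩, by by_contra h'; exact hz ⟨by omega, hp⟩⟩
  rw [Finset.sum_congr rfl h1, Finset.sum_comm, ← sum_primesLE_inv, ← sum_primesLE_inv,
    ← Finset.sum_sdiff_eq_sub (primesLE_mono hzn), Finset.mul_sum]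
  refine Finset.sum_le_sum fun p _ => ?_
  rw [← Finset.sum_filter, Finset.sum_const, nsmul_eq_mul, mul_one, mul_one_div]
  exact card_multiples_Icc n p

lemma norm_cexp_addSum_sub_le {z n : ℕ} (hzn : z ≤ n) (hn : 1 ≤ n) {g : ℕ → ℝ} {G : ℝ}
    (hg : ∀ p, |g p| ≤ G) :
    ‖(∑ m ∈ Finset.Icc 1 n, Complex.exp (Complex.I * (addSum g m : ℝ))) / n -
      (∑ m ∈ Finset.Icc 1 n, ∏ p ∈ (primesLE z).filter (· ∣ m),
        Complex.exp (Complex.I * (g p : ℝ))) / n‖ ≤ G * (recipSum 1 n - recipSum 1 z) := by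
  have hn0 : (0 : ℝ) < n := by exact_mod_cast hn
  have hG : 0 ≤ G := (abs_nonneg _).trans (hg 0)
  have h1 : ∀ m ∈ Finset.Icc 1 n, ‖Complex.exp (Complex.I * (addSum g m : ℝ)) -
      ∏ p ∈ (primesLE z).filter (· ∣ m), Complex.exp (Complex.I * (g p : ℝ))‖ ≤
      G * ((m.primeFactors.filter (z < ·)).card : ℝ) := fun m hm => by
    rw [Finset.mem_Icc] at hm
    rw [filter_primesLE_dvd z (by omega), ← Complex.exp_sum, ← Finset.mul_sum,
      ← Complex.ofReal_sum]
    have e : addSum g m = ∑ p ∈ m.primeFactors.filter (· ≤ z), g p +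
        ∑ p ∈ m.primeFactors.filter (z < ·), g p := by
      rw [addSum, ← Finset.sum_filter_add_sum_filter_not m.primeFactors (· ≤ z)]
      simp only [not_le]
    rw [e, Complex.ofReal_add, mul_add, Complex.exp_add, ← mul_sub_one, norm_mul, mul_comm Complex.I,
      Complex.norm_exp_ofReal_mul_I, one_mul]
    refine Real.norm_exp_I_mul_ofReal_sub_one_le.trans ?_
    rw [Real.norm_eq_abs]
    refine (Finset.abs_sum_le_sum_abs _ _).trans ((Finset.sum_le_sum fun p _ => hg p).trans ?_)
    rw [Finset.sum_const, nsmul_eq_mul, mul_comm]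
  rw [← sub_div, ← Finset.sum_sub_distrib, norm_div, Complex.norm_natCast, div_le_iff₀ hn0]
  refine (norm_sum_le_of_le _ h1).trans ?_
  rw [← Finset.mul_sum, mul_assoc]
  refine mul_le_mul_of_nonneg_left ?_ hG
  rw [mul_comm]
  exact sum_card_primeFactors_filter_le hzn

lemma norm_prod_sub_prod_le {ι : Type*} (s : Finset ι) {a b : ι → ℂ}
    (ha : ∀ i ∈ s, ‖a i‖ ≤ 1) (hb : ∀ i ∈ s, ‖b i‖ ≤ 1) :
    ‖∏ i ∈ s, a i - ∏ i ∈ s, b i‖ ≤ ∑ i ∈ s, ‖a i - b i‖ := by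
  classical
  induction s using Finset.induction_on with
  | empty => simp
  | insert i s hi ih =>
    rw [Finset.prod_insert hi, Finset.prod_insert hi, Finset.sum_insert hi]
    have ih' := ih (fun j hj => ha j (Finset.mem_insert_of_mem hj))
      (fun j hj => hb j (Finset.mem_insert_of_mem hj))
    have e : a i * ∏ j ∈ s, a j - b i * ∏ j ∈ s, b j =
        (a i - b i) * ∏ j ∈ s, a j + b i * (∏ j ∈ s, a j - ∏ j ∈ s, b j) := by ring
    rw [e]
    refine (norm_add_le _ _).trans ?_
    rw [norm_mul, norm_mul]
    have h1 : ‖∏ j ∈ s, a j‖ ≤ 1 := by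
      rw [norm_prod]
      exact Finset.prod_le_one (fun _ _ => norm_nonneg _)
        fun j hj => ha j (Finset.mem_insert_of_mem hj)
    have h2 := hb i (Finset.mem_insert_self _ _)
    have h3 := norm_nonneg (a i - b i)
    have h4 := norm_nonneg (∏ j ∈ s, a j - ∏ j ∈ s, b j)
    nlinarith

lemma norm_cexp_sub_quadratic_le {x : ℝ} (hx : |x| ≤ 1) :
    ‖Complex.exp (Complex.I * x) - 1 - (Complex.I * x - x ^ 2 / 2)‖ ≤ |x| ^ 3 := by
  have hn : ‖Complex.I * (x : ℂ)‖ = |x| := by simp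
  have h := Complex.exp_bound (x := Complex.I * x) (by rw [hn]; exact hx) (n := 3) (by norm_num)
  rw [hn] at h
  simp only [Finset.sum_range_succ, Finset.sum_range_zero] at h
  have e : Complex.exp (Complex.I * x) - 1 - (Complex.I * x - x ^ 2 / 2) =
      Complex.exp (Complex.I * x) - (0 + (Complex.I * x) ^ 0 / (Nat.factorial 0 : ℂ) +
        (Complex.I * x) ^ 1 / (Nat.factorial 1 : ℂ) +
        (Complex.I * x) ^ 2 / (Nat.factorial 2 : ℂ)) := by
    rw [mul_pow Complex.I _ 2, Complex.I_sq]
    simp [Nat.factorial]; ring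
  rw [e]
  refine h.trans ?_
  have : 0 ≤ |x| ^ 3 := by positivity
  norm_num [Nat.factorial]
  linarith

lemma norm_prod_sub_cexp_le {P : Finset ℕ} (hP : ∀ p ∈ P, p.Prime) {g : ℕ → ℝ} {G : ℝ}
    (hG : G ≤ 1) (hg : ∀ p, |g p| ≤ G) :
    ‖∏ p ∈ P, (1 + (Complex.exp (Complex.I * (g p : ℝ)) - 1) / p) -
      Complex.exp (∑ p ∈ P, (Complex.exp (Complex.I * (g p : ℝ)) - 1) / p)‖ ≤
      G ^ 2 * ∑' p : ℕ, 1 / (p : ℝ) ^ 2 := by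
  have hG0 : 0 ≤ G := (abs_nonneg _).trans (hg 0)
  have hunit : ∀ p, ‖Complex.exp (Complex.I * (g p : ℝ))‖ = 1 := fun p => by
    rw [mul_comm, Complex.norm_exp_ofReal_mul_I]
  rw [Complex.exp_sum]
  refine (norm_prod_sub_prod_le P (fun p hp => ?_) fun p hp => ?_).trans ?_
  · have hp1 : (1 : ℝ) ≤ p := by exact_mod_cast (hP p hp).one_le
    have hp0 : (p : ℂ) ≠ 0 := by exact_mod_cast (hP p hp).ne_zero
    have e : 1 + (Complex.exp (Complex.I * (g p : ℝ)) - 1) / p =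
        ((1 - 1 / p : ℝ) : ℂ) + Complex.exp (Complex.I * (g p : ℝ)) / p := by
      push_cast; field_simp; ring
    rw [e]
    refine (norm_add_le _ _).trans ?_
    have : 1 / (p : ℝ) ≤ 1 := by rw [div_le_one (by linarith)]; exact hp1
    rw [Complex.norm_real, norm_div, hunit, Complex.norm_natCast, Real.norm_eq_abs,
      abs_of_nonneg (by linarith)]
    linarith
  · rw [Complex.norm_exp, Real.exp_le_one_iff, Complex.div_natCast_re, Complex.sub_re, Complex.one_re]
    have h1 : (Complex.exp (Complex.I * (g p : ℝ))).re ≤ 1 := by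
      rw [← hunit p]; exact Complex.re_le_norm _
    exact div_nonpos_of_nonpos_of_nonneg (by linarith) (Nat.cast_nonneg _)
  · have hs : Summable fun p : ℕ => 1 / (p : ℝ) ^ 2 := Real.summable_one_div_nat_pow.2 (by norm_num)
    refine le_trans ?_ (mul_le_mul_of_nonneg_left
      (hs.sum_le_tsum P fun p _ => by positivity) (sq_nonneg G))
    rw [Finset.mul_sum]
    refine Finset.sum_le_sum fun p hp => ?_
    have hp1 : (1 : ℝ) ≤ p := by exact_mod_cast (hP p hp).one_le
    set v := (Complex.exp (Complex.I * (g p : ℝ)) - 1) / p with hv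
    have hvn : ‖v‖ ≤ G / p := by
      rw [hv, norm_div, Complex.norm_natCast]
      gcongr
      refine Real.norm_exp_I_mul_ofReal_sub_one_le.trans ?_
      rw [Real.norm_eq_abs]; exact hg p
    have hv1 : ‖v‖ ≤ 1 := hvn.trans (by rw [div_le_one (by linarith)]; linarith)
    have h := Complex.norm_exp_sub_one_sub_id_le hv1
    rw [norm_sub_rev, ← sub_sub]
    refine h.trans ?_
    rw [mul_one_div, ← div_pow]
    gcongr

lemma tendsto_sqrt_LL : Tendsto (fun n => Real.sqrt (LL n)) atTop atTop :=
  Real.tendsto_sqrt_atTop.comp tendsto_LL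

lemma tendsto_exp_truncation_error (A : ℝ) {k : ℕ → ℕ} (hk : ∀ᶠ n in atTop, LL n ≤ k n) :
    Tendsto (fun n : ℕ => ((Real.sqrt n)⁻¹ + (1 / 2) ^ k n) * Real.exp (A * Real.sqrt (LL n)))
      atTop (nhds 0) := by
  have hl2 : (1 / 2 : ℝ) < Real.log 2 := by linarith [Real.log_two_gt_d9]
  have hlim : Tendsto (fun n : ℕ => 2 * Real.exp (-(Real.sqrt (LL n) *
      (1 / 2 * Real.sqrt (LL n) - A)))) atTop (nhds 0) := by
    have h1 : Tendsto (fun n : ℕ => Real.sqrt (LL n) * (1 / 2 * Real.sqrt (LL n) - A))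
        atTop atTop := by
      refine tendsto_sqrt_LL.atTop_mul_atTop₀ ?_
      exact tendsto_atTop_add_const_right _ (-A)
        (tendsto_sqrt_LL.const_mul_atTop (by norm_num : (0 : ℝ) < 1 / 2))
    simpa using (Real.tendsto_exp_neg_atTop_nhds_zero.comp h1).const_mul 2
  refine squeeze_zero_norm' ?_ hlim
  have hlogn : Tendsto (fun n : ℕ => Real.log n) atTop atTop :=
    Real.tendsto_log_atTop.comp tendsto_natCast_atTop_atTop
  filter_upwards [hk, tendsto_LL.eventually_ge_atTop 1, hlogn.eventually_ge_atTop 1,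
    eventually_ge_atTop 1] with n hk hL hl hn
  have hn0 : (0 : ℝ) < n := by exact_mod_cast hn
  have hLl : LL n ≤ Real.log n := (Real.log_le_sub_one_of_pos (by linarith)).trans (by linarith)
  have h1 : (Real.sqrt n)⁻¹ ≤ Real.exp (-(1 / 2 * LL n)) := by
    rw [Real.sqrt_eq_rpow, ← Real.rpow_neg hn0.le, Real.rpow_def_of_pos hn0]
    apply Real.exp_le_exp.2; linarith
  have h2 : ((1 : ℝ) / 2) ^ k n ≤ Real.exp (-(1 / 2 * LL n)) := by
    rw [one_div, inv_pow, ← Real.rpow_natCast, ← Real.rpow_neg (by norm_num),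
      Real.rpow_def_of_pos (by norm_num)]
    apply Real.exp_le_exp.2; nlinarith
  have hs := Real.mul_self_sqrt (by linarith : 0 ≤ LL n)
  rw [Real.norm_eq_abs, abs_of_nonneg (by positivity)]
  calc _ ≤ (Real.exp (-(1 / 2 * LL n)) + Real.exp (-(1 / 2 * LL n))) *
        Real.exp (A * Real.sqrt (LL n)) := by gcongr
    _ = 2 * Real.exp (-(1 / 2 * LL n) + A * Real.sqrt (LL n)) := by rw [Real.exp_add]; ring
    _ = _ := by
      congr 2
      linear_combination (-1 / 2) * (-hs)

/-- The Erdős–Kac theorem for bounded strongly additive functions, in terms of characteristic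
functions. -/
theorem tendsto_avg_cexp_addSum {h : ℕ → ℝ} {H M₁ M₂ : ℝ} (hH : ∀ p, |h p| ≤ H)
    (hM₁ : Tendsto (fun n => ((∑ p ∈ primesLE n, h p / p) - M₁ * LL n) / Real.sqrt (LL n))
      atTop (nhds 0))
    (hM₂ : Tendsto (fun n => (∑ p ∈ primesLE n, h p ^ 2 / p) / LL n) atTop (nhds M₂)) :
    Tendsto (fun n : ℕ => (∑ m ∈ Finset.Icc 1 n,
      Complex.exp (Complex.I * ((addSum h m - M₁ * LL n) / Real.sqrt (LL n) : ℝ))) / n)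
      atTop (nhds (Complex.exp (-(M₂ / 2 : ℝ)))) := by
  obtain ⟨z, k, hzk, hz⟩ := exists_truncation
  have hH0 : 0 ≤ H := (abs_nonneg _).trans (hH 0)
  set u : ℕ → ℝ := fun n => (Real.sqrt (LL n))⁻¹ with hu
  set g : ℕ → ℕ → ℝ := fun n p => h p * u n with hg
  set w : ℕ → ℕ → ℂ := fun n p => Complex.exp (Complex.I * (g n p : ℝ)) - 1 with hw
  have hu0 : ∀ n, 0 ≤ u n := fun n => by positivity
  have hulim : Tendsto u atTop (nhds 0) := tendsto_inv_atTop_zero.comp tendsto_sqrt_LL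
  have hgG : ∀ n p, |g n p| ≤ H * u n := fun n p => by
    rw [hg, abs_mul, abs_of_nonneg (hu0 n)]
    exact mul_le_mul_of_nonneg_right (hH p) (hu0 n)
  have hwG : ∀ n p, ‖w n p‖ ≤ H * u n := fun n p =>
    Real.norm_exp_I_mul_ofReal_sub_one_le.trans (by rw [Real.norm_eq_abs]; exact hgG n p)
  have hu2 : ∀ᶠ n in atTop, u n ^ 2 * LL n = 1 := by
    filter_upwards [tendsto_LL.eventually_gt_atTop 0] with n hn
    rw [hu, inv_pow, Real.sq_sqrt hn.le, inv_mul_cancel₀ hn.ne']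
  have hgle : ∀ᶠ n in atTop, H * u n ≤ 1 := by
    have := hulim.const_mul H
    rw [mul_zero] at this
    exact this.eventually_le_const one_pos
  have hR2 : ∀ᶠ n in atTop, recipSum 1 n ≤ 2 * LL n := by
    filter_upwards [tendsto_recipSum_one_div.eventually_le_const (show (1 : ℝ) < 2 by norm_num),
      tendsto_LL.eventually_gt_atTop 0] with n h1 h2
    rwa [div_le_iff₀ h2] at h1
  set R : ℕ → ℝ := fun n => recipSum 1 n - recipSum 1 (z n) with hR
  have hRu : Tendsto (fun n => R n * u n) atTop (nhds 0) := hz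
  set A : ℕ → ℂ := fun n =>
    (∑ m ∈ Finset.Icc 1 n, Complex.exp (Complex.I * (addSum (g n) m : ℝ))) / n with hA
  set B : ℕ → ℂ := fun n => (∑ m ∈ Finset.Icc 1 n, ∏ p ∈ (primesLE (z n)).filter (· ∣ m),
    (1 + w n p)) / n with hB
  set D : ℕ → ℂ := fun n => ∏ p ∈ primesLE (z n), (1 + w n p / p) with hD
  set E : ℕ → ℂ := fun n => ∑ p ∈ primesLE (z n), w n p / p with hE
  have hAB : Tendsto (fun n => A n - B n) atTop (nhds 0) := by
    have h1 := hRu.const_mul H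
    rw [mul_zero] at h1
    refine squeeze_zero_norm' ?_ h1
    filter_upwards [hzk, eventually_ge_atTop 1] with n hz hn
    have h2 := norm_cexp_addSum_sub_le hz.2.1 hn (hgG n)
    simp only [hA, hB, hw, add_sub_cancel]
    refine h2.trans (le_of_eq ?_)
    simp only [hR]; ring
  have hBD : Tendsto (fun n => B n - D n) atTop (nhds 0) := by
    refine squeeze_zero_norm' ?_ (tendsto_exp_truncation_error (4 * H)
      (hzk.mono fun n h => h.2.2.2))
    filter_upwards [hzk, eventually_ge_atTop 1, hR2, hu2, tendsto_LL.eventually_gt_atTop 0]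
      with n hz hn hR hu2 hL
    have h2 := norm_avg_prod_sub_le (P := primesLE (z n)) (fun p hp => (mem_primesLE.1 hp).2)
      (w n) hn (fun p hp => (mem_primesLE.1 hp).1) hz.1 hz.2.2.1
    refine h2.trans ?_
    have h3 : ∑ p ∈ primesLE (z n), ‖w n p‖ / p ≤ H * u n * (2 * LL n) := by
      calc _ ≤ ∑ p ∈ primesLE n, ‖w n p‖ / p :=
            Finset.sum_le_sum_of_subset_of_nonneg (primesLE_mono hz.2.1) fun _ _ _ => by positivity
        _ ≤ ∑ p ∈ primesLE n, H * u n * (1 / p) := Finset.sum_le_sum fun p _ => by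
            rw [mul_one_div]; gcongr; exact hwG n p
        _ = H * u n * recipSum 1 n := by rw [← Finset.mul_sum, sum_primesLE_inv]
        _ ≤ _ := mul_le_mul_of_nonneg_left hR (mul_nonneg hH0 (hu0 n))
    have h4 : u n * LL n = Real.sqrt (LL n) := by
      have hs : Real.sqrt (LL n) ≠ 0 := (Real.sqrt_pos.2 hL).ne'
      have := Real.mul_self_sqrt hL.le
      rw [hu]; field_simp; linarith
    have h5 : 2 * ∑ p ∈ primesLE (z n), ‖w n p‖ / p ≤ 4 * H * Real.sqrt (LL n) := by
      rw [← h4]; linarith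
    gcongr
  have hDE : Tendsto (fun n => D n - Complex.exp (E n)) atTop (nhds 0) := by
    have h1 : Tendsto (fun n => (H * u n) ^ 2 * ∑' p : ℕ, 1 / (p : ℝ) ^ 2) atTop (nhds 0) := by
      have := ((hulim.const_mul H).pow 2).mul_const (∑' p : ℕ, 1 / (p : ℝ) ^ 2)
      simpa using this
    refine squeeze_zero_norm' ?_ h1
    filter_upwards [hgle] with n hn
    exact norm_prod_sub_cexp_le (fun p hp => (mem_primesLE.1 hp).2) hn (hgG n)
  set F : ℕ → ℂ := fun n => ∑ p ∈ primesLE n, (Complex.I * (g n p : ℝ) - (g n p : ℝ) ^ 2 / 2) / p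
    with hF
  have hEF : Tendsto (fun n => E n - F n) atTop (nhds 0) := by
    have h1 : Tendsto (fun n => 2 * H ^ 3 * u n + H * (R n * u n) +
        H ^ 2 * (u n * (R n * u n))) atTop (nhds 0) := by
      have := ((hulim.const_mul (2 * H ^ 3)).add (hRu.const_mul H)).add
        ((hulim.mul hRu).const_mul (H ^ 2))
      simpa using this
    refine squeeze_zero_norm' ?_ h1
    filter_upwards [hzk, hgle, hR2, hu2] with n hz hgle hR2 hu2
    have hRn : ∑ p ∈ primesLE n \ primesLE (z n), (1 : ℝ) / p = R n := by
      rw [Finset.sum_sdiff_eq_sub (primesLE_mono hz.2.1), sum_primesLE_inv, sum_primesLE_inv]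
    have e : E n - F n = ∑ p ∈ primesLE (z n),
        (w n p - (Complex.I * (g n p : ℝ) - (g n p : ℝ) ^ 2 / 2)) / p -
        ∑ p ∈ primesLE n \ primesLE (z n),
          (Complex.I * (g n p : ℝ) - (g n p : ℝ) ^ 2 / 2) / p := by
      rw [Finset.sum_sdiff_eq_sub (primesLE_mono hz.2.1)]
      simp only [hE, hF, sub_div _ _ ((_ : ℕ) : ℂ), Finset.sum_sub_distrib]
      ring
    rw [e]
    refine (norm_sub_le _ _).trans ?_
    have b1 : ‖∑ p ∈ primesLE (z n),
        (w n p - (Complex.I * (g n p : ℝ) - (g n p : ℝ) ^ 2 / 2)) / p‖ ≤ 2 * H ^ 3 * u n := by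
      calc _ ≤ ∑ p ∈ primesLE (z n), (H * u n) ^ 3 * (1 / p) := by
            refine norm_sum_le_of_le _ fun p _ => ?_
            rw [norm_div, Complex.norm_natCast, mul_one_div]
            gcongr
            refine (norm_cexp_sub_quadratic_le ((hgG n p).trans hgle)).trans ?_
            gcongr
            exact hgG n p
        _ ≤ ∑ p ∈ primesLE n, (H * u n) ^ 3 * (1 / p) := by
            refine Finset.sum_le_sum_of_subset_of_nonneg (primesLE_mono hz.2.1) fun _ _ _ => ?_
            have := hu0 n; positivity
        _ = (H * u n) ^ 3 * recipSum 1 n := by rw [← Finset.mul_sum, sum_primesLE_inv]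
        _ ≤ (H * u n) ^ 3 * (2 * LL n) := by
            have := hu0 n
            gcongr
        _ = _ := by linear_combination 2 * H ^ 3 * u n * hu2
    have b2 : ‖∑ p ∈ primesLE n \ primesLE (z n),
        (Complex.I * (g n p : ℝ) - (g n p : ℝ) ^ 2 / 2) / p‖ ≤
        H * (R n * u n) + H ^ 2 * (u n * (R n * u n)) := by
      calc _ ≤ ∑ p ∈ primesLE n \ primesLE (z n), (H * u n + (H * u n) ^ 2) * (1 / p) := by
            refine norm_sum_le_of_le _ fun p _ => ?_
            rw [norm_div, Complex.norm_natCast, mul_one_div]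
            gcongr
            refine (norm_sub_le _ _).trans (add_le_add ?_ ?_)
            · rw [norm_mul, Complex.norm_I, one_mul, Complex.norm_real]; exact hgG n p
            · rw [norm_div, norm_pow, Complex.norm_real, Real.norm_eq_abs]
              have h2 : |g n p| ^ 2 ≤ (H * u n) ^ 2 := by
                gcongr
                exact hgG n p
              have h3 : 0 ≤ |g n p| ^ 2 := by positivity
              norm_num
              norm_num at h3 h2
              linarith
        _ = _ := by rw [← Finset.mul_sum, hRn]; ring
    linarith
  have hFlim : Tendsto (fun n => F n - Complex.I * (M₁ * LL n * u n : ℝ)) atTop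
      (nhds (-(M₂ / 2 : ℝ))) := by
    have h1 : Tendsto (fun n => Complex.I *
        ((((∑ p ∈ primesLE n, h p / p) - M₁ * LL n) / Real.sqrt (LL n) : ℝ) : ℂ) -
        ((1 / 2 * ((∑ p ∈ primesLE n, h p ^ 2 / p) / LL n) : ℝ) : ℂ)) atTop
        (nhds (Complex.I * ((0 : ℝ) : ℂ) - ((1 / 2 * M₂ : ℝ) : ℂ))) :=
      (((Complex.continuous_ofReal.tendsto _).comp hM₁).const_mul Complex.I).sub
        ((Complex.continuous_ofReal.tendsto _).comp (hM₂.const_mul (1 / 2)))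
    have e : Complex.I * ((0 : ℝ) : ℂ) - ((1 / 2 * M₂ : ℝ) : ℂ) = (-(M₂ / 2 : ℝ)) := by
      push_cast; ring
    rw [e] at h1
    refine h1.congr' ?_
    filter_upwards [hu2, tendsto_LL.eventually_gt_atTop 0] with n hu2 hL
    have e1 : (∑ p ∈ primesLE n, h p ^ 2 / p) / LL n =
        u n ^ 2 * ∑ p ∈ primesLE n, h p ^ 2 / p := by
      rw [div_eq_iff hL.ne']; linear_combination (-(∑ p ∈ primesLE n, h p ^ 2 / p)) * hu2
    rw [e1, div_eq_mul_inv _ (Real.sqrt _)]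
    change Complex.I * (((_ - _) * u n : ℝ) : ℂ) - _ = _
    simp only [hF, hg, sub_div _ _ ((_ : ℕ) : ℂ), Finset.sum_sub_distrib]
    push_cast
    rw [sub_mul, mul_sub, sub_right_comm]
    congr 1
    congr 1
    · rw [Finset.sum_mul, Finset.mul_sum]
      exact Finset.sum_congr rfl fun p _ => by ring
    · rw [Finset.mul_sum, Finset.mul_sum]
      exact Finset.sum_congr rfl fun p _ => by ring
  set θ : ℕ → ℂ := fun n => Complex.exp (Complex.I * ((-(M₁ * LL n * u n) : ℝ) : ℂ)) with hθ
  have hθ1 : ∀ n, ‖θ n‖ ≤ 1 := fun n => by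
    simp only [hθ]; rw [mul_comm, Complex.norm_exp_ofReal_mul_I]
  have hExp : Tendsto (fun n => θ n * Complex.exp (E n)) atTop
      (nhds (Complex.exp (-(M₂ / 2 : ℝ)))) := by
    have h1 := hEF.add hFlim
    rw [zero_add] at h1
    refine ((Complex.continuous_exp.tendsto _).comp h1).congr fun n => ?_
    simp only [hθ, Function.comp, ← Complex.exp_add]
    congr 1; push_cast; ring
  have hdiff : Tendsto (fun n => θ n * (A n - Complex.exp (E n))) atTop (nhds 0) := by
    have h1 := (hAB.add hBD).add hDE
    simp only [sub_add_sub_cancel, add_zero] at h1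
    refine squeeze_zero_norm (fun n => ?_) (tendsto_zero_iff_norm_tendsto_zero.1 h1)
    rw [norm_mul]
    exact mul_le_of_le_one_left (norm_nonneg _) (hθ1 n)
  have hfin := hdiff.add hExp
  rw [zero_add] at hfin
  refine hfin.congr fun n => ?_
  rw [← mul_add, sub_add_cancel, hA, mul_div_assoc', Finset.mul_sum]
  congr 1
  refine Finset.sum_congr rfl fun m _ => ?_
  rw [hθ, ← Complex.exp_add, ← mul_add, ← Complex.ofReal_add]
  congr 3
  rw [addSum, addSum, ← Finset.sum_mul, div_eq_mul_inv]
  ring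

lemma cnt_eq_card (P : ℕ → Prop) [DecidablePred P] (n : ℕ) :
    cnt P n = ((Finset.Icc 1 n).filter P).card := by
  rw [cnt, ← Set.ncard_coe_finset]
  congr 1
  ext m
  simp [and_assoc]

/-- The distribution of `X m` for `m` uniform in `{1, …, n}`. -/
def empirical {E : Type*} [MeasurableSpace E] (X : ℕ → E) (n : ℕ) : Measure E :=
  ((n : ENNReal)⁻¹) • ∑ m ∈ Finset.Icc 1 n, Measure.dirac (X m)

lemma empirical_apply {E : Type*} [MeasurableSpace E] [MeasurableSingletonClass E] (X : ℕ → E)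
    (n : ℕ) (S : Set E) :
    empirical X n S = ENNReal.ofReal ((cnt (fun m => X m ∈ S) n : ℝ) / n) := by
  classical
  rcases Nat.eq_zero_or_pos n with rfl | hn
  · simp [empirical]
  have hn0 : (0 : ℝ) < n := by exact_mod_cast hn
  rw [cnt_eq_card, empirical, Measure.smul_apply, Measure.finsetSum_apply, smul_eq_mul,
    ENNReal.ofReal_div_of_pos hn0, ENNReal.ofReal_natCast, ENNReal.ofReal_natCast,
    div_eq_mul_inv, mul_comm, Finset.card_filter, Nat.cast_sum]
  congr 1
  refine Finset.sum_congr rfl fun m _ => ?_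
  rw [Measure.dirac_apply, Set.indicator_apply]
  split_ifs <;> simp

lemma isProbabilityMeasure_empirical {E : Type*} [MeasurableSpace E] (X : ℕ → E) {n : ℕ}
    (hn : 0 < n) : IsProbabilityMeasure (empirical X n) := by
  refine ⟨?_⟩
  rw [empirical, Measure.smul_apply, Measure.finsetSum_apply, smul_eq_mul]
  simp only [measure_univ, Finset.sum_const, Nat.card_Icc, add_tsub_cancel_right, nsmul_eq_mul,
    mul_one]
  exact ENNReal.inv_mul_cancel (by exact_mod_cast hn.ne') (ENNReal.natCast_ne_top n)

lemma charFun_empirical {E : Type*} [NormedAddCommGroup E] [InnerProductSpace ℝ E]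
    [MeasurableSpace E] [BorelSpace E] (X : ℕ → E) (n : ℕ) (t : E) :
    charFun (empirical X n) t =
      (∑ m ∈ Finset.Icc 1 n, Complex.exp (Complex.I * (inner ℝ (X m) t : ℝ))) / n := by
  rw [charFun_apply, empirical, integral_smul_measure, integral_finsetSum_measure]
  · rw [Complex.real_smul, mul_comm, div_eq_mul_inv, ENNReal.toReal_inv, ENNReal.toReal_natCast]
    push_cast
    congr 1
    refine Finset.sum_congr rfl fun m _ => ?_
    rw [integral_dirac, mul_comm]
  · intro m _
    exact (integrable_const (1 : ℝ)).mono' (by fun_prop) (ae_of_all _ fun x => by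
      rw [Complex.norm_exp_ofReal_mul_I])

/-- Lévy's continuity theorem and the portmanteau theorem for pairs of arithmetic functions. -/
theorem tendsto_cnt_pair {X Y : ℕ → ℕ → ℝ}
    (h : ∀ s t : ℝ, Tendsto (fun n : ℕ => (∑ m ∈ Finset.Icc 1 n,
      Complex.exp (Complex.I * (s * X n m + t * Y n m : ℝ))) / n) atTop
      (nhds (Complex.exp (-((s ^ 2 + t ^ 2) / 2 : ℝ)))))
    {S : Set (ℝ × ℝ)} (hS : ((gaussianReal 0 1).prod (gaussianReal 0 1)) (frontier S) = 0) :
    Tendsto (fun n : ℕ => (cnt (fun m => (X n m, Y n m) ∈ S) n : ℝ) / n) atTop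
      (nhds (((gaussianReal 0 1).prod (gaussianReal 0 1)).real S)) := by
  set Z : ℕ → ℕ → WithLp 2 (ℝ × ℝ) := fun n m => WithLp.toLp 2 (X n m, Y n m) with hZ
  set γ : Measure (ℝ × ℝ) := (gaussianReal 0 1).prod (gaussianReal 0 1) with hγ
  have hprob : ∀ n, IsProbabilityMeasure (empirical (Z (n + 1)) (n + 1)) := fun n =>
    isProbabilityMeasure_empirical _ (Nat.succ_pos n)
  have hγp : IsProbabilityMeasure (γ.map (WithLp.toLp 2)) :=
    Measure.isProbabilityMeasure_map (by fun_prop)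
  let μs : ℕ → ProbabilityMeasure (WithLp 2 (ℝ × ℝ)) := fun n =>
    ⟨empirical (Z (n + 1)) (n + 1), hprob n⟩
  let μ : ProbabilityMeasure (WithLp 2 (ℝ × ℝ)) := ⟨γ.map (WithLp.toLp 2), hγp⟩
  have hlim : Tendsto μs atTop (nhds μ) := by
    refine ProbabilityMeasure.tendsto_of_tendsto_charFun fun t => ?_
    have h1 := (tendsto_add_atTop_iff_nat 1).2 (h (WithLp.ofLp t).1 (WithLp.ofLp t).2)
    have e : charFun (μ : Measure (WithLp 2 (ℝ × ℝ))) t =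
        Complex.exp (-(((WithLp.ofLp t).1 ^ 2 + (WithLp.ofLp t).2 ^ 2) / 2 : ℝ)) := by
      change charFun (γ.map (WithLp.toLp 2)) t = _
      rw [hγ, charFun_prod, charFun_gaussianReal, charFun_gaussianReal, ← Complex.exp_add]
      congr 1
      push_cast
      simp only [mul_zero, zero_mul, zero_sub, one_mul]
      ring
    rw [e]
    refine h1.congr fun n => ?_
    change _ = charFun (empirical (Z (n + 1)) (n + 1)) t
    rw [charFun_empirical]
    congr 1
  have hcont : Continuous (WithLp.ofLp : WithLp 2 (ℝ × ℝ) → ℝ × ℝ) :=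
    WithLp.prod_continuous_ofLp 2 ℝ ℝ
  have hlim2 := ProbabilityMeasure.tendsto_map_of_tendsto_of_continuous μs μ hlim hcont
  have hμmap : ((μ.map hcont.aemeasurable : ProbabilityMeasure (ℝ × ℝ)) : Measure (ℝ × ℝ)) = γ := by
    change (γ.map (WithLp.toLp 2)).map WithLp.ofLp = γ
    rw [Measure.map_map (by fun_prop) (by fun_prop)]
    exact Measure.map_id
  have key := ProbabilityMeasure.tendsto_measure_of_null_frontier_of_tendsto' hlim2
    (E := S) (by rw [hμmap]; exact hS)
  rw [hμmap] at key
  have key2 := (ENNReal.tendsto_toReal (measure_ne_top γ S)).comp key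
  refine (tendsto_add_atTop_iff_nat 1).1 (key2.congr fun n => ?_)
  have hmap : ((μs n).map hcont.aemeasurable : Measure (ℝ × ℝ)) =
      empirical (fun m => (X (n + 1) m, Y (n + 1) m)) (n + 1) := by
    change (empirical (Z (n + 1)) (n + 1)).map WithLp.ofLp = _
    rw [empirical, Measure.map_smul, empirical, Measure.map_finset_sum hcont.aemeasurable]
    congr 1
    refine Finset.sum_congr rfl fun m _ => ?_
    exact Measure.map_dirac (Z (n + 1) m)
  simp only [Function.comp]
  rw [hmap, empirical_apply, ENNReal.toReal_ofReal (by positivity)]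

lemma integrable_exp_neg_sq_div_two : Integrable fun x : ℝ => Real.exp (-x ^ 2 / 2) := by
  refine (integrable_exp_neg_mul_sq (b := 1 / 2) (by norm_num)).congr (ae_of_all _ fun x => ?_)
  simp only
  ring_nf

lemma integrable_mul_exp_neg_sq_div_two : Integrable fun x : ℝ => x * Real.exp (-x ^ 2 / 2) := by
  refine (integrable_mul_exp_neg_mul_sq (b := 1 / 2) (by norm_num)).congr (ae_of_all _ fun x => ?_)
  simp only
  ring_nf

lemma integral_Ioi_exp_neg_sq_div_two (a : ℝ) :
    ∫ w in Set.Ioi a, Real.exp (-w ^ 2 / 2) =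
      Real.sqrt (2 * Real.pi) / 2 - ∫ w in (0 : ℝ)..a, Real.exp (-w ^ 2 / 2) := by
  have h0 : ∫ w in Set.Ioi (0 : ℝ), Real.exp (-w ^ 2 / 2) = Real.sqrt (2 * Real.pi) / 2 := by
    have := integral_gaussian_Ioi (1 / 2)
    rw [show Real.pi / (1 / 2) = 2 * Real.pi by ring] at this
    rw [← this]
    congr 1
    ext w
    ring_nf
  have h1 := intervalIntegral.integral_interval_add_Ioi
    (integrable_exp_neg_sq_div_two.integrableOn (s := Set.Ioi 0))
    (integrable_exp_neg_sq_div_two.integrableOn (s := Set.Ioi a))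
  linarith

lemma gaussianReal_real_eq {S : Set ℝ} :
    (gaussianReal 0 1).real S =
      (Real.sqrt (2 * Real.pi))⁻¹ * ∫ x in S, Real.exp (-x ^ 2 / 2) := by
  rw [Measure.real, gaussianReal_apply_eq_integral 0 one_ne_zero, ENNReal.toReal_ofReal,
    ← integral_const_mul]
  · congr 1
    ext x
    simp [gaussianPDFReal]
  · exact integral_nonneg fun x => gaussianPDFReal_nonneg _ _ _

lemma integral_Iic_mul_exp_neg_mul_sq (x : ℝ) {b : ℝ} (hb : 0 < b) :
    ∫ u in Set.Iic x, u * Real.exp (-b * u ^ 2) = -(Real.exp (-b * x ^ 2) / (2 * b)) := by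
  have hd : ∀ u : ℝ, HasDerivAt (fun u => -(Real.exp (-b * u ^ 2) / (2 * b)))
      (u * Real.exp (-b * u ^ 2)) u := by
    intro u
    have h1 : HasDerivAt (fun u : ℝ => -b * u ^ 2) (-b * (2 * u)) u := by
      simpa using (hasDerivAt_pow 2 u).const_mul (-b)
    refine ((h1.exp.div_const (2 * b)).neg).congr_deriv ?_
    field_simp
  have hlim : Tendsto (fun u : ℝ => -(Real.exp (-b * u ^ 2) / (2 * b))) atBot (nhds 0) := by
    have h2 : Tendsto (fun u : ℝ => -b * u ^ 2) atBot atBot :=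
      Tendsto.const_mul_atTop_of_neg (by linarith) (((tendsto_pow_atTop two_ne_zero).comp
        tendsto_neg_atBot_atTop).congr fun u => by simp)
    simpa using ((Real.tendsto_exp_atBot.comp h2).div_const (2 * b)).neg
  rw [integral_Iic_of_hasDerivAt_of_tendsto (hd x).continuousAt.continuousWithinAt
    (fun u _ => hd u) (integrable_mul_exp_neg_mul_sq hb).integrableOn hlim, sub_zero]

lemma integral_Iic_exp_mul_interval (x : ℝ) {κ : ℝ} (hκ : 0 ≤ κ) :
    ∫ u in Set.Iic x, Real.exp (-u ^ 2 / 2) * ∫ w in (0 : ℝ)..κ * u, Real.exp (-w ^ 2 / 2) =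
      -(2 * Real.pi * OwenT x κ) := by
  have e1 : ∀ u : ℝ, Real.exp (-u ^ 2 / 2) * ∫ w in (0 : ℝ)..κ * u, Real.exp (-w ^ 2 / 2) =
      ∫ s in Set.Ioc 0 κ, u * Real.exp (-u ^ 2 / 2) * Real.exp (-(u * s) ^ 2 / 2) := by
    intro u
    have := intervalIntegral.mul_integral_comp_mul_left (a := 0) (b := κ)
      (f := fun w => Real.exp (-w ^ 2 / 2)) u
    rw [mul_zero, mul_comm u κ] at this
    rw [← this, intervalIntegral.integral_of_le hκ, integral_const_mul]
    ring
  simp_rw [e1]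
  rw [integral_integral_swap]
  · rw [OwenT, ← mul_assoc, mul_inv_cancel₀ (by positivity), one_mul,
      intervalIntegral.integral_of_le hκ, ← integral_neg]
    congr 1
    ext s
    have := integral_Iic_mul_exp_neg_mul_sq x (b := (1 + s ^ 2) / 2) (by positivity)
    rw [show 2 * ((1 + s ^ 2) / 2) = 1 + s ^ 2 by ring,
      show -((1 + s ^ 2) / 2) * x ^ 2 = -(1 + s ^ 2) * x ^ 2 / 2 by ring] at this
    rw [← this]
    congr 1
    ext u
    rw [mul_assoc, ← Real.exp_add]
    ring_nf
  · have hi := Integrable.mul_prod (μ := volume.restrict (Set.Iic x))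
      (ν := volume.restrict (Set.Ioc 0 κ)) integrable_mul_exp_neg_sq_div_two.restrict
      (integrable_const (1 : ℝ))
    refine hi.mono (by fun_prop) (ae_of_all _ fun z => ?_)
    simp only [Function.uncurry, norm_mul, mul_one, Real.norm_eq_abs, Real.abs_exp]
    refine mul_le_of_le_one_right (by positivity) (Real.exp_le_one_iff.2 ?_)
    nlinarith [sq_nonneg (z.1 * z.2)]

lemma OwenT_neg (h a : ℝ) : OwenT h (-a) = -OwenT h a := by
  have := intervalIntegral.integral_comp_neg (a := 0) (b := a)
    (fun t => Real.exp (-(1 + t ^ 2) * h ^ 2 / 2) / (1 + t ^ 2))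
  simp only [neg_sq, neg_zero] at this
  rw [OwenT, OwenT, intervalIntegral.integral_symm, ← this]
  ring

lemma gaussian_prod_real_eq {x κ : ℝ} (hκ : 0 ≤ κ) {S : Set (ℝ × ℝ)} (hS : MeasurableSet S)
    (h : ∀ u, (gaussianReal 0 1).real (Prod.mk u ⁻¹' S) =
      (Set.Iic x).indicator (fun u => (gaussianReal 0 1).real (Set.Ioi (κ * u))) u) :
    ((gaussianReal 0 1).prod (gaussianReal 0 1)).real S = PhiSkew x (-κ) / 2 := by
  rw [Measure.real, Measure.prod_apply hS, ← integral_toReal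
    (measurable_measure_prodMk_left hS).aemeasurable (ae_of_all _ fun u => measure_lt_top _ _)]
  have e : ∀ u, ((gaussianReal 0 1) (Prod.mk u ⁻¹' S)).toReal = _ := h
  simp_rw [e]
  rw [integral_gaussianReal_eq_integral_smul one_ne_zero]
  set c : ℝ := (Real.sqrt (2 * Real.pi))⁻¹ with hc
  have hc2 : c * c = (2 * Real.pi)⁻¹ := by
    rw [hc, ← mul_inv, Real.mul_self_sqrt (by positivity)]
  have hc1 : c * Real.sqrt (2 * Real.pi) = 1 := inv_mul_cancel₀ (by positivity)
  have e2 : (fun u => gaussianPDFReal 0 1 u • (Set.Iic x).indicator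
      (fun u => (gaussianReal 0 1).real (Set.Ioi (κ * u))) u) =
      (Set.Iic x).indicator (fun u => c / 2 * Real.exp (-u ^ 2 / 2) - (2 * Real.pi)⁻¹ *
        (Real.exp (-u ^ 2 / 2) * ∫ w in (0 : ℝ)..κ * u, Real.exp (-w ^ 2 / 2))) := by
    ext u
    by_cases hu : u ∈ Set.Iic x
    · rw [Set.indicator_of_mem hu, Set.indicator_of_mem hu, gaussianReal_real_eq,
        integral_Ioi_exp_neg_sq_div_two, ← hc2]
      simp only [gaussianPDFReal, NNReal.coe_one, mul_one, sub_zero, smul_eq_mul, ← hc]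
      linear_combination (c * Real.exp (-u ^ 2 / 2) / 2) * hc1
    · rw [Set.indicator_of_notMem hu, Set.indicator_of_notMem hu, smul_zero]
  have hint : Integrable (fun u : ℝ => Real.exp (-u ^ 2 / 2) *
      ∫ w in (0 : ℝ)..κ * u, Real.exp (-w ^ 2 / 2)) := by
    have hcont : Continuous fun u : ℝ => ∫ w in (0 : ℝ)..κ * u, Real.exp (-w ^ 2 / 2) :=
      (intervalIntegral.continuous_primitive
        (fun a b => integrable_exp_neg_sq_div_two.intervalIntegrable) 0).comp
        (continuous_const.mul continuous_id)
    refine integrable_exp_neg_sq_div_two.mul_bdd (c := ∫ w : ℝ, Real.exp (-w ^ 2 / 2))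
      hcont.aestronglyMeasurable (ae_of_all _ fun u => ?_)
    refine (intervalIntegral.norm_integral_le_integral_norm_uIoc).trans ?_
    simp only [Real.norm_eq_abs, Real.abs_exp]
    exact setIntegral_le_integral integrable_exp_neg_sq_div_two
      (ae_of_all _ fun _ => (Real.exp_pos _).le)
  rw [e2, integral_indicator measurableSet_Iic, integral_sub
    (integrable_exp_neg_sq_div_two.const_mul _).integrableOn (hint.const_mul _).integrableOn,
    integral_const_mul, integral_const_mul, integral_Iic_exp_mul_interval x hκ, PhiSkew, OwenT_neg,
    Phi, ← hc]
  field_simp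

/-- The planar sector `{(u, w) | u ≤ x, κu ≤ w}`. -/
def sector (x κ : ℝ) : Set (ℝ × ℝ) := {z | z.1 ≤ x ∧ κ * z.1 ≤ z.2}

/-- The planar sector `{(u, w) | u ≤ x, κu < w}`. -/
def strictSector (x κ : ℝ) : Set (ℝ × ℝ) := {z | z.1 ≤ x ∧ κ * z.1 < z.2}

lemma isClosed_sector (x κ : ℝ) : IsClosed (sector x κ) :=
  (isClosed_le continuous_fst continuous_const).inter
    (isClosed_le (continuous_const.mul continuous_fst) continuous_snd)

lemma measurableSet_strictSector (x κ : ℝ) : MeasurableSet (strictSector x κ) :=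
  (measurableSet_le measurable_fst measurable_const).inter
    (measurableSet_lt (measurable_const.mul measurable_fst) measurable_snd)

lemma gaussian_sector (x : ℝ) {κ : ℝ} (hκ : 0 ≤ κ) :
    ((gaussianReal 0 1).prod (gaussianReal 0 1)).real (sector x κ) = PhiSkew x (-κ) / 2 := by
  refine gaussian_prod_real_eq hκ (isClosed_sector x κ).measurableSet fun u => ?_
  by_cases hu : u ∈ Set.Iic x
  · rw [Set.indicator_of_mem hu, gaussianReal_real_eq, gaussianReal_real_eq,
      ← integral_Ici_eq_integral_Ioi]
    congr 3
    ext w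
    simp [sector, Set.mem_Iic.1 hu]
  · rw [Set.indicator_of_notMem hu, show Prod.mk u ⁻¹' sector x κ = ∅ from
      Set.eq_empty_of_forall_notMem fun w hw => hu hw.1, measureReal_empty]

lemma gaussian_strictSector (x : ℝ) {κ : ℝ} (hκ : 0 ≤ κ) :
    ((gaussianReal 0 1).prod (gaussianReal 0 1)).real (strictSector x κ) =
      PhiSkew x (-κ) / 2 := by
  refine gaussian_prod_real_eq hκ (measurableSet_strictSector x κ) fun u => ?_
  by_cases hu : u ∈ Set.Iic x
  · rw [Set.indicator_of_mem hu]
    congr 1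
    ext w
    simp [strictSector, Set.mem_Iic.1 hu]
  · rw [Set.indicator_of_notMem hu, show Prod.mk u ⁻¹' strictSector x κ = ∅ from
      Set.eq_empty_of_forall_notMem fun w hw => hu hw.1, measureReal_empty]

lemma gaussian_boundary (x κ : ℝ) :
    ((gaussianReal 0 1).prod (gaussianReal 0 1)) {z : ℝ × ℝ | z.1 = x ∨ z.2 = κ * z.1} = 0 := by
  have hna : ∀ a : ℝ, (gaussianReal 0 1) {a} = 0 := fun a => by
    have := nullSingletonClass_gaussianReal (μ := 0) (v := 1) one_ne_zero
    exact measure_singleton a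
  have hm : MeasurableSet {z : ℝ × ℝ | z.2 = κ * z.1} :=
    measurableSet_eq_fun measurable_snd (measurable_const.mul measurable_fst)
  rw [Set.ofPred_or]
  refine measure_union_null ?_ ?_
  · rw [show {z : ℝ × ℝ | z.1 = x} = {x} ×ˢ Set.univ by ext; simp, Measure.prod_prod, hna, zero_mul]
  · rw [Measure.prod_apply hm]
    refine (lintegral_congr fun u => ?_).trans lintegral_zero
    rw [show Prod.mk u ⁻¹' {z : ℝ × ℝ | z.2 = κ * z.1} = {κ * u} by ext; simp]
    exact hna _

lemma frontier_sector_subset (x κ : ℝ) :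
    frontier (sector x κ) ⊆ {z | z.1 = x ∨ z.2 = κ * z.1} := by
  intro z hz
  have h1 : z ∈ sector x κ := (isClosed_sector x κ).frontier_subset hz
  by_contra hcon
  simp only [Set.mem_ofPred_eq, not_or] at hcon
  have hU : IsOpen {z : ℝ × ℝ | z.1 < x ∧ κ * z.1 < z.2} :=
    (isOpen_lt continuous_fst continuous_const).inter
      (isOpen_lt (continuous_const.mul continuous_fst) continuous_snd)
  exact hz.2 (mem_interior.2 ⟨_, fun w hw => ⟨hw.1.le, hw.2.le⟩, hU,
    lt_of_le_of_ne h1.1 hcon.1, lt_of_le_of_ne h1.2 (Ne.symm hcon.2)⟩)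

lemma frontier_strictSector_subset (x κ : ℝ) :
    frontier (strictSector x κ) ⊆ {z | z.1 = x ∨ z.2 = κ * z.1} := by
  intro z hz
  have h1 : z ∈ sector x κ :=
    closure_minimal (t := sector x κ) (fun w hw => ⟨hw.1, le_of_lt hw.2⟩) (isClosed_sector x κ) hz.1
  by_contra hcon
  simp only [Set.mem_ofPred_eq, not_or] at hcon
  have hU : IsOpen {z : ℝ × ℝ | z.1 < x ∧ κ * z.1 < z.2} :=
    (isOpen_lt continuous_fst continuous_const).inter
      (isOpen_lt (continuous_const.mul continuous_fst) continuous_snd)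
  exact hz.2 (mem_interior.2 ⟨_, fun w hw => ⟨hw.1.le, hw.2⟩, hU,
    lt_of_le_of_ne h1.1 hcon.1, lt_of_le_of_ne h1.2 (Ne.symm hcon.2)⟩)

lemma continuous_PhiSkew (α : ℝ) : Continuous fun x => PhiSkew x α := by
  have h1 : Continuous Phi := by
    have : Phi = fun x => (Real.sqrt (2 * Real.pi))⁻¹ *
        (Real.sqrt (2 * Real.pi) - ∫ t in Set.Ioi x, Real.exp (-t ^ 2 / 2)) := by
      ext x
      have h2 := integral_add_compl (measurableSet_Iic (a := x)) integrable_exp_neg_sq_div_two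
      have h3 : ∫ t : ℝ, Real.exp (-t ^ 2 / 2) = Real.sqrt (2 * Real.pi) := by
        have := integral_gaussian (1 / 2)
        rw [show Real.pi / (1 / 2) = 2 * Real.pi by ring] at this
        rw [← this]
        congr 1
        ext w
        ring_nf
      rw [Set.compl_Iic, h3] at h2
      rw [Phi, ← h2]
      ring
    rw [this]
    simp_rw [integral_Ioi_exp_neg_sq_div_two]
    have := intervalIntegral.continuous_primitive (μ := volume)
      (f := fun w : ℝ => Real.exp (-w ^ 2 / 2))
      (fun a b => integrable_exp_neg_sq_div_two.intervalIntegrable) 0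
    fun_prop
  have h4 : Continuous fun x => OwenT x α := by
    unfold OwenT
    refine continuous_const.mul
      (intervalIntegral.continuous_parametric_intervalIntegral_of_continuous' ?_ 0 α)
    exact Continuous.div (by fun_prop) (by fun_prop) fun z => by positivity
  exact h1.sub (continuous_const.mul h4)

/-- The indicator function of the residue class `1` modulo `q`. -/
def oneModInd (q p : ℕ) : ℝ := if p % q = 1 % q then 1 else 0

lemma omegaQ_eq_addSum (m q : ℕ) : (omegaQ m q : ℝ) = addSum (oneModInd q) m := by
  simp [omegaQ, addSum, oneModInd]

lemma abs_oneModInd_le (q p : ℕ) : |oneModInd q p| ≤ 1 := by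
  unfold oneModInd
  split_ifs <;> simp

lemma oneModInd_sq (q p : ℕ) : oneModInd q p ^ 2 = oneModInd q p := by
  unfold oneModInd
  split_ifs <;> simp

lemma oneModInd_mul {q r : ℕ} (h : q.Coprime r) (p : ℕ) :
    oneModInd q p * oneModInd r p = oneModInd (q * r) p := by
  have := Nat.modEq_and_modEq_iff_modEq_mul h (a := p) (b := 1)
  simp only [Nat.ModEq] at this
  simp only [oneModInd, ← this, ite_and]
  split_ifs <;> simp

lemma sum_oneModInd_div (q n : ℕ) :
    ∑ p ∈ primesLE n, oneModInd q p / p = recipSum q n := by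
  rw [recipSum, primesLE, Finset.sum_filter, Finset.sum_filter]
  refine Finset.sum_congr rfl fun p _ => ?_
  unfold oneModInd
  split_ifs <;> simp_all

lemma tendsto_recipSum_div_LL {q : ℕ} (hq : 0 < q) :
    Tendsto (fun n => recipSum q n / LL n) atTop (nhds (1 / (q.totient : ℝ))) := by
  have h1 := (tendsto_recipSum hq).mul tendsto_sqrt_LL.inv_tendsto_atTop
  rw [mul_zero] at h1
  have h2 := h1.add_const (1 / (q.totient : ℝ))
  rw [zero_add] at h2
  refine h2.congr' ?_
  filter_upwards [tendsto_LL.eventually_gt_atTop 0] with n hn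
  have hs : Real.sqrt (LL n) * Real.sqrt (LL n) = LL n := Real.mul_self_sqrt hn.le
  have hs0 : Real.sqrt (LL n) ≠ 0 := (Real.sqrt_pos.2 hn).ne'
  simp only [Pi.inv_apply]
  rw [← div_eq_mul_inv, div_div, hs]
  field_simp
  ring


lemma addSum_linear_comb (a b c : ℕ) (α β γ : ℝ) (m : ℕ) :
    addSum (fun p => α * oneModInd a p + β * oneModInd b p + γ * oneModInd c p) m =
      α * omegaQ m a + β * omegaQ m b + γ * omegaQ m c := by
  simp only [omegaQ_eq_addSum, addSum, Finset.mul_sum, Finset.sum_add_distrib]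

/-- The joint central limit theorem for `ω(m;a), ω(m;b), ω(m;c)` with pairwise coprime moduli. -/
lemma tendsto_avg_cexp_omegaQ {a b c : ℕ} (ha : 0 < a) (hb : 0 < b) (hc : 0 < c)
    (hab : a.Coprime b) (hac : a.Coprime c) (hbc : b.Coprime c) (α β γ : ℝ) {M₁ M₂ : ℝ}
    (h₁ : M₁ = α / a.totient + β / b.totient + γ / c.totient)
    (h₂ : M₂ = α ^ 2 / a.totient + β ^ 2 / b.totient + γ ^ 2 / c.totient +
      2 * α * β / (a.totient * b.totient) + 2 * α * γ / (a.totient * c.totient) +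
      2 * β * γ / (b.totient * c.totient)) :
    Tendsto (fun n : ℕ => (∑ m ∈ Finset.Icc 1 n, Complex.exp (Complex.I *
      ((α * omegaQ m a + β * omegaQ m b + γ * omegaQ m c - M₁ * LL n) / Real.sqrt (LL n) : ℝ))) / n)
      atTop (nhds (Complex.exp (-(M₂ / 2 : ℝ)))) := by
  have key := tendsto_avg_cexp_addSum
    (h := fun p => α * oneModInd a p + β * oneModInd b p + γ * oneModInd c p)
    (H := |α| + |β| + |γ|) (M₁ := M₁) (M₂ := M₂) ?_ ?_ ?_
  · simpa only [addSum_linear_comb] using key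
  · intro p
    refine (abs_add_three _ _ _).trans ?_
    simp only [abs_mul]
    have h (q : ℕ) (x : ℝ) : |x| * |oneModInd q p| ≤ |x| :=
      mul_le_of_le_one_right (abs_nonneg _) (abs_oneModInd_le q p)
    exact add_le_add (add_le_add (h a α) (h b β)) (h c γ)
  · have h := (((tendsto_recipSum ha).const_mul α).add ((tendsto_recipSum hb).const_mul β)).add
      ((tendsto_recipSum hc).const_mul γ)
    simp only [mul_zero, add_zero] at h
    refine h.congr fun n => ?_
    have e : ∑ p ∈ primesLE n, (α * oneModInd a p + β * oneModInd b p + γ * oneModInd c p) / p =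
        α * recipSum a n + β * recipSum b n + γ * recipSum c n := by
      simp only [← sum_oneModInd_div, Finset.mul_sum, ← Finset.sum_add_distrib]
      exact Finset.sum_congr rfl fun p _ => by ring
    rw [e, h₁]
    ring
  · have h := (((((tendsto_recipSum_div_LL ha).const_mul (α ^ 2)).add
      ((tendsto_recipSum_div_LL hb).const_mul (β ^ 2))).add
      ((tendsto_recipSum_div_LL hc).const_mul (γ ^ 2))).add
      ((tendsto_recipSum_div_LL (Nat.mul_pos ha hb)).const_mul (2 * α * β))).add
      ((tendsto_recipSum_div_LL (Nat.mul_pos ha hc)).const_mul (2 * α * γ)) |>.add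
      ((tendsto_recipSum_div_LL (Nat.mul_pos hb hc)).const_mul (2 * β * γ))
    rw [Nat.totient_mul hab, Nat.totient_mul hac, Nat.totient_mul hbc] at h
    simp only [mul_one_div, Nat.cast_mul] at h
    rw [← h₂] at h
    refine h.congr fun n => ?_
    have e : ∑ p ∈ primesLE n,
        (α * oneModInd a p + β * oneModInd b p + γ * oneModInd c p) ^ 2 / p =
        α ^ 2 * recipSum a n + β ^ 2 * recipSum b n + γ ^ 2 * recipSum c n +
        2 * α * β * recipSum (a * b) n + 2 * α * γ * recipSum (a * c) n +
        2 * β * γ * recipSum (b * c) n := by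
      simp only [← sum_oneModInd_div, Finset.mul_sum, ← Finset.sum_add_distrib]
      refine Finset.sum_congr rfl fun p _ => ?_
      rw [← oneModInd_mul hab, ← oneModInd_mul hac, ← oneModInd_mul hbc]
      have ea := oneModInd_sq a p
      have eb := oneModInd_sq b p
      have ec := oneModInd_sq c p
      linear_combination (α ^ 2 * ea + β ^ 2 * eb + γ ^ 2 * ec) / p
    rw [e]
    ring

/-- Centred and normalised difference `ω(m;q) - ω(m;r)`. -/
def normDiff (q r : ℕ) (μ σ : ℝ) (n m : ℕ) : ℝ :=
  (omegaQ m q - omegaQ m r - μ * LL n) / (σ * Real.sqrt (LL n))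

/-- Pairwise coprime moduli `a, b, c` with `φ(a) = φ(b) = F`, `φ(c) = G`, together with the mean
`μ`, deviation `σ` and correlation `ρ` of the pair `ω(m;a) - ω(m;c)`, `ω(m;b) - ω(m;c)`. -/
structure PairData (a b c : ℕ) (F G μ σ ρ τ : ℝ) : Prop where
  ha : 0 < a
  hb : 0 < b
  hc : 0 < c
  hab : a.Coprime b
  hac : a.Coprime c
  hbc : b.Coprime c
  hFa : (a.totient : ℝ) = F
  hFb : (b.totient : ℝ) = F
  hGc : (c.totient : ℝ) = G
  hμ : μ = 1 / F - 1 / G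
  hσ : 0 < σ
  hσ2 : σ ^ 2 = 1 / F + 1 / G - 2 / (F * G)
  hρ : ρ * σ ^ 2 = 1 / F ^ 2 + 1 / G - 2 / (F * G)
  hρ1 : ρ ≤ 1
  hτ : 0 < τ
  hτ2 : τ ^ 2 = 1 - ρ ^ 2

lemma PairData.symm {a b c : ℕ} {F G μ σ ρ τ : ℝ} (D : PairData a b c F G μ σ ρ τ) :
    PairData b a c F G μ σ ρ τ :=
  { D with ha := D.hb, hb := D.ha, hab := D.hab.symm, hac := D.hbc, hbc := D.hac, hFa := D.hFb,
           hFb := D.hFa }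

lemma PairData.tendsto_avg_cexp {a b c : ℕ} {F G μ σ ρ τ : ℝ} (D : PairData a b c F G μ σ ρ τ)
    (s t : ℝ) :
    Tendsto (fun n : ℕ => (∑ m ∈ Finset.Icc 1 n, Complex.exp (Complex.I *
      (s * normDiff a c μ σ n m +
        t * ((normDiff b c μ σ n m - ρ * normDiff a c μ σ n m) / τ) : ℝ))) / n)
      atTop (nhds (Complex.exp (-((s ^ 2 + t ^ 2) / 2 : ℝ)))) := by
  obtain ⟨ha, hb, hc, hab, hac, hbc, hFa, hFb, hGc, hμ, hσ, hσ2, hρ, -, hτ, hτ2⟩ := D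
  have key := tendsto_avg_cexp_omegaQ ha hb hc hab hac hbc ((s - t * ρ / τ) / σ) (t / τ / σ)
    (-((s - t * ρ / τ) / σ + t / τ / σ)) (M₁ := ((s - t * ρ / τ) / σ + t / τ / σ) * μ)
    (M₂ := s ^ 2 + t ^ 2) (by rw [hFa, hFb, hGc, hμ]; ring) ?_
  · refine key.congr fun n => ?_
    congr 1
    refine Finset.sum_congr rfl fun m _ => ?_
    congr 3
    simp only [normDiff]
    field_simp
    ring
  · rw [hFa, hFb, hGc]
    set A := s - t * ρ / τ with hA
    set B := t / τ with hB
    have e1 : (A / σ) ^ 2 / F + (B / σ) ^ 2 / F + (-(A / σ + B / σ)) ^ 2 / G +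
        2 * (A / σ) * (B / σ) / (F * F) + 2 * (A / σ) * (-(A / σ + B / σ)) / (F * G) +
        2 * (B / σ) * (-(A / σ + B / σ)) / (F * G) =
        (A ^ 2 + B ^ 2) * ((1 / F + 1 / G - 2 / (F * G)) / σ ^ 2) +
        2 * A * B * ((1 / F ^ 2 + 1 / G - 2 / (F * G)) / σ ^ 2) := by
      field_simp
      ring
    rw [e1, ← hρ, ← hσ2, mul_div_cancel_right₀ _ (by positivity), div_self (by positivity)]
    have hBt : B * τ = t := by rw [hB]; field_simp
    have hAs : A = s - B * ρ := by rw [hA, hB]; ring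
    rw [hAs, ← hBt]
    linear_combination B ^ 2 * hτ2

lemma PairData.tendsto_cnt_le {a b c : ℕ} {F G μ σ ρ τ : ℝ} (D : PairData a b c F G μ σ ρ τ)
    (x : ℝ) :
    Tendsto (fun n : ℕ => (cnt (fun m => normDiff a c μ σ n m ≤ x ∧
      normDiff a c μ σ n m ≤ normDiff b c μ σ n m) n : ℝ) / n) atTop
      (nhds (PhiSkew x (-((1 - ρ) / τ)) / 2)) := by
  have h := tendsto_cnt_pair D.tendsto_avg_cexp (S := sector x ((1 - ρ) / τ))
    (measure_mono_null (frontier_sector_subset _ _) (gaussian_boundary _ _))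
  rw [gaussian_sector x (div_nonneg (sub_nonneg.2 D.hρ1) D.hτ.le)] at h
  refine h.congr fun n => ?_
  congr 3
  ext m
  simp only [sector, Set.mem_ofPred_eq]
  rw [div_mul_eq_mul_div, div_le_div_iff_of_pos_right D.hτ]
  refine and_congr_right fun _ => ?_
  constructor <;> intro h <;> linarith

lemma PairData.tendsto_cnt_lt {a b c : ℕ} {F G μ σ ρ τ : ℝ} (D : PairData a b c F G μ σ ρ τ)
    (x : ℝ) :
    Tendsto (fun n : ℕ => (cnt (fun m => normDiff a c μ σ n m ≤ x ∧
      normDiff a c μ σ n m < normDiff b c μ σ n m) n : ℝ) / n) atTop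
      (nhds (PhiSkew x (-((1 - ρ) / τ)) / 2)) := by
  have h := tendsto_cnt_pair D.tendsto_avg_cexp (S := strictSector x ((1 - ρ) / τ))
    (measure_mono_null (frontier_strictSector_subset _ _) (gaussian_boundary _ _))
  rw [gaussian_strictSector x (div_nonneg (sub_nonneg.2 D.hρ1) D.hτ.le)] at h
  refine h.congr fun n => ?_
  congr 3
  ext m
  simp only [strictSector, Set.mem_ofPred_eq]
  rw [div_mul_eq_mul_div, div_lt_div_iff_of_pos_right D.hτ]
  refine and_congr_right fun _ => ?_
  constructor <;> intro h <;> linarith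

lemma cnt_add_of_disjoint {P Q : ℕ → Prop} (h : ∀ m, P m → ¬ Q m) (n : ℕ) :
    cnt (fun m => P m ∨ Q m) n = cnt P n + cnt Q n := by
  classical
  rw [cnt_eq_card, cnt_eq_card, cnt_eq_card, Finset.filter_or, Finset.card_union_of_disjoint]
  exact Finset.disjoint_filter.2 fun m _ hp => h m hp

/-- The limiting distribution of `min(ω(m;a), ω(m;b)) - ω(m;c)` is skew-normal. -/
theorem PairData.tendsto_cnt_min {a b c : ℕ} {F G μ σ ρ τ : ℝ} (D : PairData a b c F G μ σ ρ τ)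
    (x : ℝ) :
    Tendsto (fun n : ℕ => (cnt (fun m => (min (omegaQ m a) (omegaQ m b) : ℝ) - omegaQ m c ≤
      μ * LL n + x * σ * Real.sqrt (LL n)) n : ℝ) / n) atTop
      (nhds (PhiSkew x (-((1 - ρ) / τ)))) := by
  have h := (D.tendsto_cnt_le x).add (D.symm.tendsto_cnt_lt x)
  rw [add_halves] at h
  refine h.congr' ?_
  filter_upwards [tendsto_LL.eventually_gt_atTop 0] with n hn
  rw [← add_div, ← Nat.cast_add, ← cnt_add_of_disjoint fun m h1 h2 => absurd h2.2 (not_lt.2 h1.2)]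
  congr 3
  ext m
  have hs : 0 < σ * Real.sqrt (LL n) := mul_pos D.hσ (Real.sqrt_pos.2 hn)
  simp only [normDiff]
  rw [div_le_div_iff_of_pos_right hs, div_lt_div_iff_of_pos_right hs, div_le_iff₀ hs,
    div_le_iff₀ hs]
  rcases le_or_gt (omegaQ m a : ℝ) (omegaQ m b) with hm | hm
  · rw [min_eq_left hm]
    constructor
    · rintro (h | h) <;> linarith [h.1, h.2]
    · intro h
      exact Or.inl ⟨by linarith, by linarith⟩
  · rw [min_eq_right hm.le]
    constructor
    · rintro (h | h) <;> linarith [h.1, h.2]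
    · intro h
      exact Or.inr ⟨by linarith, by linarith⟩

lemma cnt_mono {P Q : ℕ → Prop} (n : ℕ) (h : ∀ m, 1 ≤ m → m ≤ n → P m → Q m) :
    cnt P n ≤ cnt Q n := by
  classical
  rw [cnt_eq_card, cnt_eq_card]
  refine Finset.card_le_card fun m hm => ?_
  simp only [Finset.mem_filter, Finset.mem_Icc] at hm ⊢
  exact ⟨hm.1, h m hm.1.1 hm.1.2 hm.2⟩

/-- The weak law of large numbers for bounded strongly additive functions, lower tail. -/
theorem tendsto_cnt_addSum_le {h : ℕ → ℝ} {H M₁ M₂ c : ℝ} (hH : ∀ p, |h p| ≤ H)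
    (hM₁ : Tendsto (fun n => ((∑ p ∈ primesLE n, h p / p) - M₁ * LL n) / Real.sqrt (LL n)) atTop
      (nhds 0))
    (hM₂ : Tendsto (fun n => (∑ p ∈ primesLE n, h p ^ 2 / p) / LL n) atTop (nhds M₂))
    (hc : c < M₁) :
    Tendsto (fun n : ℕ => (cnt (fun m => addSum h m ≤ c * LL n) n : ℝ) / n) atTop (nhds 0) := by
  set Z : ℕ → ℕ → ℝ := fun n m => (addSum h m - M₁ * LL n) / Real.sqrt (LL n) with hZ
  have hprob : ∀ n, IsProbabilityMeasure (empirical (Z (n + 1)) (n + 1)) := fun n =>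
    isProbabilityMeasure_empirical _ (Nat.succ_pos n)
  have hchar : ∀ t : ℝ, Tendsto (fun n => charFun (empirical (Z (n + 1)) (n + 1)) t) atTop
      (nhds (Complex.exp (-((t ^ 2 * M₂) / 2 : ℝ)))) := by
    intro t
    have h1 := tendsto_avg_cexp_addSum (h := fun p => t * h p) (H := |t| * H) (M₁ := t * M₁)
      (M₂ := t ^ 2 * M₂) (fun p => by rw [abs_mul]; gcongr; exact hH p) ?_ ?_
    · refine ((tendsto_add_atTop_iff_nat 1).2 h1).congr fun n => ?_
      rw [charFun_empirical]
      congr 1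
      refine Finset.sum_congr rfl fun m _ => ?_
      congr 3
      simp only [hZ, addSum, ← Finset.mul_sum, RCLike.inner_apply, conj_trivial]
      ring
    · have := hM₁.const_mul t
      rw [mul_zero] at this
      refine this.congr fun n => ?_
      rw [mul_div_assoc', mul_sub, Finset.mul_sum]
      simp only [mul_div_assoc, mul_assoc]
    · refine (hM₂.const_mul (t ^ 2)).congr fun n => ?_
      rw [mul_div_assoc', Finset.mul_sum]
      simp only [mul_pow, mul_div_assoc]
  have htight := isTightMeasureSet_of_tendsto_charFun
    (f := fun t : ℝ => Complex.exp (-((t ^ 2 * M₂) / 2 : ℝ))) (by fun_prop) hchar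
  have hsup := isTightMeasureSet_iff_tendsto_measure_norm_gt.1 htight
  rw [Metric.tendsto_atTop]
  intro ε hε
  obtain ⟨K, hK⟩ := (hsup.eventually_lt_const
    (show (0 : ENNReal) < ENNReal.ofReal ε by simpa using hε)).exists
  have hev : ∀ᶠ n in atTop, K / (M₁ - c) < Real.sqrt (LL n) :=
    tendsto_sqrt_LL.eventually_gt_atTop _
  obtain ⟨N, hN⟩ := eventually_atTop.1 (hev.and (tendsto_LL.eventually_gt_atTop 0))
  refine ⟨max N 1, fun n hn => ?_⟩
  obtain ⟨h1, h2⟩ := hN n ((le_max_left _ _).trans hn)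
  obtain ⟨k, rfl⟩ : ∃ k, n = k + 1 := ⟨n - 1, by have := (le_max_right N 1).trans hn; omega⟩
  rw [dist_zero_right, Real.norm_of_nonneg (by positivity)]
  have h3 : empirical (Z (k + 1)) (k + 1) {x | K < ‖x‖} < ENNReal.ofReal ε :=
    lt_of_le_of_lt (le_iSup₂ (f := fun (μ : Measure ℝ) (_ : μ ∈ Set.range
      fun n => empirical (Z (n + 1)) (n + 1)) => μ {x | K < ‖x‖}) _ ⟨k, rfl⟩) hK
  rw [empirical_apply, ENNReal.ofReal_lt_ofReal_iff hε] at h3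
  refine lt_of_le_of_lt ?_ h3
  gcongr
  refine cnt_mono _ fun m _ _ hm => ?_
  have hs : 0 < Real.sqrt (LL (k + 1)) := Real.sqrt_pos.2 h2
  have hs2 : Real.sqrt (LL (k + 1)) * Real.sqrt (LL (k + 1)) = LL (k + 1) :=
    Real.mul_self_sqrt h2.le
  rw [div_lt_iff₀ (by linarith)] at h1
  simp only [Set.mem_ofPred_eq, hZ, Real.norm_eq_abs]
  refine lt_of_lt_of_le ?_ (neg_le_abs _)
  rw [← neg_div, lt_div_iff₀ hs]
  have := mul_lt_mul_of_pos_right h1 hs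
  nlinarith

lemma oneModInd_mul_lcm (q r : ℕ) (p : ℕ) :
    oneModInd q p * oneModInd r p = oneModInd (q.lcm r) p := by
  have : p % (q.lcm r) = 1 % (q.lcm r) ↔ p % q = 1 % q ∧ p % r = 1 % r :=
    ⟨fun h => ⟨Nat.ModEq.of_dvd (Nat.dvd_lcm_left q r) h,
      Nat.ModEq.of_dvd (Nat.dvd_lcm_right q r) h⟩, fun h => Nat.mod_lcm h.1 h.2⟩
  simp only [oneModInd, this, ite_and]
  split_ifs <;> simp

theorem tendsto_cnt_omegaQ_le {q : ℕ} (hq : 0 < q) {c : ℝ} (hc : c < 1 / q.totient) :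
    Tendsto (fun n : ℕ => (cnt (fun m => (omegaQ m q : ℝ) ≤ c * LL n) n : ℝ) / n) atTop
      (nhds 0) := by
  simp only [omegaQ_eq_addSum]
  refine tendsto_cnt_addSum_le (abs_oneModInd_le q) (M₁ := 1 / q.totient) ?_
    (M₂ := 1 / q.totient) ?_ hc
  · simpa only [sum_oneModInd_div, one_div_mul_eq_div] using tendsto_recipSum hq
  · simpa only [oneModInd_sq, sum_oneModInd_div] using tendsto_recipSum_div_LL hq

theorem tendsto_cnt_omegaQ_sub_le {q r : ℕ} (hq : 0 < q) (hr : 0 < r) {c : ℝ}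
    (hc : c < 1 / q.totient - 1 / r.totient) :
    Tendsto (fun n : ℕ => (cnt (fun m => (omegaQ m q : ℝ) - omegaQ m r ≤ c * LL n) n : ℝ) / n)
      atTop (nhds 0) := by
  have e : ∀ m, (omegaQ m q : ℝ) - omegaQ m r =
      addSum (fun p => oneModInd q p - oneModInd r p) m := fun m => by
    simp only [omegaQ_eq_addSum, addSum, Finset.sum_sub_distrib]
  simp only [e]
  refine tendsto_cnt_addSum_le (H := 1 + 1) (fun p => (abs_sub _ _).trans (add_le_add
    (abs_oneModInd_le q p) (abs_oneModInd_le r p))) (M₁ := 1 / q.totient - 1 / r.totient) ?_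
    (M₂ := 1 / q.totient + 1 / r.totient - 2 * (1 / (q.lcm r).totient)) ?_ hc
  · have h := (tendsto_recipSum hq).sub (tendsto_recipSum hr)
    rw [sub_zero] at h
    refine h.congr fun n => ?_
    simp only [sub_div, Finset.sum_sub_distrib, sum_oneModInd_div]
    ring
  · have h := ((tendsto_recipSum_div_LL hq).add (tendsto_recipSum_div_LL hr)).sub
      ((tendsto_recipSum_div_LL (Nat.lcm_pos hq hr)).const_mul 2)
    refine h.congr fun n => ?_
    have e2 : ∑ p ∈ primesLE n, (oneModInd q p - oneModInd r p) ^ 2 / p =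
        recipSum q n + recipSum r n - 2 * recipSum (q.lcm r) n := by
      simp only [← sum_oneModInd_div, Finset.mul_sum, ← Finset.sum_add_distrib,
        ← Finset.sum_sub_distrib]
      refine Finset.sum_congr rfl fun p _ => ?_
      rw [← oneModInd_mul_lcm]
      linear_combination (oneModInd_sq q p + oneModInd_sq r p) / p
    rw [e2]
    ring

lemma cnt_exists_le {S : Finset ℕ} (P : ℕ → ℕ → Prop) (n : ℕ) :
    cnt (fun m => ∃ q ∈ S, P q m) n ≤ ∑ q ∈ S, cnt (P q) n := by
  classical
  simp only [cnt_eq_card]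
  refine (Finset.card_le_card fun m hm => ?_).trans (Finset.card_biUnion_le (s := S)
    (t := fun q => (Finset.Icc 1 n).filter (P q)))
  obtain ⟨h1, q, hq, h2⟩ := Finset.mem_filter.1 hm
  exact Finset.mem_biUnion.2 ⟨q, hq, Finset.mem_filter.2 ⟨h1, h2⟩⟩

lemma cnt_or_le (P Q : ℕ → Prop) (n : ℕ) : cnt (fun m => P m ∨ Q m) n ≤ cnt P n + cnt Q n := by
  classical
  rw [cnt_eq_card, cnt_eq_card, cnt_eq_card, Finset.filter_or]
  exact Finset.card_union_le _ _

lemma cnt_mul_pow_le (q n k : ℕ) {w : ℝ} (hw : 0 ≤ w) :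
    (cnt (fun m => k ≤ omegaQ m q) n : ℝ) * (1 + w) ^ k ≤ n * Real.exp (w * recipSum q n) := by
  classical
  set P := (Finset.Icc 1 n).filter (fun p => p.Prime ∧ p % q = 1 % q) with hP
  have hPp : ∀ p ∈ P, p.Prime := fun p hp => (Finset.mem_filter.1 hp).2.1
  have hω : ∀ m ∈ Finset.Icc 1 n, omegaQ m q = (P.filter (· ∣ m)).card := by
    intro m hm
    rw [Finset.mem_Icc] at hm
    rw [omegaQ]
    congr 1
    ext p
    simp only [hP, Finset.mem_filter, Nat.mem_primeFactors, Finset.mem_Icc]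
    constructor
    · rintro ⟨⟨h1, h2, -⟩, h3⟩
      exact ⟨⟨⟨h1.one_le, (Nat.le_of_dvd hm.1 h2).trans hm.2⟩, h1, h3⟩, h2⟩
    · rintro ⟨⟨-, h1, h3⟩, h2⟩
      exact ⟨⟨h1, h2, by omega⟩, h3⟩
  have h1 : (cnt (fun m => k ≤ omegaQ m q) n : ℝ) * (1 + w) ^ k ≤
      ∑ m ∈ Finset.Icc 1 n, ∏ p ∈ P.filter (· ∣ m), (1 + w) := by
    rw [cnt_eq_card, ← nsmul_eq_mul, ← Finset.sum_const, Finset.sum_filter]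
    refine Finset.sum_le_sum fun m hm => ?_
    rw [Finset.prod_const, ← hω m hm]
    split_ifs with h
    · exact pow_le_pow_right₀ (by linarith) h
    · positivity
  refine h1.trans ?_
  rw [sum_prod_filter_dvd hPp (fun _ => w)]
  have h2 : ∀ D ∈ P.powerset, (∏ p ∈ D, w) *
      (((Finset.Icc 1 n).filter ((∏ p ∈ D, p) ∣ ·)).card : ℝ) ≤ n * ∏ p ∈ D, (w / p) := by
    intro D _
    refine (mul_le_mul_of_nonneg_left (card_multiples_Icc n _)
      (Finset.prod_nonneg fun _ _ => hw)).trans (le_of_eq ?_)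
    rw [Finset.prod_div_distrib, Nat.cast_prod]
    ring
  refine (Finset.sum_le_sum h2).trans ?_
  rw [← Finset.mul_sum, ← Finset.prod_one_add]
  refine mul_le_mul_of_nonneg_left ?_ (Nat.cast_nonneg n)
  rw [recipSum, Finset.mul_sum, Real.exp_sum]
  refine Finset.prod_le_prod (fun p _ => by positivity) fun p _ => ?_
  rw [mul_one_div, add_comm]
  exact Real.add_one_le_exp _

lemma recipSum_le_one_add_log_div {q : ℕ} (hq : 2 ≤ q) (n : ℕ) :
    recipSum q n ≤ (1 + Real.log n) / q := by
  classical
  have hq0 : (0 : ℝ) < q := by exact_mod_cast (by omega : 0 < q)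
  set S := (Finset.Icc 1 n).filter (fun p => p.Prime ∧ p % q = 1 % q) with hS
  have hp : ∀ p ∈ S, p = q * (p / q) + 1 ∧ 1 ≤ p / q ∧ p / q ≤ n := by
    intro p hp
    obtain ⟨h1, h2, h3⟩ := Finset.mem_filter.1 hp
    rw [Nat.mod_eq_of_lt (show 1 < q by omega)] at h3
    have h4 := Nat.div_add_mod p q
    rw [h3] at h4
    refine ⟨h4.symm, ?_, (Nat.div_le_self p q).trans (Finset.mem_Icc.1 h1).2⟩
    rcases Nat.eq_zero_or_pos (p / q) with h5 | h5
    · rw [h5] at h4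
      exact absurd h4.symm (by simpa using h2.ne_one)
    · exact h5
  have hinj : Set.InjOn (fun p => p / q) (S : Set ℕ) := by
    intro p hpS p' hpS' h
    rw [(hp p hpS).1, (hp p' hpS').1]
    simp only at h
    rw [h]
  calc recipSum q n = ∑ p ∈ S, (1 : ℝ) / p := rfl
    _ ≤ ∑ p ∈ S, ((p / q : ℕ) : ℝ)⁻¹ / q := by
        refine Finset.sum_le_sum fun p hpS => ?_
        obtain ⟨h1, h2, -⟩ := hp p hpS
        have h3 : (0 : ℝ) < (p / q : ℕ) := by exact_mod_cast h2
        rw [← one_div, div_div]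
        refine one_div_le_one_div_of_le (by positivity) ?_
        have : ((p / q : ℕ) : ℝ) * q + 1 = p := by
          conv_rhs => rw [h1]
          push_cast
          ring
        linarith
    _ = ∑ j ∈ S.image (fun p => p / q), (j : ℝ)⁻¹ / q := by rw [Finset.sum_image hinj]
    _ ≤ ∑ j ∈ Finset.Icc 1 n, (j : ℝ)⁻¹ / q := by
        refine Finset.sum_le_sum_of_subset_of_nonneg ?_ fun _ _ _ => by positivity
        intro j hj
        obtain ⟨p, hpS, rfl⟩ := Finset.mem_image.1 hj
        exact Finset.mem_Icc.2 (hp p hpS).2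
    _ ≤ (1 + Real.log n) / q := by
        rw [← Finset.sum_div]
        gcongr
        have := harmonic_le_one_add_log n
        rw [harmonic_eq_sum_Icc] at this
        simpa using this

lemma IsPrimePow.le_two_mul_totient {q : ℕ} (hq : IsPrimePow q) : q ≤ 2 * q.totient := by
  obtain ⟨p, k, hp, hk, rfl⟩ := (isPrimePow_nat_iff _).1 hq
  obtain ⟨k, rfl⟩ : ∃ j, k = j + 1 := ⟨k - 1, by omega⟩
  rw [Nat.totient_prime_pow_succ hp, pow_succ]
  have h2 := hp.two_le
  calc p ^ k * p ≤ p ^ k * (2 * (p - 1)) := Nat.mul_le_mul_left _ (by omega)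
    _ = 2 * (p ^ k * (p - 1)) := by ring

/-- For most integers `m`, all the counts `ω(m;q)` with `q` large are small. -/
theorem tendsto_cnt_exists_omegaQ_large {c : ℝ} (hc : 0 < c) :
    ∃ Y : ℕ, Tendsto (fun n : ℕ => (cnt (fun m => ∃ q, Y < q ∧ IsPrimePow q ∧
      c * LL n < omegaQ m q) n : ℝ) / n) atTop (nhds 0) := by
  obtain ⟨C, hC⟩ := exists_recipSum_le
  set w : ℝ := Real.exp (6 / c) with hw
  have hw0 : 0 < w := Real.exp_pos _
  obtain ⟨Y, hY⟩ := exists_nat_gt (12 * w)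
  refine ⟨Y, ?_⟩
  have hlog : Tendsto (fun n : ℕ => Real.log n) atTop atTop :=
    Real.tendsto_log_atTop.comp tendsto_natCast_atTop_atTop
  have hsmall : ∀ᶠ n in atTop, 3 * (Real.log (2 + 2 * LL n) + C) ≤ LL n / (2 * w) := by
    have h1 : Tendsto (fun y : ℝ => (3 * (Real.log (2 + 2 * y) + C)) / y) atTop (nhds 0) := by
      have a1 : Tendsto (fun y : ℝ => Real.log (2 + 2 * y) / (2 + 2 * y)) atTop (nhds 0) := by
        have : Tendsto (fun y : ℝ => 2 + 2 * y) atTop atTop :=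
          tendsto_atTop_add_const_left _ _ (tendsto_id.const_mul_atTop two_pos)
        have h := (Real.isLittleO_log_id_atTop.tendsto_div_nhds_zero).comp this
        exact h
      have a2 : Tendsto (fun y : ℝ => 2 / y + 2) atTop (nhds (0 + 2)) :=
        (tendsto_id.const_div_atTop 2).add_const 2
      have a3 : Tendsto (fun y : ℝ => C / y) atTop (nhds 0) := tendsto_id.const_div_atTop C
      have a4 := ((a1.mul a2).add a3).const_mul 3
      simp only [zero_mul, add_zero, mul_zero] at a4
      refine a4.congr' ?_
      filter_upwards [eventually_gt_atTop 0] with y hy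
      field_simp
    have h2 := (h1.comp tendsto_LL).eventually_le_const (show (0 : ℝ) < 1 / (2 * w) by positivity)
    filter_upwards [h2, tendsto_LL.eventually_gt_atTop 0] with n h3 h4
    simp only [Function.comp] at h3
    rw [div_le_iff₀ h4] at h3
    rwa [one_div_mul_eq_div] at h3
  have hbound : ∀ᶠ n : ℕ in atTop, (cnt (fun m => ∃ q, Y < q ∧ IsPrimePow q ∧
      c * LL n < omegaQ m q) n : ℝ) / n ≤
      Real.exp (-3 * LL n) + 16 * Real.exp 1 * ((⌊Real.log n ^ 2⌋₊ : ℕ) : ℝ)⁻¹ := by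
    filter_upwards [hsmall, hlog.eventually_ge_atTop 1, eventually_ge_atTop 3,
      tendsto_LL.eventually_ge_atTop (4 / c), tendsto_LL.eventually_gt_atTop 0]
      with n hs hl1 hn3 hL4 hL0
    set b := ⌊Real.log n ^ 2⌋₊ with hb
    have hn0 : (0 : ℝ) < n := by exact_mod_cast (by omega : 0 < n)
    have hlogL : Real.log n = Real.exp (LL n) := (Real.exp_log (by linarith)).symm
    have hb1 : 1 ≤ b := (Nat.one_le_floor_iff _).2 (by nlinarith)
    have hb2 : (b : ℝ) ≤ Real.exp (2 * LL n) := by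
      refine (Nat.floor_le (by positivity)).trans (le_of_eq ?_)
      rw [hlogL, ← Real.exp_nat_mul]
      norm_num
    set k := ⌈c * LL n⌉₊ with hk
    have hsub : cnt (fun m => ∃ q, Y < q ∧ IsPrimePow q ∧ c * LL n < omegaQ m q) n ≤
        ∑ q ∈ (Finset.Icc 1 b).filter (fun q => Y < q ∧ IsPrimePow q),
          cnt (fun m => k ≤ omegaQ m q) n +
        ∑ q ∈ Finset.Ioc b (max b n), cnt (fun m => 4 ≤ omegaQ m q) n := by
      refine le_trans ?_ (add_le_add (cnt_exists_le _ _) (cnt_exists_le _ _))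
      refine le_trans ?_ (cnt_or_le _ _ _)
      refine cnt_mono _ fun m hm1 hmn => ?_
      rintro ⟨q, h1, h2, h3⟩
      rcases le_or_gt q b with hqb | hqb
      · exact Or.inl ⟨q, Finset.mem_filter.2 ⟨Finset.mem_Icc.2 ⟨h2.pos, hqb⟩, h1, h2⟩,
          Nat.ceil_le.2 h3.le⟩
      · have h4 : 4 ≤ omegaQ m q := by
          have : (4 : ℝ) ≤ c * LL n := by rwa [div_le_iff₀' hc] at hL4
          exact_mod_cast (this.trans h3.le)
        refine Or.inr ⟨q, Finset.mem_Ioc.2 ⟨hqb, le_max_of_le_right ?_⟩, h4⟩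
        have h5 : (m.primeFactors.filter fun p => p % q = 1 % q).Nonempty := by
          rw [← Finset.card_pos]
          exact lt_of_lt_of_le (by norm_num) h4
        obtain ⟨p, hp⟩ := h5
        obtain ⟨hp1, hp2⟩ := Finset.mem_filter.1 hp
        rw [Nat.mod_eq_of_lt h2.one_lt] at hp2
        have hpp := Nat.prime_of_mem_primeFactors hp1
        have hpm := (Nat.le_of_mem_primeFactors hp1).trans hmn
        by_contra hcon
        rw [Nat.mod_eq_of_lt (by omega)] at hp2
        exact hpp.ne_one hp2
    have hpart1 : ∀ q ∈ (Finset.Icc 1 b).filter (fun q => Y < q ∧ IsPrimePow q),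
        (cnt (fun m => k ≤ omegaQ m q) n : ℝ) ≤ n * Real.exp (-5 * LL n) := by
      intro q hq
      obtain ⟨hq1, hq2, hq3⟩ := Finset.mem_filter.1 hq
      have hq0 : 0 < q := hq3.pos
      have hqr : (0 : ℝ) < q := by exact_mod_cast hq0
      have hqb : (q : ℝ) ≤ Real.exp (2 * LL n) :=
        le_trans (by exact_mod_cast (Finset.mem_Icc.1 hq1).2) hb2
      have hlq : Real.log q ≤ 2 * LL n := by
        rw [← Real.log_exp (2 * LL n)]
        exact Real.log_le_log hqr hqb
      have hlq0 : 0 ≤ Real.log q := Real.log_natCast_nonneg q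
      have hφ : 6 * w ≤ q.totient := by
        have h1 : (q : ℝ) ≤ 2 * q.totient := by exact_mod_cast hq3.le_two_mul_totient
        have h2 : (Y : ℝ) < q := by exact_mod_cast hq2
        linarith
      have hR : recipSum q n ≤ LL n / w := by
        refine (hC q hq0 n hn3).trans ?_
        have h1 : LL n / q.totient ≤ LL n / (6 * w) := by gcongr
        have h2 : Real.log (2 + Real.log q) ≤ Real.log (2 + 2 * LL n) := by gcongr
        have h3 : 3 * (LL n / (6 * w)) + LL n / (2 * w) = LL n / w := by
          field_simp
          norm_num
        linarith
      have h1 := cnt_mul_pow_le q n k hw0.le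
      have h2 : Real.exp (w * recipSum q n) ≤ Real.exp (LL n) := by
        refine Real.exp_le_exp.2 ((mul_le_mul_of_nonneg_left hR hw0.le).trans (le_of_eq ?_))
        field_simp
      have h3 : Real.exp (6 * LL n) ≤ (1 + w) ^ k := by
        refine le_trans ?_ (pow_le_pow_left₀ hw0.le (by linarith : w ≤ 1 + w) k)
        rw [hw, ← Real.exp_nat_mul]
        refine Real.exp_le_exp.2 ?_
        have : c * LL n ≤ k := Nat.le_ceil _
        calc 6 * LL n = c * LL n * (6 / c) := by field_simp
          _ ≤ k * (6 / c) := by gcongr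
      have h4 : (cnt (fun m => k ≤ omegaQ m q) n : ℝ) * Real.exp (6 * LL n) ≤
          n * Real.exp (LL n) :=
        (mul_le_mul_of_nonneg_left h3 (Nat.cast_nonneg _)).trans
          (h1.trans (mul_le_mul_of_nonneg_left h2 hn0.le))
      rw [← le_div_iff₀ (Real.exp_pos _), mul_div_assoc, ← Real.exp_sub] at h4
      refine h4.trans (le_of_eq ?_)
      ring_nf
    have hpart2 : ∀ q ∈ Finset.Ioc b (max b n),
        (cnt (fun m => 4 ≤ omegaQ m q) n : ℝ) ≤ n * (16 * Real.exp 1 * ((q : ℝ) ^ 2)⁻¹) := by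
      intro q hq
      have hbq : b < q := (Finset.mem_Ioc.1 hq).1
      have hqr : (0 : ℝ) < q := by exact_mod_cast (by omega : 0 < q)
      have hlq : Real.log n ^ 2 ≤ q := by
        refine (Nat.lt_floor_add_one _).le.trans ?_
        exact_mod_cast hbq
      have hl : Real.log n ≤ Real.sqrt q := Real.le_sqrt_of_sq_le hlq
      have hsq : Real.sqrt q * Real.sqrt q = q := Real.mul_self_sqrt hqr.le
      have hsq0 : 0 < Real.sqrt q := Real.sqrt_pos.2 hqr
      have hR : Real.sqrt q / 2 * recipSum q n ≤ 1 := by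
        have h1 := recipSum_le_one_add_log_div (q := q) (by omega) n
        have h2 : (1 + Real.log n) / q ≤ 2 * Real.sqrt q / q := by gcongr; linarith
        calc Real.sqrt q / 2 * recipSum q n ≤ Real.sqrt q / 2 * (2 * Real.sqrt q / q) := by
              gcongr; exact h1.trans h2
          _ = Real.sqrt q * Real.sqrt q / q := by ring
          _ = 1 := by rw [hsq, div_self hqr.ne']
      have h1 := cnt_mul_pow_le q n 4 (w := Real.sqrt q / 2) (by positivity)
      have h2 : (q : ℝ) ^ 2 / 16 ≤ (1 + Real.sqrt q / 2) ^ 4 := by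
        have e : (q : ℝ) ^ 2 = (Real.sqrt q * Real.sqrt q) ^ 2 := by rw [hsq]
        calc (q : ℝ) ^ 2 / 16 = (Real.sqrt q / 2) ^ 4 := by rw [e]; ring
          _ ≤ _ := by gcongr; linarith
      have h3 : (cnt (fun m => 4 ≤ omegaQ m q) n : ℝ) * ((q : ℝ) ^ 2 / 16) ≤ n * Real.exp 1 :=
        (mul_le_mul_of_nonneg_left h2 (Nat.cast_nonneg _)).trans
          (h1.trans (mul_le_mul_of_nonneg_left (Real.exp_le_exp.2 hR) hn0.le))
      rw [← le_div_iff₀ (by positivity)] at h3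
      refine h3.trans (le_of_eq ?_)
      field_simp
    rw [div_le_iff₀ hn0]
    calc (cnt (fun m => ∃ q, Y < q ∧ IsPrimePow q ∧ c * LL n < omegaQ m q) n : ℝ)
        ≤ ∑ q ∈ (Finset.Icc 1 b).filter (fun q => Y < q ∧ IsPrimePow q),
          (cnt (fun m => k ≤ omegaQ m q) n : ℝ) +
          ∑ q ∈ Finset.Ioc b (max b n), (cnt (fun m => 4 ≤ omegaQ m q) n : ℝ) := by
            exact_mod_cast hsub
      _ ≤ b * (n * Real.exp (-5 * LL n)) +
          n * (16 * Real.exp 1 * (b : ℝ)⁻¹) := by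
            refine add_le_add ?_ ?_
            · refine (Finset.sum_le_card_nsmul _ _ _ hpart1).trans ?_
              rw [nsmul_eq_mul]
              gcongr
              exact (Finset.card_filter_le _ _).trans (by simp)
            · refine (Finset.sum_le_sum hpart2).trans ?_
              rw [← Finset.mul_sum, ← Finset.mul_sum]
              gcongr
              have := sum_Ioc_inv_sq_le_sub (α := ℝ) (show b ≠ 0 by omega) (le_max_left b n)
              exact this.trans (sub_le_self _ (by positivity))
      _ ≤ Real.exp (2 * LL n) * (n * Real.exp (-5 * LL n)) +
          n * (16 * Real.exp 1 * (b : ℝ)⁻¹) := by gcongr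
      _ = (Real.exp (-3 * LL n) + 16 * Real.exp 1 * (b : ℝ)⁻¹) * n := by
            rw [show (-3 * LL n) = 2 * LL n + -5 * LL n by ring, Real.exp_add]
            ring
  refine squeeze_zero' (Eventually.of_forall fun n => by positivity) hbound ?_
  have h1 : Tendsto (fun n => Real.exp (-3 * LL n)) atTop (nhds 0) :=
    Real.tendsto_exp_atBot.comp (tendsto_LL.const_mul_atTop_of_neg (by norm_num))
  have h2 : Tendsto (fun n : ℕ => 16 * Real.exp 1 * ((⌊Real.log n ^ 2⌋₊ : ℕ) : ℝ)⁻¹) atTop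
      (nhds 0) := by
    have a := tendsto_inv_atTop_zero.comp ((tendsto_natCast_atTop_atTop (R := ℝ)).comp
      (tendsto_nat_floor_atTop.comp ((tendsto_pow_atTop two_ne_zero).comp hlog)))
    simpa using a.const_mul (16 * Real.exp 1)
  simpa using h1.add h2

/-- The `2`-adic valuation is almost always smaller than any function tending to infinity. -/
theorem tendsto_cnt_factorization_two {g : ℕ → ℝ} (hg : Tendsto g atTop atTop) :
    Tendsto (fun n : ℕ => (cnt (fun m => g n ≤ m.factorization 2) n : ℝ) / n) atTop (nhds 0) := by
  have h1 : ∀ n : ℕ, (cnt (fun m => g n ≤ m.factorization 2) n : ℝ) / n ≤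
      (1 / 2) ^ ⌈g n⌉₊ := by
    intro n
    rcases Nat.eq_zero_or_pos n with rfl | hn
    · simp
    have hn0 : (0 : ℝ) < n := by exact_mod_cast hn
    rw [div_le_iff₀ hn0]
    have h2 := card_multiples_Icc n (2 ^ ⌈g n⌉₊)
    refine le_trans ?_ (h2.trans (le_of_eq ?_))
    · rw [← cnt_eq_card]
      exact_mod_cast cnt_mono n fun m hm _ h => by
        rw [Nat.prime_two.pow_dvd_iff_le_factorization (by omega)]
        exact Nat.ceil_le.2 h
    · push_cast
      rw [one_div, inv_pow]
      ring
  refine squeeze_zero (fun n => by positivity) h1 ?_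
  exact (tendsto_pow_atTop_nhds_zero_of_lt_one (by norm_num) (by norm_num)).comp
    (tendsto_nat_ceil_atTop.comp hg)

lemma zmod_gcd_prod_lcm {a b : ℕ} (ha : 0 < a) (hb : 0 < b) :
    Nonempty (ZMod (Nat.gcd a b) × ZMod (Nat.lcm a b) ≃+ ZMod a × ZMod b) := by
  have hg : 0 < Nat.gcd a b := Nat.gcd_pos_of_pos_left b ha
  have hl : 0 < Nat.lcm a b := Nat.lcm_pos ha hb
  have : NeZero a := ⟨ha.ne'⟩
  have : NeZero b := ⟨hb.ne'⟩
  have : NeZero (Nat.gcd a b) := ⟨hg.ne'⟩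
  have : NeZero (Nat.lcm a b) := ⟨hl.ne'⟩
  obtain ⟨a', ha'⟩ := Nat.gcd_dvd_left a b
  obtain ⟨b', hb'⟩ := Nat.gcd_dvd_right a b
  have hcop : IsCoprime (a' : ℤ) (b' : ℤ) := by
    rw [Nat.isCoprime_iff_coprime]
    have h := Nat.coprime_div_gcd_div_gcd hg
    rwa [Nat.div_eq_of_eq_mul_right hg ha', Nat.div_eq_of_eq_mul_right hg hb'] at h
  obtain ⟨u, v, huv⟩ := hcop
  set s : ℤ := u * a' with hs
  set g := Nat.gcd a b with hgdef
  let f₁ : ℤ →+ ZMod a × ZMod b :=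
    (zmultiplesHom (ZMod a × ZMod b)) ((s : ZMod a), ((s - 1 : ℤ) : ZMod b))
  let f₂ : ℤ →+ ZMod a × ZMod b := (zmultiplesHom (ZMod a × ZMod b)) (1, 1)
  have hf₁ : ∀ w : ℤ, f₁ w = (((w * s : ℤ) : ZMod a), ((w * (s - 1) : ℤ) : ZMod b)) := by
    intro w
    simp [f₁]
  have hf₂ : ∀ z : ℤ, f₂ z = ((z : ZMod a), (z : ZMod b)) := by
    intro z
    simp [f₂]
  have hag : (a : ℤ) = g * a' := by exact_mod_cast ha'
  have hbg : (b : ℤ) = g * b' := by exact_mod_cast hb'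
  have hz₁ : f₁ (g : ℤ) = 0 := by
    rw [hf₁, Prod.mk_eq_zero, ZMod.intCast_zmod_eq_zero_iff_dvd,
      ZMod.intCast_zmod_eq_zero_iff_dvd]
    refine ⟨⟨u, ?_⟩, ⟨-v, ?_⟩⟩
    · rw [hag, hs]; ring
    · rw [hbg, hs]; linear_combination (g : ℤ) * huv
  have hz₂ : f₂ (Nat.lcm a b : ℤ) = 0 := by
    rw [hf₂, Prod.mk_eq_zero, ZMod.intCast_zmod_eq_zero_iff_dvd,
      ZMod.intCast_zmod_eq_zero_iff_dvd]
    exact ⟨by exact_mod_cast Nat.dvd_lcm_left a b, by exact_mod_cast Nat.dvd_lcm_right a b⟩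
  let ψ : ZMod g × ZMod (Nat.lcm a b) →+ ZMod a × ZMod b :=
    (ZMod.lift g ⟨f₁, hz₁⟩).coprod (ZMod.lift (Nat.lcm a b) ⟨f₂, hz₂⟩)
  have hinj : Function.Injective ψ := by
    rw [injective_iff_map_eq_zero]
    rintro ⟨w, z⟩ h
    obtain ⟨w, rfl⟩ := ZMod.intCast_surjective w
    obtain ⟨z, rfl⟩ := ZMod.intCast_surjective z
    simp only [ψ, AddMonoidHom.coprod_apply, ZMod.lift_coe, hf₁, hf₂, Prod.mk_add_mk,
      Prod.mk_eq_zero, ← Int.cast_add, ZMod.intCast_zmod_eq_zero_iff_dvd] at h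
    have h3 : (g : ℤ) ∣ w := by
      have h1 : (g : ℤ) ∣ w * s + z := (Dvd.intro _ hag.symm).trans h.1
      have h2 : (g : ℤ) ∣ w * (s - 1) + z := (Dvd.intro _ hbg.symm).trans h.2
      have := dvd_sub h1 h2
      ring_nf at this
      exact this
    rw [Prod.mk_eq_zero]
    refine ⟨by rwa [ZMod.intCast_zmod_eq_zero_iff_dvd], ?_⟩
    rw [ZMod.intCast_zmod_eq_zero_iff_dvd]
    obtain ⟨t, rfl⟩ := h3
    have h1 : (a : ℤ) ∣ z := by
      have : (a : ℤ) ∣ g * t * s := ⟨t * u, by rw [hag, hs]; ring⟩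
      exact (dvd_add_right this).1 h.1
    have h2 : (b : ℤ) ∣ z := by
      have : (b : ℤ) ∣ g * t * (s - 1) :=
        ⟨-(t * v), by rw [hbg, hs]; linear_combination (g : ℤ) * t * huv⟩
      exact (dvd_add_right this).1 h.2
    rw [Int.natCast_dvd] at h1 h2 ⊢
    exact Nat.lcm_dvd h1 h2
  have hcard : Nat.card (ZMod a × ZMod b) ≤ Nat.card (ZMod g × ZMod (Nat.lcm a b)) := by
    simp only [Nat.card_prod, Nat.card_zmod]
    exact (Nat.gcd_mul_lcm a b).ge
  exact ⟨AddEquiv.ofBijective ψ (hinj.bijective_of_nat_card_le hcard)⟩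

/-- The direct product of the cyclic groups `ZMod n` for `n` in a list. -/
def CycProd : List ℕ → Type
  | [] => Unit
  | n :: l => ZMod n × CycProd l

/-- The componentwise group structure on `CycProd l`. -/
@[reducible] def CycProd.addCommGroupAux : (l : List ℕ) → AddCommGroup (CycProd l)
  | [] => inferInstanceAs (AddCommGroup Unit)
  | n :: l =>
    letI := CycProd.addCommGroupAux l
    inferInstanceAs (AddCommGroup (ZMod n × CycProd l))

instance (l : List ℕ) : AddCommGroup (CycProd l) := CycProd.addCommGroupAux l

/-- The first factor of `CycProd` split off. -/
def CycProd.consEquiv (n : ℕ) (l : List ℕ) : CycProd (n :: l) ≃+ ZMod n × CycProd l :=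
  AddEquiv.refl (ZMod n × CycProd l)

lemma IsPrimePow.dvd_lcm_iff {q a b : ℕ} (hq : IsPrimePow q) (ha : 0 < a) (hb : 0 < b) :
    q ∣ Nat.lcm a b ↔ q ∣ a ∨ q ∣ b := by
  obtain ⟨p, k, hp, -, rfl⟩ := hq
  rw [← Nat.prime_iff] at hp
  rw [hp.pow_dvd_iff_le_factorization (Nat.lcm_pos ha hb).ne',
    hp.pow_dvd_iff_le_factorization ha.ne', hp.pow_dvd_iff_le_factorization hb.ne',
    Nat.factorization_lcm ha.ne' hb.ne', Finsupp.sup_apply, le_sup_iff]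

lemma exists_chain_insert (l : List ℕ) : ∀ a : ℕ, 0 < a → (∀ x ∈ l, 0 < x) →
    l.Pairwise (· ∣ ·) → ∃ l' : List ℕ, (∀ x ∈ l', 0 < x) ∧ l'.Pairwise (· ∣ ·) ∧
      Nonempty (CycProd l' ≃+ ZMod a × CycProd l) ∧
      (∀ q, IsPrimePow q → l'.countP (q ∣ ·) = (a :: l).countP (q ∣ ·)) ∧
      ∀ c, c ∣ a → (∀ x ∈ l, c ∣ x) → ∀ x ∈ l', c ∣ x := by
  induction l with
  | nil =>
    intro a ha _ _
    exact ⟨[a], by simpa using ha, List.pairwise_singleton _ _, ⟨CycProd.consEquiv a []⟩,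
      fun _ _ => rfl, fun c hc _ x hx => by rw [List.mem_singleton.1 hx]; exact hc⟩
  | cons x r ih =>
    intro a ha hpos hch
    have hx : 0 < x := hpos x (by simp)
    rw [List.pairwise_cons] at hch
    obtain ⟨l', hpos', hch', ⟨e⟩, hcount, hdvd⟩ := ih (Nat.lcm a x) (Nat.lcm_pos ha hx)
      (fun y hy => hpos y (List.mem_cons_of_mem _ hy)) hch.2
    obtain ⟨e'⟩ := zmod_gcd_prod_lcm ha hx
    refine ⟨Nat.gcd a x :: l', ?_, ?_, ⟨?_⟩, ?_, ?_⟩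
    · intro y hy
      rcases List.mem_cons.1 hy with rfl | hy
      · exact Nat.gcd_pos_of_pos_left _ ha
      · exact hpos' y hy
    · refine List.pairwise_cons.2 ⟨fun y hy => ?_, hch'⟩
      exact hdvd _ ((Nat.gcd_dvd_left a x).trans (Nat.dvd_lcm_left a x))
        (fun z hz => (Nat.gcd_dvd_right a x).trans (hch.1 z hz)) y hy
    · exact (CycProd.consEquiv _ _).trans (((AddEquiv.refl _).prodCongr e).trans
        (AddEquiv.prodAssoc.symm.trans ((e'.prodCongr (AddEquiv.refl _)).trans
        (AddEquiv.prodAssoc.trans ((AddEquiv.refl _).prodCongr (CycProd.consEquiv x r).symm)))))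
    · intro q hq
      simp only [List.countP_cons, hcount q hq, decide_eq_true_eq, Nat.dvd_gcd_iff,
        hq.dvd_lcm_iff ha hx]
      by_cases h1 : q ∣ a <;> by_cases h2 : q ∣ x <;> simp [h1, h2]
    · intro c hca hcl y hy
      rcases List.mem_cons.1 hy with rfl | hy
      · exact Nat.dvd_gcd hca (hcl x (by simp))
      · exact hdvd c (hca.trans (Nat.dvd_lcm_left a x))
          (fun z hz => hcl z (List.mem_cons_of_mem _ hz)) y hy

lemma exists_chain (l : List ℕ) (hl : ∀ x ∈ l, 0 < x) : ∃ l' : List ℕ, (∀ x ∈ l', 0 < x) ∧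
    l'.Pairwise (· ∣ ·) ∧ Nonempty (CycProd l' ≃+ CycProd l) ∧
      ∀ q, IsPrimePow q → l'.countP (q ∣ ·) = l.countP (q ∣ ·) := by
  induction l with
  | nil => exact ⟨[], by simp, List.Pairwise.nil, ⟨AddEquiv.refl _⟩, fun _ _ => rfl⟩
  | cons a l ih =>
    obtain ⟨l₁, hp₁, hc₁, ⟨e₁⟩, hn₁⟩ := ih fun x hx => hl x (List.mem_cons_of_mem _ hx)
    obtain ⟨l₂, hp₂, hc₂, ⟨e₂⟩, hn₂, -⟩ := exists_chain_insert l₁ a (hl a (by simp)) hp₁ hc₁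
    refine ⟨l₂, hp₂, hc₂, ⟨e₂.trans (((AddEquiv.refl _).prodCongr e₁).trans
      (CycProd.consEquiv a l).symm)⟩, fun q hq => ?_⟩
    rw [hn₂ q hq, List.countP_cons, List.countP_cons, hn₁ q hq]

lemma cycProd_filter_equiv (l : List ℕ) :
    Nonempty (CycProd (l.filter (· ≠ 1)) ≃+ CycProd l) := by
  induction l with
  | nil => exact ⟨AddEquiv.refl _⟩
  | cons a l ih =>
    obtain ⟨e⟩ := ih
    by_cases h : a = 1
    · subst h
      have h1 : (1 :: l).filter (· ≠ 1) = l.filter (· ≠ 1) := by simp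
      rw [h1]
      have : Unique (ZMod 1) := inferInstanceAs (Unique (Fin 1))
      exact ⟨e.trans (AddEquiv.uniqueProd.symm.trans (CycProd.consEquiv 1 l).symm)⟩
    · have h1 : (a :: l).filter (· ≠ 1) = a :: l.filter (· ≠ 1) := by simp [h]
      rw [h1]
      exact ⟨(CycProd.consEquiv _ _).trans (((AddEquiv.refl _).prodCongr e).trans
        (CycProd.consEquiv a l).symm)⟩

lemma cycProd_append_equiv (l r : List ℕ) :
    Nonempty (CycProd (l ++ r) ≃+ CycProd l × CycProd r) := by
  induction l with
  | nil =>
    have : Unique (CycProd []) := inferInstanceAs (Unique Unit)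
    exact ⟨AddEquiv.uniqueProd.symm⟩
  | cons a l ih =>
    obtain ⟨e⟩ := ih
    exact ⟨(CycProd.consEquiv a (l ++ r)).trans (((AddEquiv.refl _).prodCongr e).trans
      (AddEquiv.prodAssoc.symm.trans ((CycProd.consEquiv a l).symm.prodCongr (AddEquiv.refl _))))⟩

lemma cycProd_ofFn_equiv {n : ℕ} (f : Fin n → ℕ) :
    Nonempty (CycProd (List.ofFn f) ≃+ ∀ i, ZMod (f i)) := by
  induction n with
  | zero =>
    rw [List.ofFn_zero]
    have : Unique (CycProd []) := inferInstanceAs (Unique Unit)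
    exact ⟨AddEquiv.ofUnique⟩
  | succ n ih =>
    rw [List.ofFn_succ]
    obtain ⟨e⟩ := ih fun i => f i.succ
    exact ⟨(CycProd.consEquiv _ _).trans (((AddEquiv.refl _).prodCongr e).trans
      (Fin.consLinearEquiv ℤ fun i => ZMod (f i)).toAddEquiv)⟩

lemma card_filter_get (l : List ℕ) (p : ℕ → Prop) [DecidablePred p] :
    (Finset.univ.filter fun j : Fin l.length => p (l.get j)).card = l.countP (p ·) := by
  induction l with
  | nil => simp
  | cons a l ih =>
    rw [List.countP_cons, ← ih]
    refine (Fin.card_filter_univ_succ fun j : Fin (l.length + 1) => p ((a :: l).get j)).trans ?_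
    by_cases h : p a <;> simp [h, add_comm]

lemma cycProd_singleton_equiv (n : ℕ) : Nonempty (CycProd [n] ≃+ ZMod n) := by
  have : Unique (CycProd []) := inferInstanceAs (Unique Unit)
  exact ⟨(CycProd.consEquiv n []).trans AddEquiv.prodUnique⟩

lemma omegaQ_prime_pow {p k : ℕ} (hp : p.Prime) (hk : 0 < k) (q : ℕ) :
    omegaQ (p ^ k) q = if p % q = 1 % q then 1 else 0 := by
  rw [omegaQ, Nat.primeFactors_prime_pow hk.ne' hp, Finset.filter_singleton]
  split_ifs <;> simp

lemma omegaQ_mul_of_coprime {a b : ℕ} (h : a.Coprime b) (q : ℕ) :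
    omegaQ (a * b) q = omegaQ a q + omegaQ b q := by
  rw [omegaQ, h.primeFactors_mul, Finset.filter_union, Finset.card_union_of_disjoint]
  · rfl
  · exact Finset.disjoint_filter_filter h.disjoint_primeFactors

/-- The bounds relating the number of cyclic factors of order divisible by `q` to `omegaQ m q`. -/
def UnitsDecomp (m : ℕ) (l : List ℕ) : Prop :=
  (∀ x ∈ l, 0 < x) ∧ Nonempty ((ZMod m)ˣ ≃* Multiplicative (CycProd l)) ∧
    ∀ q, IsPrimePow q → omegaQ m q ≤ l.countP (q ∣ ·) ∧
      l.countP (q ∣ ·) ≤ omegaQ m q + (if q.minFac ∣ m then 1 else 0) + m.factorization 2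

lemma exists_unitsDecomp_odd_prime_pow {p k : ℕ} (hp : p.Prime) (hk : 0 < k) (h2 : p ≠ 2) :
    ∃ l, UnitsDecomp (p ^ k) l := by
  have hcyc : IsCyclic (ZMod (p ^ k))ˣ := by
    rw [ZMod.isCyclic_units_iff]
    exact Or.inr <| Or.inr <| Or.inr <| Or.inr
      ⟨p, k, hp, hp.odd_of_ne_two h2, hk, Or.inl rfl⟩
  have hne : NeZero (p ^ k) := ⟨(pow_pos hp.pos k).ne'⟩
  have hcard : Nat.card (ZMod (p ^ k))ˣ = p ^ (k - 1) * (p - 1) := by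
    rw [Nat.card_eq_fintype_card, ZMod.card_units_eq_totient, Nat.totient_prime_pow hp hk]
  have e := zmodCyclicMulEquiv hcyc
  rw [hcard] at e
  obtain ⟨e'⟩ := cycProd_singleton_equiv (p ^ (k - 1) * (p - 1))
  have hp1 : 0 < p - 1 := Nat.sub_pos_of_lt hp.one_lt
  refine ⟨[p ^ (k - 1) * (p - 1)], ?_, ⟨e.symm.trans e'.symm.toMultiplicative⟩, ?_⟩
  · intro x hx
    rw [List.mem_singleton.1 hx]
    exact Nat.mul_pos (pow_pos hp.pos _) hp1
  · intro q hq
    rw [omegaQ_prime_pow hp hk, List.countP_singleton]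
    have hmod : p % q = 1 % q ↔ q ∣ p - 1 := by
      rw [eq_comm, ← Nat.modEq_iff_dvd' hp.one_le]
      rfl
    simp only [hmod, decide_eq_true_eq]
    constructor
    · split_ifs with h1 h3
      · exact le_rfl
      · exact absurd (h1.mul_left _) h3
      · exact Nat.zero_le _
      · exact le_rfl
    · have key : q ∣ p ^ (k - 1) * (p - 1) → q ∣ p - 1 ∨ q.minFac ∣ p ^ k := by
        intro h
        by_cases hm : q.minFac = p
        · exact Or.inr (hm ▸ dvd_pow_self _ hk.ne')
        · left
          refine Nat.Coprime.dvd_of_dvd_mul_left ?_ h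
          refine Nat.Coprime.pow_right _ ?_
          rw [Nat.coprime_comm, hp.coprime_iff_not_dvd]
          intro hpq
          apply hm
          obtain ⟨r, e, hr, -, rfl⟩ := hq
          rw [← Nat.prime_iff] at hr
          have := (Nat.prime_dvd_prime_iff_eq hp hr).1 (hp.dvd_of_dvd_pow hpq)
          subst this
          by_cases he : e = 0
          · subst he
            exact absurd hpq (by simpa using hp.one_lt.ne')
          · exact hp.pow_minFac he
      split_ifs with h1 h3 h4 h4
      all_goals omega

lemma exists_unitsDecomp_two_pow {k : ℕ} (hk : 0 < k) : ∃ l, UnitsDecomp (2 ^ k) l := by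
  have hne : NeZero (2 ^ k) := ⟨(pow_pos two_pos k).ne'⟩
  obtain ⟨ι, _, n, hn, ⟨e⟩⟩ := CommGroup.equiv_prod_multiplicative_zmod_of_finite (ZMod (2 ^ k))ˣ
  let E := Fintype.equivFin ι
  obtain ⟨e₂⟩ := cycProd_ofFn_equiv fun j => n (E.symm j)
  have e₃ : (∀ j, ZMod (n (E.symm j))) ≃+ ∀ i, ZMod (n i) :=
    (LinearEquiv.piCongrLeft ℤ (fun i => ZMod (n i)) E.symm).toAddEquiv
  have e₄ : (∀ i, Multiplicative (ZMod (n i))) ≃* Multiplicative (∀ i, ZMod (n i)) :=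
    (MulEquiv.piMultiplicative fun i => ZMod (n i)).symm
  have hcard : ∏ i, n i = 2 ^ (k - 1) := by
    have h1 := Nat.card_congr e.toEquiv
    rw [Nat.card_eq_fintype_card, ZMod.card_units_eq_totient,
      Nat.totient_prime_pow Nat.prime_two hk, Nat.card_pi] at h1
    have h2 : ∀ i, Nat.card (Multiplicative (ZMod (n i))) = n i := fun i => Nat.card_zmod _
    simp only [h2] at h1
    omega
  have hle : Fintype.card ι ≤ k - 1 := by
    have h1 : 2 ^ Fintype.card ι ≤ ∏ i, n i := by
      rw [← Finset.card_univ]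
      exact Finset.pow_card_le_prod _ _ _ fun i _ => hn i
    rw [hcard] at h1
    exact (Nat.pow_le_pow_iff_right one_lt_two).1 h1
  refine ⟨List.ofFn fun j => n (E.symm j), ?_,
    ⟨e.trans (e₄.trans (e₂.trans e₃).symm.toMultiplicative)⟩, fun q hq => ⟨?_, ?_⟩⟩
  · intro x hx
    obtain ⟨j, rfl⟩ := (List.mem_ofFn' _ _).1 hx
    exact zero_lt_one.trans (hn _)
  · rw [omegaQ_prime_pow Nat.prime_two hk, if_neg]
    · exact Nat.zero_le _
    · have h2 : 2 ≤ q := hq.two_le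
      rcases h2.eq_or_lt with rfl | h
      · decide
      · rw [Nat.mod_eq_of_lt h, Nat.mod_eq_of_lt (by omega)]
        decide
  · refine List.countP_le_length.trans ?_
    rw [List.length_ofFn, Nat.prime_two.factorization_pow, Finsupp.single_eq_same]
    omega

lemma exists_unitsDecomp_mul {a b : ℕ} (ha : 0 < a) (hb : 0 < b) (hab : a.Coprime b)
    {l r : List ℕ} (hl : UnitsDecomp a l) (hr : UnitsDecomp b r) :
    UnitsDecomp (a * b) (l ++ r) := by
  obtain ⟨hl1, ⟨el⟩, hl2⟩ := hl
  obtain ⟨hr1, ⟨er⟩, hr2⟩ := hr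
  obtain ⟨e⟩ := cycProd_append_equiv l r
  refine ⟨fun x hx => ?_, ⟨?_⟩, fun q hq => ?_⟩
  · rcases List.mem_append.1 hx with h | h
    exacts [hl1 x h, hr1 x h]
  · exact (Units.mapEquiv (ZMod.chineseRemainder hab).toMulEquiv).trans
      (MulEquiv.prodUnits.trans ((el.prodCongr er).trans
        ((MulEquiv.prodMultiplicative _ _).symm.trans e.symm.toMultiplicative)))
  · rw [List.countP_append, omegaQ_mul_of_coprime hab, Nat.factorization_mul ha.ne' hb.ne',
      Finsupp.add_apply]
    have h1 := hl2 q hq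
    have h2 := hr2 q hq
    refine ⟨add_le_add h1.1 h2.1, ?_⟩
    have hr : q.minFac.Prime := Nat.minFac_prime hq.one_lt.ne'
    have h3 : (if q.minFac ∣ a then 1 else 0) + (if q.minFac ∣ b then 1 else 0) ≤
        (if q.minFac ∣ a * b then 1 else 0) := by
      by_cases hA : q.minFac ∣ a <;> by_cases hB : q.minFac ∣ b
      · exact absurd (Nat.dvd_gcd hA hB) (by
          rw [hab.gcd_eq_one]; exact hr.one_lt.ne' ∘ Nat.dvd_one.1)
      · simp [hA, hB, hA.mul_right]
      · simp [hA, hB, hB.mul_left]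
      · simp [hA, hB]
    omega

lemma exists_unitsDecomp (m : ℕ) : 0 < m → ∃ l, UnitsDecomp m l := by
  induction m using Nat.recOnPosPrimePosCoprime with
  | prime_pow p n hp hn =>
    intro _
    by_cases h : p = 2
    · subst h; exact exists_unitsDecomp_two_pow hn
    · exact exists_unitsDecomp_odd_prime_pow hp hn h
  | zero => exact fun h => absurd h (lt_irrefl 0)
  | one =>
    intro _
    have : Unique (CycProd []) := inferInstanceAs (Unique Unit)
    have : Unique (Multiplicative (CycProd [])) := inferInstanceAs (Unique Unit)
    have : Unique (ZMod 1)ˣ := inferInstanceAs (Unique (Fin 1)ˣ)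
    exact ⟨[], by simp, ⟨MulEquiv.ofUnique⟩, fun q _ => by simp [omegaQ]⟩
  | coprime a b ha hb hab iha ihb =>
    intro _
    obtain ⟨l, hl⟩ := iha (by omega)
    obtain ⟨r, hr⟩ := ihb (by omega)
    exact ⟨l ++ r, exists_unitsDecomp_mul (by omega) (by omega) hab hl hr⟩

/-- Invariant factors of `(ℤ/mℤ)ˣ`, with the number divisible by each prime power `q` controlled
by `omegaQ m q`. -/
lemma exists_invariant_factors {m : ℕ} (hm : 0 < m) : ∃ (K : ℕ) (lam : Fin K → ℕ),
    (∀ j, 1 < lam j) ∧ (∀ j k : Fin K, j ≤ k → lam j ∣ lam k) ∧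
    Nonempty ((ZMod m)ˣ ≃* Multiplicative (∀ j : Fin K, ZMod (lam j))) ∧
    ∀ q, IsPrimePow q → omegaQ m q ≤ (Finset.univ.filter fun j => q ∣ lam j).card ∧
      (Finset.univ.filter fun j => q ∣ lam j).card ≤ omegaQ m q + 1 + m.factorization 2 := by
  obtain ⟨l, hl, ⟨e₁⟩, hcount⟩ := exists_unitsDecomp m hm
  obtain ⟨l₁, hpos, hch, ⟨e₂⟩, hcount₁⟩ := exists_chain l hl
  obtain ⟨e₃⟩ := cycProd_filter_equiv l₁
  set r := l₁.filter (· ≠ 1) with hr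
  obtain ⟨e₄⟩ := cycProd_ofFn_equiv r.get
  rw [List.ofFn_get] at e₄
  have hchr : r.Pairwise (· ∣ ·) := hch.filter _
  refine ⟨r.length, r.get, fun j => ?_, fun j k hjk => ?_,
    ⟨e₁.trans (e₂.symm.trans (e₃.symm.trans e₄)).toMultiplicative⟩, fun q hq => ?_⟩
  · have h : r.get j ∈ l₁.filter (· ≠ 1) := List.get_mem r j
    rw [List.mem_filter] at h
    have h1 := hpos _ h.1
    have h2 : r.get j ≠ 1 := by simpa using h.2
    omega
  · rcases hjk.eq_or_lt with rfl | h
    · exact dvd_rfl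
    · exact List.pairwise_iff_get.1 hchr j k h
  · have h1 : r.countP (q ∣ ·) = l.countP (q ∣ ·) := by
      rw [← hcount₁ q hq, hr, List.countP_filter]
      refine List.countP_congr fun x _ => ?_
      simp only [ne_eq, decide_not, Bool.and_eq_true, decide_eq_true_eq, Bool.not_eq_true',
        decide_eq_false_iff_not, and_iff_left_iff_imp]
      rintro h rfl
      exact hq.one_lt.ne' (Nat.dvd_one.1 h)
    rw [card_filter_get r (q ∣ ·), h1]
    refine ⟨(hcount q hq).1, (hcount q hq).2.trans ?_⟩
    split_ifs <;> omega

lemma upperSet_subset_of_card_le {α : Type*} [LinearOrder α] {S T : Finset α}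
    (hS : ∀ j k, j ≤ k → j ∈ S → k ∈ S) (hT : ∀ j k, j ≤ k → j ∈ T → k ∈ T)
    (h : S.card ≤ T.card) : S ⊆ T := by
  intro x hx
  by_contra hxT
  have h1 : T ⊆ S := fun y hy => by
    rcases le_total x y with hxy | hxy
    · exact hS x y hxy hx
    · exact absurd (hT y x hxy hy) hxT
  exact hxT (Finset.eq_of_subset_of_card_le h1 h ▸ hx)

lemma eq_of_primePow_dvd_iff {x y : ℕ} (hx : 0 < x) (hy : 0 < y)
    (h : ∀ q, IsPrimePow q → (q ∣ x ↔ q ∣ y)) : x = y := by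
  have key : ∀ {x y : ℕ}, 0 < x → 0 < y → (∀ q, IsPrimePow q → q ∣ x → q ∣ y) → x ∣ y := by
    intro x y hx hy h
    rw [Nat.dvd_iff_prime_pow_dvd_dvd]
    intro p k hp hpk
    rcases Nat.eq_zero_or_pos k with rfl | hk
    · simp
    · exact h _ (hp.isPrimePow.pow hk.ne') hpk
  exact Nat.dvd_antisymm (key hx hy fun q hq => (h q hq).1) (key hy hx fun q hq => (h q hq).2)

lemma IsInvCount.abs_sub_le {d : ℕ} {J : ℕ → ℕ} (hJ : IsInvCount d J) (hd : 0 < d) {a b c m : ℕ}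
    (hm : 0 < m) (ha : IsPrimePow a) (hb : IsPrimePow b) (hc : IsPrimePow c)
    (had : a ∣ d) (hbd : b ∣ d) (hcd : ¬ c ∣ d)
    (hin : ∀ q, IsPrimePow q → q ∣ d → q = a ∨ q = b ∨
      min (omegaQ m a) (omegaQ m b) + (1 + m.factorization 2) ≤ omegaQ m q)
    (hout : ∀ q, IsPrimePow q → ¬ q ∣ d → q = c ∨
      omegaQ m q + (1 + m.factorization 2) ≤ omegaQ m c)
    (hle : omegaQ m c + (1 + m.factorization 2) ≤ min (omegaQ m a) (omegaQ m b)) :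
    |(J m : ℝ) - (min (omegaQ m a : ℝ) (omegaQ m b) - omegaQ m c)| ≤ 1 + m.factorization 2 := by
  obtain ⟨K, lam, h1, hch, hiso, hN⟩ := exists_invariant_factors hm
  set A : ℕ → Finset (Fin K) := fun q => Finset.univ.filter fun j => q ∣ lam j with hA
  have hmem : ∀ q j, j ∈ A q ↔ q ∣ lam j := fun q j => by simp [hA]
  have hup : ∀ q j k, j ≤ k → j ∈ A q → k ∈ A q := fun q j k hjk hj => by
    rw [hmem] at hj ⊢
    exact hj.trans (hch j k hjk)
  have hup' : ∀ j k, j ≤ k → j ∈ A a ∩ A b → k ∈ A a ∩ A b := fun j k hjk hj => by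
    rw [Finset.mem_inter] at hj ⊢
    exact ⟨hup a j k hjk hj.1, hup b j k hjk hj.2⟩
  have hinter : (A a ∩ A b).card = min (A a).card (A b).card := by
    rcases le_total (A a).card (A b).card with h | h
    · rw [min_eq_left h, Finset.inter_eq_left.2 (upperSet_subset_of_card_le (hup a) (hup b) h)]
    · rw [min_eq_right h, Finset.inter_eq_right.2 (upperSet_subset_of_card_le (hup b) (hup a) h)]
  have hNq : ∀ q, IsPrimePow q → omegaQ m q ≤ (A q).card ∧
    (A q).card ≤ omegaQ m q + 1 + m.factorization 2 := hN
  have hNa := hNq a ha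
  have hNb := hNq b hb
  have hNc := hNq c hc
  have hcsub : A c ⊆ A a ∩ A b := upperSet_subset_of_card_le (hup c) hup' (by omega)
  have hset : (Finset.univ.filter fun j : Fin K => lam j = d) = (A a ∩ A b) \ A c := by
    ext j
    simp only [Finset.mem_filter, Finset.mem_univ, true_and, Finset.mem_sdiff, Finset.mem_inter,
      hmem]
    constructor
    · rintro rfl
      exact ⟨⟨had, hbd⟩, hcd⟩
    · rintro ⟨⟨hja, hjb⟩, hjc⟩
      refine eq_of_primePow_dvd_iff (by linarith [h1 j]) hd fun q hq => ⟨fun h => ?_, fun h => ?_⟩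
      · by_contra hqd
        rcases hout q hq hqd with rfl | h2
        · exact hjc h
        · have hNq' := hNq q hq
          refine hjc ((hmem c j).1 (upperSet_subset_of_card_le (hup q) (hup c) ?_ ((hmem q j).2 h)))
          omega
      · rcases hin q hq h with rfl | rfl | h2
        · exact hja
        · exact hjb
        · have hNq' := hNq q hq
          refine (hmem q j).1 (upperSet_subset_of_card_le hup' (hup q) ?_
            (Finset.mem_inter.2 ⟨(hmem a j).2 hja, (hmem b j).2 hjb⟩))
          omega
  have hJm : J m = min (A a).card (A b).card - (A c).card := by
    rw [hJ m hm K lam h1 hch hiso, hset, Finset.card_sdiff_of_subset hcsub, hinter]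
  have hfin1 : (J m : ℤ) - ((min (omegaQ m a) (omegaQ m b) : ℕ) - omegaQ m c) ≤
      1 + m.factorization 2 := by omega
  have hfin2 : -(1 + m.factorization 2 : ℤ) ≤
      (J m : ℤ) - ((min (omegaQ m a) (omegaQ m b) : ℕ) - omegaQ m c) := by omega
  rw [abs_le, ← Nat.cast_min]
  exact ⟨by exact_mod_cast hfin2, by exact_mod_cast hfin1⟩

/-- A family of events whose density among `1, …, n` tends to zero. -/
def Negligible (P : ℕ → ℕ → Prop) : Prop :=
  Tendsto (fun n : ℕ => (cnt (P n) n : ℝ) / n) atTop (nhds 0)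

lemma Negligible.of_eventually_le {P : ℕ → ℕ → Prop} {f : ℕ → ℝ} (hf : Tendsto f atTop (nhds 0))
    (h : ∀ᶠ n in atTop, (cnt (P n) n : ℝ) / n ≤ f n) : Negligible P :=
  squeeze_zero' (Eventually.of_forall fun _ => by positivity) h hf

lemma Negligible.mono {P Q : ℕ → ℕ → Prop} (hQ : Negligible Q)
    (h : ∀ᶠ n in atTop, ∀ m, P n m → Q n m) : Negligible P := by
  refine Negligible.of_eventually_le hQ (h.mono fun n hn => ?_)
  gcongr
  exact cnt_mono n fun m _ _ => hn m

lemma Negligible.or {P Q : ℕ → ℕ → Prop} (hP : Negligible P) (hQ : Negligible Q) :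
    Negligible fun n m => P n m ∨ Q n m := by
  have h := Tendsto.add hP hQ
  rw [add_zero] at h
  refine Negligible.of_eventually_le h (Eventually.of_forall fun n => ?_)
  rw [← add_div]
  gcongr
  exact_mod_cast cnt_or_le _ _ n

lemma Negligible.exists_mem {S : Finset ℕ} {P : ℕ → ℕ → ℕ → Prop}
    (h : ∀ q ∈ S, Negligible (P q)) : Negligible fun n m => ∃ q ∈ S, P q n m := by
  have h1 := tendsto_finsetSum S h
  rw [Finset.sum_const_zero] at h1
  refine Negligible.of_eventually_le h1 (Eventually.of_forall fun n => ?_)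
  rw [← Finset.sum_div]
  gcongr
  exact_mod_cast cnt_exists_le (fun q => P q n) n

lemma eventually_mul_sqrt_LL_le (δ : ℝ) {c : ℝ} (hc : 0 < c) :
    ∀ᶠ n in atTop, δ * Real.sqrt (LL n) ≤ c * LL n := by
  filter_upwards [tendsto_sqrt_LL.eventually_ge_atTop (δ / c), tendsto_LL.eventually_ge_atTop 0]
    with n h1 h2
  rw [div_le_iff₀ hc] at h1
  have h3 := mul_le_mul_of_nonneg_right h1 (Real.sqrt_nonneg (LL n))
  rwa [mul_right_comm, Real.mul_self_sqrt h2, mul_comm (LL n)] at h3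

lemma negligible_omegaQ_sub_le_sqrt {q r : ℕ} (hq : 0 < q) (h : q.totient < r.totient) (δ : ℝ) :
    Negligible fun n m => (omegaQ m q : ℝ) - omegaQ m r ≤ δ * Real.sqrt (LL n) := by
  have hq' : (0 : ℝ) < q.totient := by exact_mod_cast Nat.totient_pos.2 hq
  have hlt : (1 : ℝ) / r.totient < 1 / q.totient :=
    one_div_lt_one_div_of_lt hq' (by exact_mod_cast h)
  have hr : 0 < r := Nat.totient_pos.1 (Nat.zero_lt_of_lt h)
  obtain ⟨c, hc0, hc⟩ := exists_between (sub_pos.2 hlt)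
  exact Negligible.mono (tendsto_cnt_omegaQ_sub_le hq hr hc)
    ((eventually_mul_sqrt_LL_le δ hc0).mono fun n hn m hm => hm.trans hn)

lemma exists_negligible_omegaQ_large {c : ℕ} (hc : 0 < c) (δ : ℝ) : ∃ Y : ℕ,
    Negligible fun n m => ∃ q, Y < q ∧ IsPrimePow q ∧
      (omegaQ m c : ℝ) - omegaQ m q ≤ δ * Real.sqrt (LL n) := by
  have hG : (0 : ℝ) < 1 / c.totient := by
    have := Nat.totient_pos.2 hc
    positivity
  obtain ⟨s, hs0, hs⟩ := exists_between hG
  obtain ⟨Y, hY⟩ := tendsto_cnt_exists_omegaQ_large (half_pos (half_pos hs0))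
  refine ⟨Y, Negligible.mono (Negligible.or hY (tendsto_cnt_omegaQ_le hc hs)) ?_⟩
  filter_upwards [eventually_mul_sqrt_LL_le δ (half_pos hs0),
    tendsto_LL.eventually_gt_atTop 0] with n h1 h2
  rintro m ⟨q, hq, hpp, hm⟩
  by_cases h : (omegaQ m c : ℝ) ≤ s * LL n
  · exact Or.inr h
  · refine Or.inl ⟨q, hq, hpp, ?_⟩
    nlinarith [mul_pos hs0 h2]

lemma negligible_large_factorization_two {δ : ℝ} (hδ : 0 < δ) :
    Negligible fun n m => δ * Real.sqrt (LL n) ≤ 1 + m.factorization 2 := by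
  have h : Tendsto (fun n => δ * Real.sqrt (LL n) - 1) atTop atTop :=
    tendsto_atTop_add_const_right _ _ (tendsto_sqrt_LL.const_mul_atTop hδ)
  refine Negligible.mono (tendsto_cnt_factorization_two h) (Eventually.of_forall fun n m hm => ?_)
  linarith

lemma IsInvCount.negligible_sub {d : ℕ} {J : ℕ → ℕ} (hJ : IsInvCount d J) (hd : 0 < d)
    {a b c : ℕ} (ha : IsPrimePow a) (hb : IsPrimePow b) (hc : IsPrimePow c)
    (had : a ∣ d) (hbd : b ∣ d) (hcd : ¬ c ∣ d) (hac : a.totient < c.totient)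
    (hbc : b.totient < c.totient)
    (hin : ∀ q, IsPrimePow q → q ∣ d → q = a ∨ q = b ∨ q.totient < a.totient)
    (hout : ∀ q, IsPrimePow q → ¬ q ∣ d → q = c ∨ c.totient < q.totient) {δ : ℝ} (hδ : 0 < δ) :
    Negligible fun n m => 0 < m ∧ δ * Real.sqrt (LL n) <
      |(J m : ℝ) - (min (omegaQ m a : ℝ) (omegaQ m b) - omegaQ m c)| := by
  classical
  obtain ⟨Y, hY⟩ := exists_negligible_omegaQ_large hc.pos δ
  have h1 : Negligible fun n m => ∃ q ∈ d.divisors.filter (fun q => IsPrimePow q ∧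
      q.totient < a.totient), (omegaQ m q : ℝ) - omegaQ m a ≤ δ * Real.sqrt (LL n) := by
    refine Negligible.exists_mem fun q hq => ?_
    have hq' := (Finset.mem_filter.1 hq).2
    exact negligible_omegaQ_sub_le_sqrt hq'.1.pos hq'.2 δ
  have h2 : Negligible fun n m => ∃ q ∈ (Finset.Icc 1 Y).filter (fun q => c.totient < q.totient),
      (omegaQ m c : ℝ) - omegaQ m q ≤ δ * Real.sqrt (LL n) := by
    refine Negligible.exists_mem fun q hq => ?_
    exact negligible_omegaQ_sub_le_sqrt hc.pos (Finset.mem_filter.1 hq).2 δ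
  refine Negligible.mono ((((((negligible_large_factorization_two hδ).or hY).or h1).or h2).or
    (negligible_omegaQ_sub_le_sqrt ha.pos hac δ)).or (negligible_omegaQ_sub_le_sqrt hb.pos hbc δ))
    (Eventually.of_forall fun n m hm => ?_)
  obtain ⟨hm0, hm⟩ := hm
  by_contra! hnot
  obtain ⟨⟨⟨⟨⟨hE, hY'⟩, h1'⟩, h2'⟩, hac'⟩, hbc'⟩ := hnot
  refine absurd (hJ.abs_sub_le hd hm0 ha hb hc had hbd hcd ?_ ?_ ?_) (by linarith)
  · intro q hq hqd
    rcases hin q hq hqd with h | h | h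
    · exact Or.inl h
    · exact Or.inr (Or.inl h)
    · have := h1' q (Finset.mem_filter.2 ⟨Nat.mem_divisors.2 ⟨hqd, hd.ne'⟩, hq, h⟩)
      have h3 : ((omegaQ m a + (1 + m.factorization 2) : ℕ) : ℝ) ≤ omegaQ m q := by
        push_cast
        linarith
      have h4 := min_le_left (omegaQ m a) (omegaQ m b)
      have h5 : omegaQ m a + (1 + m.factorization 2) ≤ omegaQ m q := by exact_mod_cast h3
      omega
  · intro q hq hqd
    rcases hout q hq hqd with h | h
    · exact Or.inl h
    · right
      have h3 : δ * Real.sqrt (LL n) < (omegaQ m c : ℝ) - omegaQ m q := by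
        by_cases hqY : Y < q
        · exact hY' q hqY hq
        · exact h2' q (Finset.mem_filter.2 ⟨Finset.mem_Icc.2 ⟨hq.pos, not_lt.1 hqY⟩, h⟩)
      have h4 : ((omegaQ m q + (1 + m.factorization 2) : ℕ) : ℝ) ≤ omegaQ m c := by
        push_cast
        linarith
      exact_mod_cast h4
  · have h3 : ((omegaQ m c + (1 + m.factorization 2) : ℕ) : ℝ) ≤ omegaQ m a := by
      push_cast
      linarith
    have h4 : ((omegaQ m c + (1 + m.factorization 2) : ℕ) : ℝ) ≤ omegaQ m b := by
      push_cast
      linarith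
    exact le_min (by exact_mod_cast h3) (by exact_mod_cast h4)

lemma tendsto_cnt_of_negligible_sub {X Y : ℕ → ℝ} {Ψ : ℝ → ℝ} (hΨ : Continuous Ψ) {μ σ : ℝ}
    (hσ : 0 < σ)
    (hY : ∀ x, Tendsto (fun n : ℕ => (cnt (fun m => Y m ≤ μ * LL n + x * σ * Real.sqrt (LL n)) n : ℝ)
      / n) atTop (nhds (Ψ x)))
    (hXY : ∀ δ > 0, Negligible fun n m => 0 < m ∧ δ * Real.sqrt (LL n) < |X m - Y m|) (x : ℝ) :
    Tendsto (fun n : ℕ => (cnt (fun m => X m ≤ μ * LL n + x * σ * Real.sqrt (LL n)) n : ℝ) / n)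
      atTop (nhds (Ψ x)) := by
  have hcmp : ∀ {U V : ℕ → ℝ} (n : ℕ) (y η : ℝ),
      (∀ m, |U m - V m| = |X m - Y m|) →
      (cnt (fun m => U m ≤ μ * LL n + y * σ * Real.sqrt (LL n)) n : ℝ) / n ≤
      (cnt (fun m => V m ≤ μ * LL n + (y + η) * σ * Real.sqrt (LL n)) n : ℝ) / n +
      (cnt (fun m => 0 < m ∧ η * σ * Real.sqrt (LL n) < |X m - Y m|) n : ℝ) / n := by
    intro U V n y η hUV
    rw [← add_div]
    gcongr
    rw [← Nat.cast_add, Nat.cast_le]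
    refine le_trans (cnt_mono n fun m hm1 _ hm => ?_) (cnt_or_le _ _ n)
    by_contra! h
    have h2 := h.2 hm1
    rw [← hUV m, abs_le] at h2
    nlinarith [h.1, h2.1]
  rw [tendsto_order]
  constructor
  · intro u hu
    have h1 : ∀ᶠ η in nhdsWithin (0 : ℝ) (Set.Ioi 0), u < Ψ (x - η) := by
      refine (Tendsto.mono_left ?_ nhdsWithin_le_nhds).eventually (lt_mem_nhds hu)
      have : Continuous fun η => Ψ (x - η) := by fun_prop
      simpa using this.tendsto 0
    obtain ⟨η, hη, hη0⟩ := (h1.and self_mem_nhdsWithin).exists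
    have h2 := (hY (x - η)).sub (hXY (η * σ) (mul_pos hη0 hσ))
    rw [sub_zero] at h2
    filter_upwards [h2.eventually (lt_mem_nhds hη)] with n hn
    have h3 := hcmp n (x - η) η (U := Y) (V := X) fun m => abs_sub_comm _ _
    rw [sub_add_cancel] at h3
    linarith
  · intro u hu
    have h1 : ∀ᶠ η in nhdsWithin (0 : ℝ) (Set.Ioi 0), Ψ (x + η) < u := by
      refine (Tendsto.mono_left ?_ nhdsWithin_le_nhds).eventually (gt_mem_nhds hu)
      have : Continuous fun η => Ψ (x + η) := by fun_prop
      simpa using this.tendsto 0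
    obtain ⟨η, hη, hη0⟩ := (h1.and self_mem_nhdsWithin).exists
    have h2 := (hY (x + η)).add (hXY (η * σ) (mul_pos hη0 hσ))
    rw [add_zero] at h2
    filter_upwards [h2.eventually (gt_mem_nhds hη)] with n hn
    exact (hcmp n x η (U := X) (V := Y) fun m => rfl).trans_lt hn

theorem PairData.tendsto_cnt_invCount {a b c : ℕ} {F G μ σ ρ τ : ℝ}
    (D : PairData a b c F G μ σ ρ τ) {d : ℕ} {J : ℕ → ℕ} (hJ : IsInvCount d J) (hd : 0 < d)
    (ha : IsPrimePow a) (hb : IsPrimePow b) (hc : IsPrimePow c)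
    (had : a ∣ d) (hbd : b ∣ d) (hcd : ¬ c ∣ d) (hac : a.totient < c.totient)
    (hbc : b.totient < c.totient)
    (hin : ∀ q, IsPrimePow q → q ∣ d → q = a ∨ q = b ∨ q.totient < a.totient)
    (hout : ∀ q, IsPrimePow q → ¬ q ∣ d → q = c ∨ c.totient < q.totient) (x : ℝ) :
    Tendsto (fun n : ℕ => (cnt (fun m => (J m : ℝ) ≤ μ * LL n + x * σ * Real.sqrt (LL n)) n : ℝ)
      / n) atTop (nhds (PhiSkew x (-((1 - ρ) / τ)))) :=
  tendsto_cnt_of_negligible_sub (continuous_PhiSkew _) D.hσ D.tendsto_cnt_min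
    (fun _ hδ => hJ.negligible_sub hd ha hb hc had hbd hcd hac hbc hin hout hδ) x

lemma ppKey_lt_of_totient_lt {q r : ℕ} (hq : IsPrimePow q) (h : q.totient < r.totient) :
    ppKey q < ppKey r := by
  have h1 := hq.le_two_mul_totient
  have h2 : (q.totient + 1) ^ 2 ≤ r.totient ^ 2 := Nat.pow_le_pow_left h 2
  simp only [ppKey]
  nlinarith

lemma totient_le_of_ppKey_le {q r : ℕ} (hr : IsPrimePow r) (h : ppKey q ≤ ppKey r) :
    q.totient ≤ r.totient := by
  by_contra! h1
  exact absurd (ppKey_lt_of_totient_lt hr h1) (not_lt.2 h)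

lemma ppKey_injOn {q r : ℕ} (hq : IsPrimePow q) (hr : IsPrimePow r) (h : ppKey q = ppKey r) :
    q = r := by
  have h1 := le_antisymm (totient_le_of_ppKey_le hr h.le) (totient_le_of_ppKey_le hq h.ge)
  simp only [ppKey, h1] at h
  omega

lemma infinite_ppKey : {k : ℕ | ∃ q : ℕ, IsPrimePow q ∧ ppKey q = k}.Infinite := by
  have h : (ppKey '' {p | p.Prime}).Infinite := by
    refine Nat.infinite_setOfPred_prime.image fun p hp q hq hpq => ?_
    exact ppKey_injOn (Nat.Prime.isPrimePow hp) (Nat.Prime.isPrimePow hq) hpq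
  refine h.mono ?_
  rintro k ⟨p, hp, rfl⟩
  exact ⟨p, Nat.Prime.isPrimePow hp, rfl⟩

lemma qt_spec (i : ℕ) : IsPrimePow (qt i) ∧ ppKey (qt i) = ppNthKey (i - 1) := by
  have h : ∃ q : ℕ, IsPrimePow q ∧ ppKey q = ppNthKey (i - 1) :=
    Nat.nth_mem_of_infinite infinite_ppKey (i - 1)
  exact Nat.sInf_mem (s := {q : ℕ | IsPrimePow q ∧ ppKey q = ppNthKey (i - 1)}) h

lemma isPrimePow_qt (i : ℕ) : IsPrimePow (qt i) := (qt_spec i).1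

lemma exists_qt_eq {q : ℕ} (hq : IsPrimePow q) : ∃ i, 1 ≤ i ∧ qt i = q := by
  have h : ppKey q ∈ Set.range (Nat.nth fun k => ∃ q : ℕ, IsPrimePow q ∧ ppKey q = k) := by
    rw [Nat.range_nth_of_infinite infinite_ppKey]
    exact ⟨q, hq, rfl⟩
  obtain ⟨j, hj⟩ := h
  refine ⟨j + 1, by omega, ppKey_injOn (isPrimePow_qt _) hq ?_⟩
  rw [(qt_spec _).2, ← hj, Nat.add_sub_cancel, ppNthKey]

lemma ppKey_qt_lt {i j : ℕ} (hi : 1 ≤ i) (hij : i < j) : ppKey (qt i) < ppKey (qt j) := by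
  rw [(qt_spec i).2, (qt_spec j).2]
  exact Nat.nth_strictMono infinite_ppKey (by omega)

lemma totient_qt_mono {i j : ℕ} (hi : 1 ≤ i) (hij : i ≤ j) :
    (qt i).totient ≤ (qt j).totient := by
  rcases hij.eq_or_lt with rfl | h
  · exact le_rfl
  · exact totient_le_of_ppKey_le (isPrimePow_qt j) (ppKey_qt_lt hi h).le

lemma qt_injOn {i j : ℕ} (hi : 1 ≤ i) (hj : 1 ≤ j) (h : qt i = qt j) : i = j := by
  rcases lt_trichotomy i j with h1 | h1 | h1
  · exact absurd (congrArg ppKey h) (ppKey_qt_lt hi h1).ne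
  · exact h1
  · exact absurd (congrArg ppKey h) (ppKey_qt_lt hj h1).ne'

lemma Lseq_succ (i : ℕ) : Lseq (i + 1) = Nat.lcm (Lseq i) (qt (i + 1)) := by
  have h : Finset.Icc 1 (i + 1) = insert (i + 1) (Finset.Icc 1 i) := by
    ext j
    simp only [Finset.mem_Icc, Finset.mem_insert]
    omega
  rw [Lseq, h, Finset.lcm_insert, lcm_comm]
  rfl

lemma Lseq_pos (i : ℕ) : 0 < Lseq i := by
  induction i with
  | zero => simp [Lseq]
  | succ i ih =>
    rw [Lseq_succ]
    exact Nat.lcm_pos ih (isPrimePow_qt _).pos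

lemma IsPrimePow.dvd_Lseq_iff {q : ℕ} (hq : IsPrimePow q) (i : ℕ) :
    q ∣ Lseq i ↔ ∃ j, 1 ≤ j ∧ j ≤ i ∧ q ∣ qt j := by
  induction i with
  | zero =>
    constructor
    · intro h
      exact absurd (Nat.dvd_one.1 (by simpa [Lseq] using h)) hq.one_lt.ne'
    · rintro ⟨j, h1, h2, -⟩
      omega
  | succ i ih =>
    rw [Lseq_succ, hq.dvd_lcm_iff (Lseq_pos i) (isPrimePow_qt _).pos, ih]
    constructor
    · rintro (⟨j, h1, h2, h3⟩ | h)
      · exact ⟨j, h1, by omega, h3⟩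
      · exact ⟨i + 1, by omega, le_rfl, h⟩
    · rintro ⟨j, h1, h2, h3⟩
      rcases h2.eq_or_lt with rfl | h
      · exact Or.inr h3
      · exact Or.inl ⟨j, h1, by omega, h3⟩

lemma qt_dvd_Lseq_iff {i j : ℕ} (hj : 1 ≤ j) : qt j ∣ Lseq i ↔ j ≤ i := by
  rw [(isPrimePow_qt j).dvd_Lseq_iff]
  constructor
  · rintro ⟨k, hk1, hki, hdvd⟩
    by_contra! h
    have h1 := ppKey_qt_lt hk1 (hki.trans_lt h)
    have h2 : ppKey (qt j) ≤ ppKey (qt k) := by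
      have h3 := Nat.le_of_dvd (isPrimePow_qt k).pos hdvd
      have h4 := Nat.le_of_dvd (Nat.totient_pos.2 (isPrimePow_qt k).pos)
        (Nat.totient_dvd_of_dvd hdvd)
      simp only [ppKey]
      gcongr
    omega
  · exact fun h => ⟨j, hj, h, dvd_rfl⟩

lemma IsPrimePow.minFac_mul_totient_le {q r : ℕ} (hq : IsPrimePow q) (hr : IsPrimePow r)
    (h : q ∣ r) (hne : q ≠ r) : r.minFac * q.totient ≤ r.totient := by
  obtain ⟨p, l, hp, hl, rfl⟩ := hr
  rw [← Nat.prime_iff] at hp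
  obtain ⟨k, hkl, rfl⟩ := (Nat.dvd_prime_pow hp).1 h
  have hk : 0 < k := Nat.pos_of_ne_zero fun h0 => by
    subst h0
    exact hq.one_lt.ne' (pow_zero p)
  have hlt : k < l := lt_of_le_of_ne hkl fun h => hne (by rw [h])
  rw [hp.pow_minFac hl.ne', Nat.totient_prime_pow hp hk, Nat.totient_prime_pow hp hl,
    ← mul_assoc, ← pow_succ']
  exact Nat.mul_le_mul_right _ (Nat.pow_le_pow_right hp.pos (by omega))

lemma IsPrimePow.eq_of_dvd_of_totient_eq {q r : ℕ} (hq : IsPrimePow q) (hr : IsPrimePow r)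
    (h : q ∣ r) (ht : q.totient = r.totient) : q = r := by
  by_contra hne
  have h1 := hq.minFac_mul_totient_le hr h hne
  have h2 := (Nat.minFac_prime hr.one_lt.ne').two_le
  have h3 := Nat.totient_pos.2 hq.pos
  nlinarith

lemma IsPrimePow.dvd_or_dvd_of_not_coprime {q r : ℕ} (hq : IsPrimePow q) (hr : IsPrimePow r)
    (h : ¬ q.Coprime r) : q ∣ r ∨ r ∣ q := by
  obtain ⟨p, k, hp, hk, rfl⟩ := hq
  obtain ⟨p', l, hp', hl, rfl⟩ := hr
  rw [← Nat.prime_iff] at hp hp'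
  have : p = p' := by
    by_contra hne
    exact h (((Nat.coprime_primes hp hp').2 hne).pow k l)
  subst this
  rcases le_total k l with h | h
  · exact Or.inl (pow_dvd_pow p h)
  · exact Or.inr (pow_dvd_pow p h)

lemma IsPrimePow.coprime_of_totient_eq {q r : ℕ} (hq : IsPrimePow q) (hr : IsPrimePow r)
    (hne : q ≠ r) (ht : q.totient = r.totient) : q.Coprime r := by
  by_contra h
  rcases hq.dvd_or_dvd_of_not_coprime hr h with h | h
  · exact hne (hq.eq_of_dvd_of_totient_eq hr h ht)
  · exact hne (hr.eq_of_dvd_of_totient_eq hq h ht.symm).symm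

lemma IsPrimePow.eq_of_totient_eq_of_not_prime {q r : ℕ} (hq : IsPrimePow q) (hr : IsPrimePow r)
    (hq' : ¬ q.Prime) (hr' : ¬ r.Prime) (ht : q.totient = r.totient) : q = r := by
  have key : ∀ {p p' k l : ℕ}, p.Prime → p'.Prime → 0 < k → 0 < l → k ≠ 1 →
      (p ^ k).totient = (p' ^ l).totient → p ≤ p' := by
    intro p p' k l hp hp' hk hl hk1 h
    rw [Nat.totient_prime_pow hp hk, Nat.totient_prime_pow hp' hl] at h
    have h1 : p ∣ p' ^ (l - 1) * (p' - 1) := by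
      rw [← h]
      exact (dvd_pow_self p (by omega)).mul_right _
    rcases (hp.dvd_mul).1 h1 with h2 | h2
    · exact Nat.le_of_dvd hp'.pos (hp.dvd_of_dvd_pow h2)
    · have := Nat.le_of_dvd (Nat.sub_pos_of_lt hp'.one_lt) h2
      omega
  by_contra hne
  have hcop := hq.coprime_of_totient_eq hr hne ht
  obtain ⟨p, k, hp, hk, rfl⟩ := hq
  obtain ⟨p', l, hp', hl, rfl⟩ := hr
  rw [← Nat.prime_iff] at hp hp'
  have hk1 : k ≠ 1 := by rintro rfl; exact hq' (by rwa [pow_one])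
  have hl1 : l ≠ 1 := by rintro rfl; exact hr' (by rwa [pow_one])
  have := le_antisymm (key hp hp' hk hl hk1 ht) (key hp' hp hl hk hl1 ht.symm)
  subst this
  have h1 := Nat.Coprime.eq_one_of_dvd ((Nat.coprime_pow_left_iff hk _ _).1
    ((Nat.coprime_pow_right_iff hl _ _).1 hcop)) dvd_rfl
  exact hp.one_lt.ne' h1

lemma Nat.Prime.eq_of_totient_eq {p q : ℕ} (hp : p.Prime) (hq : q.Prime)
    (h : p.totient = q.totient) : p = q := by
  rw [Nat.totient_prime hp, Nat.totient_prime hq] at h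
  have := hp.one_lt
  have := hq.one_lt
  omega

/-- At most two prime powers share a given totient. -/
lemma IsPrimePow.eq_or_eq_or_eq_of_totient_eq {q r s : ℕ} (hq : IsPrimePow q)
    (hr : IsPrimePow r) (hs : IsPrimePow s) (hqr : q.totient = r.totient)
    (hrs : r.totient = s.totient) : q = r ∨ r = s ∨ q = s := by
  by_cases h1 : q.Prime <;> by_cases h2 : r.Prime <;> by_cases h3 : s.Prime
  · exact Or.inl (h1.eq_of_totient_eq h2 hqr)
  · exact Or.inl (h1.eq_of_totient_eq h2 hqr)
  · exact Or.inr (Or.inr (h1.eq_of_totient_eq h3 (hqr.trans hrs)))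
  · exact Or.inr (Or.inl (hr.eq_of_totient_eq_of_not_prime hs h2 h3 hrs))
  · exact Or.inr (Or.inl (h2.eq_of_totient_eq h3 hrs))
  · exact Or.inr (Or.inr (hq.eq_of_totient_eq_of_not_prime hs h1 h3 (hqr.trans hrs)))
  · exact Or.inl (hq.eq_of_totient_eq_of_not_prime hr h1 h2 hqr)
  · exact Or.inl (hq.eq_of_totient_eq_of_not_prime hr h1 h2 hqr)

lemma totient_lt_of_ncard_UFO_eq_one {i : ℕ} (hi : 1 ≤ i) (h : (UFO i).ncard = 1) :
    (qt i).totient < (qt (i + 1)).totient := by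
  by_contra hlt
  rw [UFO, if_neg hlt, Set.ncard_pair] at h
  · omega
  · intro heq
    have h1 : qt i ∣ Nat.lcm (Lseq (i - 1)) (qt (i + 1)) := heq ▸ (qt_dvd_Lseq_iff hi).2 le_rfl
    rw [(isPrimePow_qt i).dvd_lcm_iff (Lseq_pos _) (isPrimePow_qt _).pos,
      qt_dvd_Lseq_iff hi] at h1
    rcases h1 with h1 | h1
    · omega
    · have h2 := (isPrimePow_qt i).eq_of_dvd_of_totient_eq (isPrimePow_qt _) h1
        (le_antisymm (totient_qt_mono hi (by omega)) (not_lt.1 hlt))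
      have := qt_injOn hi (by omega) h2
      omega

lemma totient_eq_of_ncard_UFO_eq_two {i : ℕ} (hi : 1 ≤ i) (h : (UFO i).ncard = 2) :
    (qt i).totient = (qt (i + 1)).totient := by
  refine le_antisymm (totient_qt_mono hi (by omega)) (not_lt.1 fun hlt => ?_)
  rw [UFO, if_pos hlt, Set.ncard_singleton] at h
  omega

lemma exists_lt_qt_eq {i : ℕ} {q : ℕ} (hq : IsPrimePow q)
    (h : (qt i).totient < q.totient) : ∃ j, i < j ∧ qt j = q := by
  obtain ⟨j, hj, rfl⟩ := exists_qt_eq hq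
  refine ⟨j, ?_, rfl⟩
  by_contra! hji
  exact absurd (totient_qt_mono hj hji) (not_le.2 h)

lemma two_le_totient_of_tie {a b : ℕ} (ha : IsPrimePow a) (hb : IsPrimePow b) (hab : a ≠ b)
    (h : a.totient = b.totient) : 2 ≤ a.totient := by
  have h1 := Nat.totient_pos.2 ha.pos
  have h2 := ha.le_two_mul_totient
  have h3 := hb.le_two_mul_totient
  have h4 := ha.two_le
  have h5 := hb.two_le
  by_contra! h6
  omega

/-- A prime power with the totient following a tie is coprime to the tied prime powers, provided
that its own totient is not shared with a later one. -/
lemma coprime_qt_succ {i : ℕ} (hi : 1 ≤ i) (h2 : (qt i).totient < (qt (i + 1)).totient)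
    (h3 : (qt (i + 1)).totient < (qt (i + 2)).totient) {a : ℕ} (ha : IsPrimePow a)
    (hat : a.totient = (qt i).totient) (ha2 : 2 ≤ a.totient) : a.Coprime (qt (i + 1)) := by
  by_contra hcop
  have hc := isPrimePow_qt (i + 1)
  have hdvd : a ∣ qt (i + 1) := by
    rcases ha.dvd_or_dvd_of_not_coprime hc hcop with h | h
    · exact h
    · have := Nat.le_of_dvd (Nat.totient_pos.2 ha.pos) (Nat.totient_dvd_of_dvd h)
      omega
  have hne : a ≠ qt (i + 1) := by
    rintro rfl
    omega
  have hmul := ha.minFac_mul_totient_le hc hdvd hne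
  obtain ⟨r, hr, hr1, hr2⟩ := Nat.exists_prime_lt_and_le_two_mul (a.totient + 1) (by omega)
  have hrt := Nat.totient_prime hr
  obtain ⟨j, hj, rfl⟩ := exists_lt_qt_eq (i := i) (q := r) hr.isPrimePow (by omega)
  have hcj := totient_qt_mono (i := i + 1) (by omega) (show i + 1 ≤ j by omega)
  have hp := Nat.minFac_prime hc.one_lt.ne'
  have hp2 : (qt (i + 1)).minFac = 2 := by
    by_contra h
    have h4 : 3 ≤ (qt (i + 1)).minFac := by
      have := hp.two_le
      omega
    have := Nat.mul_le_mul_right a.totient h4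
    omega
  rw [hp2] at hmul
  have hodd : qt j % 2 = 1 := Nat.odd_iff.1 (hr.odd_of_ne_two (by omega))
  have hjt : (qt j).totient = (qt (i + 1)).totient := by omega
  rcases (show i + 1 ≤ j by omega).eq_or_lt with h | h
  · subst h
    have := (Nat.minFac_eq_two_iff _).1 hp2
    omega
  · have := totient_qt_mono (i := i + 2) (by omega) (show i + 2 ≤ j by omega)
    omega

theorem statement9 (i : ℕ) (hi : 2 ≤ i)
    (h1 : (UFO (i - 1)).ncard = 2) (h2 : (UFO i).ncard = 1) (h3 : (UFO (i + 1)).ncard = 1)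
    (d : ℕ) (hd : UFO i = {d}) (J : ℕ → ℕ) (hJ : IsInvCount d J) :
    ∀ x : ℝ, Filter.Tendsto
      (fun n : ℕ => ((cnt (fun m =>
          (J m : ℝ) ≤ muSeq i * LL n + x * sigSeq i * Real.sqrt (LL n)) n : ℝ)) / n)
      Filter.atTop
      (nhds (PhiSkew x (-(nuSeq i) / Real.sqrt (sigSeq i ^ 2 + sigAB i 2 1 ^ 2)))) := by
  intro x
  have hab := totient_eq_of_ncard_UFO_eq_two (by omega) h1
  rw [show i - 1 + 1 = i by omega] at hab
  have hbc := totient_lt_of_ncard_UFO_eq_one (by omega) h2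
  have hcd := totient_lt_of_ncard_UFO_eq_one (by omega) h3
  have hd' : Lseq i = d := by
    rw [UFO, if_pos hbc] at hd
    exact Set.singleton_injective hd
  subst hd'
  have hne : qt (i - 1) ≠ qt i := fun h => by
    have := qt_injOn (by omega) (by omega) h
    omega
  have ha := isPrimePow_qt (i - 1)
  have hb := isPrimePow_qt i
  have hc := isPrimePow_qt (i + 1)
  have ha2 := two_le_totient_of_tie ha hb hne hab
  have hF : (2 : ℝ) ≤ phiQ i := by
    rw [phiQ, ← hab]
    exact_mod_cast ha2
  have hFG : phiQ i < phiQ (i + 1) := Nat.cast_lt.2 hbc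
  have hs : 0 < 1 / phiQ i + 1 / phiQ (i + 1) - 2 / (phiQ i * phiQ (i + 1)) := by
    have h4 : 1 / phiQ i + 1 / phiQ (i + 1) - 2 / (phiQ i * phiQ (i + 1)) =
        (phiQ i + phiQ (i + 1) - 2) / (phiQ i * phiQ (i + 1)) := by
      have := (by linarith : (0 : ℝ) < phiQ i).ne'
      have := (by linarith : (0 : ℝ) < phiQ (i + 1)).ne'
      field_simp
      ring
    rw [h4]
    exact div_pos (by linarith) (mul_pos (by linarith) (by linarith))
  have hs' : 0 < 1 / phiQ i ^ 2 + 1 / phiQ (i + 1) ^ 1 - 2 / (phiQ i * phiQ (i + 1)) := by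
    have h4 : 1 / phiQ i ^ 2 + 1 / phiQ (i + 1) ^ 1 - 2 / (phiQ i * phiQ (i + 1)) =
        (phiQ i * (phiQ i - 2) + phiQ (i + 1)) / (phiQ i ^ 2 * phiQ (i + 1)) := by
      have := (by linarith : (0 : ℝ) < phiQ i).ne'
      have := (by linarith : (0 : ℝ) < phiQ (i + 1)).ne'
      field_simp
      ring
    rw [h4]
    exact div_pos (by nlinarith) (mul_pos (by positivity) (by linarith))
  have hν : 0 < 1 / phiQ i * (1 - 1 / phiQ i) := by
    have h4 : 1 / phiQ i < 1 := by
      rw [div_lt_one (by linarith)]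
      linarith
    exact mul_pos (by positivity) (by linarith)
  have hσ : 0 < sigSeq i := Real.sqrt_pos.2 hs
  have hσ2 : sigSeq i ^ 2 = _ := Real.sq_sqrt hs.le
  have hς2 : sigAB i 2 1 ^ 2 = _ := Real.sq_sqrt hs'.le
  have hν2 : nuSeq i ^ 2 = _ := Real.sq_sqrt hν.le
  have hν0 : 0 < nuSeq i := Real.sqrt_pos.2 hν
  have hς : 0 < sigAB i 2 1 ^ 2 := by rw [hς2]; exact hs'
  have hrel : nuSeq i ^ 2 = sigSeq i ^ 2 - sigAB i 2 1 ^ 2 := by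
    rw [hν2, hσ2, hς2]
    ring
  obtain ⟨ρ, hρ⟩ : ∃ ρ, ρ = sigAB i 2 1 ^ 2 / sigSeq i ^ 2 := ⟨_, rfl⟩
  have hσ2pos : 0 < sigSeq i ^ 2 := by positivity
  have hρ0 : 0 < ρ := hρ ▸ div_pos hς hσ2pos
  have hρ1 : ρ < 1 := by
    rw [hρ, div_lt_one hσ2pos]
    nlinarith
  have hτ0 : 0 < 1 - ρ ^ 2 := by nlinarith
  have hρσ : ρ * sigSeq i ^ 2 = sigAB i 2 1 ^ 2 := by
    rw [hρ, div_mul_cancel₀ _ hσ2pos.ne']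
  have D : PairData (qt (i - 1)) (qt i) (qt (i + 1)) (phiQ i) (phiQ (i + 1)) (muSeq i) (sigSeq i)
      ρ (Real.sqrt (1 - ρ ^ 2)) :=
    { ha := ha.pos
      hb := hb.pos
      hc := hc.pos
      hab := ha.coprime_of_totient_eq hb hne hab
      hac := coprime_qt_succ (by omega) hbc hcd ha hab ha2
      hbc := coprime_qt_succ (by omega) hbc hcd hb rfl (hab ▸ ha2)
      hFa := by rw [hab, phiQ]
      hFb := rfl
      hGc := rfl
      hμ := rfl
      hσ := hσ
      hσ2 := hσ2
      hρ := by rw [hρσ, hς2, pow_one]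
      hρ1 := hρ1.le
      hτ := Real.sqrt_pos.2 hτ0
      hτ2 := Real.sq_sqrt hτ0.le }
  have hα : (1 - ρ) / Real.sqrt (1 - ρ ^ 2) =
      nuSeq i / Real.sqrt (sigSeq i ^ 2 + sigAB i 2 1 ^ 2) := by
    have hpos : 0 < sigSeq i ^ 2 + sigAB i 2 1 ^ 2 := by positivity
    refine (sq_eq_sq₀ (div_nonneg (by linarith) (Real.sqrt_nonneg _))
      (div_nonneg hν0.le (Real.sqrt_nonneg _))).1 ?_
    rw [div_pow, div_pow, Real.sq_sqrt hτ0.le, Real.sq_sqrt hpos.le, hrel,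
      div_eq_div_iff hτ0.ne' hpos.ne', ← hρσ]
    ring
  rw [neg_div, ← hα]
  refine D.tendsto_cnt_invCount hJ (Lseq_pos i) ha hb hc
    ((qt_dvd_Lseq_iff (by omega)).2 (by omega)) ((qt_dvd_Lseq_iff (by omega)).2 le_rfl)
    (fun h => ?_) (hab ▸ hbc) hbc (fun q hq hqd => ?_) (fun q hq hqd => ?_) x
  · have := (qt_dvd_Lseq_iff (by omega)).1 h
    omega
  · obtain ⟨j, hj, rfl⟩ := exists_qt_eq hq
    have hji := (qt_dvd_Lseq_iff hj).1 hqd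
    by_contra! hnot
    have hle := totient_qt_mono hj hji
    rcases hq.eq_or_eq_or_eq_of_totient_eq ha hb (by omega) hab with h | h | h
    · exact hnot.1 h
    · exact hne h
    · exact hnot.2.1 h
  · obtain ⟨j, hj, rfl⟩ := exists_qt_eq hq
    rw [qt_dvd_Lseq_iff hj, not_le] at hqd
    rcases (show i + 1 ≤ j by omega).eq_or_lt with rfl | h
    · exact Or.inl rfl
    · exact Or.inr (hcd.trans_le (totient_qt_mono (by omega) (show i + 1 + 1 ≤ j by omega)))

end
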